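/- Fix integers 0 < n ≤ d. Let μ be a Radon measure on ℝ^d with nonempty support Σ that is doubling and n-asymptotically optimally doubling, let η > 0 and let K ⊂ ℝ^d be compact. Then there exists δ₁ > 0 with the following property: if x₀ ∈ Σ∩K, r > 0, B(x₀,r) ⊆ K and β^n_μ(B(x₀,r)) ≤ δ₁, then bβ^n_μ(B(x₀, 2^{−k} r)) ≤ η for every integer k ≥ 0. -/

import Mathlib

open MeasureTheory Metric Filter Set

noncomputable section

abbrev Euc (d : ℕ) : Type := EuclideanSpace ℝ (Fin d)

/-- The support of a measure: points all of whose closed balls have positive measure. -/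
def msupport {d : ℕ} (μ : Measure (Euc d)) : Set (Euc d) :=
  {x | ∀ r : ℝ, 0 < r → 0 < μ (Metric.closedBall x r)}

/-- `φ` is a distribution function of the uniformly distributed measure `μ`. -/
def IsDistributionFunction {d : ℕ} (μ : Measure (Euc d)) (φ : ℝ → ENNReal) : Prop :=
  (msupport μ).Nonempty ∧
  (∀ r : ℝ, 0 < r → 0 < φ r ∧ φ r < ⊤) ∧
  (∀ x ∈ msupport μ, ∀ r : ℝ, 0 < r → μ (Metric.closedBall x r) = φ r)

/-- `μ` is uniformly distributed. -/
def UniformlyDistributed {d : ℕ} (μ : Measure (Euc d)) : Prop :=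
  ∃ φ : ℝ → ENNReal, IsDistributionFunction μ φ

/-- `dim₀ μ = n` : the limit of `φ(r)/rⁿ` as `r → 0⁺` exists, is finite and positive. -/
def HasDim0 (φ : ℝ → ENNReal) (n : ℕ) : Prop :=
  ∃ c : ℝ, 0 < c ∧
    Filter.Tendsto (fun r : ℝ => (φ r).toReal / r ^ n) (nhdsWithin 0 (Set.Ioi 0)) (nhds c)

/-- `dim_∞ μ = p` : the limit of `φ(r)/r^p` as `r → ∞` exists, is finite and positive. -/
def HasDimInfty (φ : ℝ → ENNReal) (p : ℕ) : Prop :=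
  ∃ c : ℝ, 0 < c ∧
    Filter.Tendsto (fun r : ℝ => (φ r).toReal / r ^ p) Filter.atTop (nhds c)

/-- The affine `n`-planes of `ℝ^d`. -/
def nPlanes (d n : ℕ) : Set (AffineSubspace ℝ (Euc d)) :=
  {L | (L : Set (Euc d)).Nonempty ∧ Module.finrank ℝ L.direction = n}

/-- Jones' beta number `β^n_μ(B(x,r))`. -/
def jonesBeta {d : ℕ} (n : ℕ) (μ : Measure (Euc d)) (x : Euc d) (r : ℝ) : ℝ :=
  ⨅ L : nPlanes d n,
    ⨆ y : (msupport μ ∩ Metric.closedBall x r : Set (Euc d)),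
      Metric.infDist y.1 (L.1 : Set (Euc d)) / r

/-- The bilateral beta number `bβ^n_μ(B(x,r))`. -/
def bilateralBeta {d : ℕ} (n : ℕ) (μ : Measure (Euc d)) (x : Euc d) (r : ℝ) : ℝ :=
  ⨅ L : nPlanes d n,
    ((⨆ y : (msupport μ ∩ Metric.closedBall x r : Set (Euc d)),
        Metric.infDist y.1 (L.1 : Set (Euc d)) / r) +
     (⨆ p : ((L.1 : Set (Euc d)) ∩ Metric.closedBall x r : Set (Euc d)),
        Metric.infDist p.1 (msupport μ) / r))

/-- `μ` is doubling with constant `C`. -/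
def DoublingWith {d : ℕ} (μ : Measure (Euc d)) (C : ℝ) : Prop :=
  ∀ x ∈ msupport μ, ∀ r : ℝ, 0 < r →
    μ (Metric.closedBall x (2 * r)) ≤ ENNReal.ofReal C * μ (Metric.closedBall x r)

/-- `μ` is doubling. -/
def Doubling {d : ℕ} (μ : Measure (Euc d)) : Prop :=
  ∃ C : ℝ, 0 < C ∧ DoublingWith μ C

/-- Weak convergence of a sequence of Radon measures. -/
def WeakConv {d : ℕ} (μs : ℕ → Measure (Euc d)) (μ : Measure (Euc d)) : Prop :=
  ∀ f : Euc d → ℝ, Continuous f → HasCompactSupport f →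
    Filter.Tendsto (fun j => ∫ x, f x ∂(μs j)) Filter.atTop (nhds (∫ x, f x ∂μ))

/-- `μ` is `n`-asymptotically optimally doubling. -/
def AsympOptDoubling {d : ℕ} (n : ℕ) (μ : Measure (Euc d)) : Prop :=
  ∀ K : Set (Euc d), IsCompact K → K ⊆ msupport μ →
    ∀ t : ℝ, t ∈ Set.Icc (1/2 : ℝ) 1 →
      Filter.Tendsto
        (fun r : ℝ => ⨆ x : K,
          |(μ (Metric.closedBall x.1 (t * r)) / μ (Metric.closedBall x.1 r)).toReal - t ^ n|)
        (nhdsWithin 0 (Set.Ioi 0)) (nhds 0)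

/-- Truncated `n`-Riesz transform `R_{r,s}μ(z)`. -/
def rieszT {d : ℕ} (n : ℕ) (μ : Measure (Euc d)) (z : Euc d) (r s : ℝ) : Euc d :=
  ∫ y in {y : Euc d | r ≤ dist y z ∧ dist y z ≤ s}, (‖y - z‖ ^ (n + 1))⁻¹ • (y - z) ∂μ

/-- `μ` is locally Ahlfors `n`-regular. -/
def LocallyAhlforsRegular {d : ℕ} (n : ℕ) (μ : Measure (Euc d)) : Prop :=
  ∀ K : Set (Euc d), IsCompact K → ∃ c : ℝ, 0 < c ∧ ∃ rK : ℝ, 0 < rK ∧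
    ∀ x ∈ msupport μ ∩ K, ∀ r : ℝ, 0 < r → r ≤ rK →
      ENNReal.ofReal (c⁻¹ * r ^ n) ≤ μ (Metric.closedBall x r) ∧
      μ (Metric.closedBall x r) ≤ ENNReal.ofReal (c * r ^ n)

/-- `μ` is locally uniformly `n`-rectifiable. -/
def LocUnifRectifiable {d : ℕ} (n : ℕ) (μ : Measure (Euc d)) : Prop :=
  LocallyAhlforsRegular n μ ∧
  ∀ K : Set (Euc d), IsCompact K →
    ∃ RK θK MK : ℝ, 0 < RK ∧ 0 < θK ∧ 0 < MK ∧
      ∀ x ∈ msupport μ ∩ K, ∀ R : ℝ, 0 < R → R ≤ RK →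
        ∃ g : EuclideanSpace ℝ (Fin n) → Euc d,
          LipschitzWith (Real.toNNReal MK) g ∧
          ENNReal.ofReal (θK * R ^ n) ≤ μ (Metric.closedBall x R ∩ Set.range g)

namespace FlatStab

open Topology Module
open scoped CompactlySupported RealInnerProductSpace

section Preliminaries

/-- A fixed nonprincipal ultrafilter on `ℕ`, seen as a filter. -/
abbrev UF : Filter ℕ := (hyperfilter ℕ : Ultrafilter ℕ)

lemma UF_le : UF ≤ atTop := Nat.hyperfilter_le_atTop

lemma uf_not {p : ℕ → Prop} (h : ¬ ∀ᶠ j in UF, p j) : ∀ᶠ j in UF, ¬ p j :=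
  Ultrafilter.eventually_not.2 h

lemma uf_compact {X : Type*} [TopologicalSpace X] {K : Set X} (hK : IsCompact K) {f : ℕ → X}
    (hf : ∀ᶠ j in UF, f j ∈ K) : ∃ x ∈ K, Tendsto f UF (𝓝 x) := by
  have := hK.ultrafilter_le_nhds ((hyperfilter ℕ).map f) (by rw [Ultrafilter.coe_map, le_principal_iff]; exact hf)
  exact this

lemma uf_bdd {E : Type*} [NormedAddCommGroup E] [ProperSpace E] {f : ℕ → E} {C : ℝ}
    (hf : ∀ᶠ j in UF, ‖f j‖ ≤ C) : ∃ x, ‖x‖ ≤ C ∧ Tendsto f UF (𝓝 x) := by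
  obtain ⟨x, hx, h⟩ := uf_compact (isCompact_closedBall (0 : E) C)
    (f := f) (hf.mono fun j hj => by simpa using hj)
  exact ⟨x, by simpa using hx, h⟩

lemma uf_one_div : Tendsto (fun j : ℕ => 1 / ((j : ℝ) + 1)) UF (𝓝 0) :=
  tendsto_one_div_add_atTop_nhds_zero_nat.mono_left UF_le

variable {d : ℕ}

lemma mem_msupport_iff {μ : Measure (Euc d)} {x : Euc d} :
    x ∈ msupport μ ↔ ∀ r : ℝ, 0 < r → 0 < μ (closedBall x r) := Iff.rfl

lemma isClosed_msupport (μ : Measure (Euc d)) : IsClosed (msupport μ) := by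
  rw [← isSeqClosed_iff_isClosed]
  intro u x hu hx r hr
  obtain ⟨j, hj⟩ := ((Metric.tendsto_nhds.1 hx) (r / 2) (by positivity)).exists
  refine (hu j (r / 2) (by positivity)).trans_le (measure_mono (closedBall_subset_closedBall' ?_))
  linarith

lemma measure_compl_msupport (μ : Measure (Euc d)) : μ (msupport μ)ᶜ = 0 := by
  apply measure_null_of_locally_null
  intro x hx
  simp only [mem_compl_iff, mem_msupport_iff, not_forall, not_lt, nonpos_iff_eq_zero] at hx
  obtain ⟨r, hr, h⟩ := hx
  exact ⟨closedBall x r, mem_nhdsWithin_of_mem_nhds (closedBall_mem_nhds x hr), h⟩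

lemma ae_mem_msupport (μ : Measure (Euc d)) : ∀ᵐ x ∂μ, x ∈ msupport μ :=
  measure_compl_msupport μ

lemma measure_eq_zero_of_disjoint {μ : Measure (Euc d)} {s : Set (Euc d)}
    (h : Disjoint s (msupport μ)) : μ s = 0 :=
  measure_mono_null h.subset_compl_right (measure_compl_msupport μ)

lemma infDist_le_of_measure_pos {μ : Measure (Euc d)} {x : Euc d} {r : ℝ}
    (h : 0 < μ (closedBall x r)) : infDist x (msupport μ) ≤ r := by
  by_contra hc
  push Not at hc
  refine h.ne' (measure_eq_zero_of_disjoint ?_)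
  rw [Set.disjoint_left]
  intro y hy hys
  have := infDist_le_dist_of_mem (x := x) hys
  rw [mem_closedBall, dist_comm] at hy
  linarith

lemma exists_nearest {S : Set (Euc d)} (hS : IsClosed S) (hne : S.Nonempty) (x : Euc d) :
    ∃ y ∈ S, dist x y = infDist x S := by
  obtain ⟨y, hy, h⟩ := hS.exists_infDist_eq_dist hne x
  exact ⟨y, hy, h.symm⟩

/-- If the distances to a sequence of closed sets tend to zero, the point is a limit of points. -/
lemma exists_seq_of_infDist {S : ℕ → Set (Euc d)} (hS : ∀ j, IsClosed (S j))
    (h0 : ∀ j, (0 : Euc d) ∈ S j) {x : Euc d}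
    (hx : Tendsto (fun j => infDist x (S j)) UF (𝓝 0)) :
    ∃ y : ℕ → Euc d, (∀ j, y j ∈ S j) ∧ (∀ j, ‖y j - x‖ ≤ ‖x‖) ∧ Tendsto y UF (𝓝 x) := by
  choose y hy hxy using fun j => exists_nearest (hS j) ⟨0, h0 j⟩ x
  refine ⟨y, hy, fun j => ?_, ?_⟩
  · rw [← dist_eq_norm, dist_comm, hxy]
    simpa using infDist_le_dist_of_mem (x := x) (h0 j)
  · rw [tendsto_iff_dist_tendsto_zero]
    refine hx.congr fun j => ?_
    rw [← hxy, dist_comm]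

lemma infDist_tendsto_of_seq {S : ℕ → Set (Euc d)} {y : ℕ → Euc d} (hy : ∀ j, y j ∈ S j)
    {x : Euc d} (hx : Tendsto y UF (𝓝 x)) : Tendsto (fun j => infDist x (S j)) UF (𝓝 0) := by
  rw [tendsto_iff_dist_tendsto_zero] at hx
  refine squeeze_zero (fun _ => infDist_nonneg) (fun j => ?_) hx
  rw [dist_comm]
  exact infDist_le_dist_of_mem (hy j)

/-- `ν` gives mass `r ^ n` to every ball of radius `r` centred on its support. -/
structure NUnif (n : ℕ) (ν : Measure (Euc d)) : Prop where
  zero_mem : (0 : Euc d) ∈ msupport ν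
  ball : ∀ x ∈ msupport ν, ∀ r : ℝ, 0 < r → ν (closedBall x r) = ENNReal.ofReal (r ^ n)

lemma NUnif.locFin {n : ℕ} {ν : Measure (Euc d)} (h : NUnif n ν) : IsLocallyFiniteMeasure ν := by
  refine ⟨fun x => ⟨closedBall 0 (‖x‖ + 1), ?_, ?_⟩⟩
  · refine mem_of_superset (closedBall_mem_nhds x one_pos) (closedBall_subset_closedBall' ?_)
    rw [dist_zero_right]; linarith
  · rw [h.ball 0 h.zero_mem _ (by positivity)]
    exact ENNReal.ofReal_lt_top

/-- A test function between the indicators of two concentric balls. -/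
lemma exists_cutoff (x : Euc d) {r r' : ℝ} (hr : r < r') :
    ∃ f : C_c(Euc d, ℝ), (∀ y, 0 ≤ f y ∧ f y ≤ 1) ∧ (∀ y ∈ closedBall x r, f y = 1) ∧
      (∀ y, y ∉ closedBall x r' → f y = 0) ∧ tsupport f ⊆ closedBall x r' := by
  have hpos : 0 < r' - r := by linarith
  let g : Euc d → ℝ := fun y => max 0 (min 1 ((r' - dist y x) / (r' - r)))
  have hgc : Continuous g := by fun_prop
  have hsupp : Function.support g ⊆ closedBall x r' := by
    intro y hy
    by_contra hc
    rw [mem_closedBall, not_le] at hc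
    apply hy
    have : (r' - dist y x) / (r' - r) ≤ 0 := div_nonpos_of_nonpos_of_nonneg (by linarith) hpos.le
    simp only [g]
    rw [max_eq_left]
    exact (min_le_right _ _).trans this
  have hts : tsupport g ⊆ closedBall x r' := closure_minimal hsupp isClosed_closedBall
  have hcs : HasCompactSupport g := (isCompact_closedBall x r').of_isClosed_subset
    (isClosed_tsupport g) hts
  refine ⟨⟨⟨g, hgc⟩, hcs⟩, fun y => ⟨le_max_left _ _, max_le zero_le_one (min_le_left _ _)⟩,
    fun y hy => ?_, fun y hy => ?_, hts⟩
  · have : 1 ≤ (r' - dist y x) / (r' - r) := by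
      rw [le_div_iff₀ hpos]; rw [mem_closedBall] at hy; linarith
    change max 0 (min 1 _) = (1 : ℝ)
    rw [min_eq_left this]; simp
  · by_contra h
    exact hy (hsupp h)

/-- Vague compactness along the ultrafilter, phrased through balls. -/
lemma exists_vague_limit (M : ℕ → Measure (Euc d)) [∀ j, IsLocallyFiniteMeasure (M j)]
    (hM : ∀ R : ℝ, ∃ C : ℝ, ∀ᶠ j in UF, (M j).real (closedBall 0 R) ≤ C) :
    ∃ N : Measure (Euc d), ∀ (x : Euc d) (r r' c : ℝ), r < r' →
      ((∀ᶠ j in UF, (M j).real (closedBall x r') ≤ c) → N (closedBall x r) ≤ ENNReal.ofReal c) ∧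
      ((∀ᶠ j in UF, c ≤ (M j).real (closedBall x r)) →
        ENNReal.ofReal c ≤ N (closedBall x r')) := by
  have hintg : ∀ (j : ℕ) (f : C_c(Euc d, ℝ)), Integrable f (M j) := fun j f =>
    f.continuous.integrable_of_hasCompactSupport f.hasCompactSupport
  have hlim : ∀ f : C_c(Euc d, ℝ), ∃ l : ℝ, Tendsto (fun j => ∫ x, f x ∂(M j)) UF (𝓝 l) := by
    intro f
    obtain ⟨R, hR⟩ := f.hasCompactSupport.isCompact.isBounded.subset_closedBall 0
    obtain ⟨B, hB⟩ := f.hasCompactSupport.exists_bound_of_continuous f.continuous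
    obtain ⟨C, hC⟩ := hM R
    have hB0 : 0 ≤ B := (norm_nonneg _).trans (hB 0)
    have hbd : ∀ᶠ j in UF, ‖∫ x, f x ∂(M j)‖ ≤ B * C := by
      filter_upwards [hC] with j hj
      have h1 : ∫ x, f x ∂(M j) = ∫ x in closedBall 0 R, f x ∂(M j) := by
        rw [setIntegral_eq_integral_of_forall_compl_eq_zero]
        intro x hx
        by_contra h
        exact hx (hR (subset_tsupport _ h))
      rw [h1]
      refine (norm_setIntegral_le_of_norm_le_const (C := B)
        measure_closedBall_lt_top (fun x _ => hB x)).trans ?_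
      gcongr
    obtain ⟨l, -, hl⟩ := uf_bdd hbd
    exact ⟨l, hl⟩
  choose Λ hΛ using hlim
  let L : C_c(Euc d, ℝ) →ₗ[ℝ] ℝ :=
    { toFun := Λ
      map_add' := fun f g => by
        refine tendsto_nhds_unique (hΛ (f + g)) (((hΛ f).add (hΛ g)).congr fun j => ?_)
        rw [← integral_add (hintg j f) (hintg j g)]
        rfl
      map_smul' := fun c f => by
        refine tendsto_nhds_unique (hΛ (c • f)) (((hΛ f).const_mul c).congr fun j => ?_)
        rw [← integral_const_mul]
        rfl }
  let P : C_c(Euc d, ℝ) →ₚ[ℝ] ℝ := PositiveLinearMap.mk₀ L fun f hf =>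
    ge_of_tendsto (hΛ f) (Eventually.of_forall fun j => integral_nonneg fun x => hf x)
  refine ⟨RealRMK.rieszMeasure P, fun x r r' c hr => ?_⟩
  obtain ⟨f, h01, h1, h0, hts⟩ := exists_cutoff x hr
  constructor
  · intro h
    refine (RealRMK.rieszMeasure_le_of_eq_one P (fun y => (h01 y).1)
      (isCompact_closedBall x r) h1).trans (ENNReal.ofReal_le_ofReal ?_)
    refine le_of_tendsto (hΛ f) (h.mono fun j hj => le_trans ?_ hj)
    rw [← integral_indicator_one measurableSet_closedBall]
    refine integral_mono (hintg j f) ?_ fun y => ?_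
    · exact (integrable_indicator_iff measurableSet_closedBall).2
        (integrableOn_const (C := (1 : ℝ)) measure_closedBall_lt_top.ne)
    · by_cases hy : y ∈ closedBall x r'
      · simpa [indicator_of_mem hy] using (h01 y).2
      · simp [indicator_of_notMem hy, h0 y hy]
  · intro h
    refine le_trans (ENNReal.ofReal_le_ofReal ?_)
      (RealRMK.le_rieszMeasure_tsupport_subset P h01 hts)
    refine ge_of_tendsto (hΛ f) (h.mono fun j hj => le_trans hj ?_)
    rw [← integral_indicator_one measurableSet_closedBall]
    refine integral_mono ?_ (hintg j f) fun y => ?_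
    · exact (integrable_indicator_iff measurableSet_closedBall).2
        (integrableOn_const (C := (1 : ℝ)) measure_closedBall_lt_top.ne)
    · by_cases hy : y ∈ closedBall x r
      · simp [indicator_of_mem hy, h1 y hy]
      · simpa [indicator_of_notMem hy] using (h01 y).1

end Preliminaries

variable {d n : ℕ}

lemma exists_limit_of_balls (M : ℕ → Measure (Euc d)) [∀ j, IsLocallyFiniteMeasure (M j)]
    (h0 : ∀ j, (0 : Euc d) ∈ msupport (M j))
    (hU : ∀ (y : ℕ → Euc d) (C : ℝ), (∀ j, y j ∈ msupport (M j)) → (∀ j, ‖y j‖ ≤ C) →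
      ∀ r : ℝ, 0 < r → Tendsto (fun j => (M j).real (closedBall (y j) r)) UF (𝓝 (r ^ n))) :
    ∃ N : Measure (Euc d), NUnif n N ∧
      ∀ x, x ∈ msupport N ↔ Tendsto (fun j => infDist x (msupport (M j))) UF (𝓝 0) := by
  have hM : ∀ R : ℝ, ∃ C : ℝ, ∀ᶠ j in UF, (M j).real (closedBall 0 R) ≤ C := by
    intro R
    refine ⟨(max R 1) ^ n + 1, ?_⟩
    have := hU (fun _ => 0) 0 h0 (by simp) (max R 1) (by positivity)
    filter_upwards [this.eventually (gt_mem_nhds (lt_add_one _))] with j hj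
    refine le_trans (measureReal_mono (closedBall_subset_closedBall (le_max_left _ _))
      measure_closedBall_lt_top.ne) hj.le
  obtain ⟨N, hN⟩ := exists_vague_limit M hM
  have hball : ∀ x, Tendsto (fun j => infDist x (msupport (M j))) UF (𝓝 0) →
      ∀ r : ℝ, 0 < r → N (closedBall x r) = ENNReal.ofReal (r ^ n) := by
    intro x hx r hr
    obtain ⟨y, hy, hyb, hyx⟩ := exists_seq_of_infDist (fun j => isClosed_msupport (M j)) h0 hx
    have hyC : ∀ j, ‖y j‖ ≤ 2 * ‖x‖ := fun j => by
      have := norm_add_le (y j - x) x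
      rw [sub_add_cancel] at this
      linarith [hyb j]
    have hlim := hU y _ hy hyC
    have hc : Tendsto (fun s : ℝ => s ^ n) (𝓝 r) (𝓝 (r ^ n)) :=
      (continuous_pow n).tendsto r
    apply le_antisymm
    · have ht : Tendsto ENNReal.ofReal (𝓝[>] (r ^ n)) (𝓝 (ENNReal.ofReal (r ^ n))) :=
        (ENNReal.continuous_ofReal.tendsto _).mono_left nhdsWithin_le_nhds
      refine ge_of_tendsto ht ?_
      filter_upwards [self_mem_nhdsWithin] with c hcr
      have h1 : ∀ᶠ s in 𝓝[>] r, s ^ n < c ∧ r < s :=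
        ((hc.mono_left nhdsWithin_le_nhds).eventually (gt_mem_nhds hcr)).and self_mem_nhdsWithin
      obtain ⟨s, hsc, hrs⟩ := h1.exists
      refine (hN x r ((r + s) / 2) c (by linarith)).1 ?_
      filter_upwards [(hlim s (hr.trans hrs)).eventually (gt_mem_nhds hsc),
        (Metric.tendsto_nhds.1 hyx) ((s - r) / 2) (by linarith)] with j hj hd
      refine le_trans (measureReal_mono (closedBall_subset_closedBall' ?_)
        measure_closedBall_lt_top.ne) hj.le
      rw [dist_comm] at hd
      linarith
    · have ht : Tendsto ENNReal.ofReal (𝓝[<] (r ^ n)) (𝓝 (ENNReal.ofReal (r ^ n))) :=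
        (ENNReal.continuous_ofReal.tendsto _).mono_left nhdsWithin_le_nhds
      refine le_of_tendsto ht ?_
      filter_upwards [self_mem_nhdsWithin] with c hcr
      have h1 : ∀ᶠ s in 𝓝[<] r, (c < s ^ n ∧ 0 < s) ∧ s < r :=
        (((hc.mono_left nhdsWithin_le_nhds).eventually (lt_mem_nhds hcr)).and
          (nhdsWithin_le_nhds (lt_mem_nhds hr))).and self_mem_nhdsWithin
      obtain ⟨s, ⟨hsc, hs0⟩, hrs⟩ := h1.exists
      refine (hN x ((r + s) / 2) r c (by linarith)).2 ?_
      filter_upwards [(hlim s hs0).eventually (lt_mem_nhds hsc),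
        (Metric.tendsto_nhds.1 hyx) ((r - s) / 2) (by linarith)] with j hj hd
      refine hj.le.trans (measureReal_mono (closedBall_subset_closedBall' ?_)
        measure_closedBall_lt_top.ne)
      linarith
  have hsupp : ∀ x, x ∈ msupport N ↔
      Tendsto (fun j => infDist x (msupport (M j))) UF (𝓝 0) := by
    intro x
    constructor
    · intro hx
      by_contra hc
      rw [Metric.tendsto_nhds] at hc
      push Not at hc
      obtain ⟨ε, hε, h⟩ := hc
      have h2 : ∀ᶠ j in UF, (M j).real (closedBall x (ε / 2)) ≤ 0 := by
        filter_upwards [uf_not (p := fun j => dist (infDist x (msupport (M j))) 0 < ε)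
          (by simpa using h)] with j hj
        rw [Real.dist_eq, sub_zero, abs_of_nonneg infDist_nonneg, not_lt] at hj
        have : M j (closedBall x (ε / 2)) = 0 := by
          by_contra hne
          have := infDist_le_of_measure_pos (pos_iff_ne_zero.2 hne)
          linarith
        simp [measureReal_def, this]
      have := (hN x (ε / 4) (ε / 2) 0 (by linarith)).1 h2
      exact (hx (ε / 4) (by positivity)).ne' (by simpa using this)
    · intro hx r hr
      rw [hball x hx r hr]
      simpa using pow_pos hr n
  refine ⟨N, ⟨?_, fun x hx => hball x ((hsupp x).1 hx)⟩, hsupp⟩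
  rw [hsupp]
  exact infDist_tendsto_of_seq h0 tendsto_const_nhds

/-- Blow up of `μ` at `x` with scale `ρ`, normalised on the unit ball. -/
def rescale (μ : Measure (Euc d)) (x : Euc d) (ρ : ℝ) : Measure (Euc d) :=
  (μ (closedBall x ρ))⁻¹ • μ.map (fun y => ρ⁻¹ • (y - x))

lemma rescale_closedBall (μ : Measure (Euc d)) (x : Euc d) {ρ : ℝ} (hρ : 0 < ρ) (y : Euc d)
    (r : ℝ) : rescale μ x ρ (closedBall y r) =
      (μ (closedBall x ρ))⁻¹ * μ (closedBall (x + ρ • y) (ρ * r)) := by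
  have hm : Measurable (fun y : Euc d => ρ⁻¹ • (y - x)) := by fun_prop
  rw [rescale, Measure.smul_apply, Measure.map_apply hm measurableSet_closedBall, smul_eq_mul]
  congr 2
  ext z
  simp only [mem_preimage, mem_closedBall, dist_eq_norm]
  have : z - (x + ρ • y) = ρ • (ρ⁻¹ • (z - x) - y) := by
    rw [smul_sub, smul_inv_smul₀ hρ.ne']; abel
  rw [this, norm_smul, Real.norm_of_nonneg hρ.le]
  exact (mul_le_mul_iff_right₀ hρ).symm

lemma rescale_real (μ : Measure (Euc d)) (x : Euc d) {ρ : ℝ} (hρ : 0 < ρ) (y : Euc d)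
    (r : ℝ) : (rescale μ x ρ).real (closedBall y r) =
      μ.real (closedBall (x + ρ • y) (ρ * r)) / μ.real (closedBall x ρ) := by
  rw [measureReal_def, rescale_closedBall μ x hρ, ENNReal.toReal_mul, ENNReal.toReal_inv,
    div_eq_inv_mul]
  rfl

lemma rescale_locFin (μ : Measure (Euc d)) [IsLocallyFiniteMeasure μ] {x : Euc d}
    (hx : x ∈ msupport μ) {ρ : ℝ} (hρ : 0 < ρ) : IsLocallyFiniteMeasure (rescale μ x ρ) := by
  refine ⟨fun y => ⟨closedBall y 1, closedBall_mem_nhds y one_pos, ?_⟩⟩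
  rw [rescale_closedBall μ x hρ]
  exact ENNReal.mul_lt_top (ENNReal.inv_lt_top.2 (hx ρ hρ)) measure_closedBall_lt_top

lemma mem_msupport_rescale (μ : Measure (Euc d)) [IsLocallyFiniteMeasure μ] (x : Euc d)
    {ρ : ℝ} (hρ : 0 < ρ) (y : Euc d) :
    y ∈ msupport (rescale μ x ρ) ↔ x + ρ • y ∈ msupport μ := by
  have hinv : (μ (closedBall x ρ))⁻¹ ≠ 0 :=
    ENNReal.inv_ne_zero.2 measure_closedBall_lt_top.ne
  simp only [mem_msupport_iff]
  constructor
  · intro h r hr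
    have := h (r / ρ) (by positivity)
    rw [rescale_closedBall μ x hρ, mul_div_cancel₀ _ hρ.ne'] at this
    exact pos_of_mul_pos_right this zero_le
  · intro h r hr
    rw [rescale_closedBall μ x hρ]
    exact ENNReal.mul_pos hinv (h _ (by positivity)).ne'

/-- Asymptotic `n`-uniformity along a sequence of measures, at small scales. -/
def AsympUnif (n : ℕ) (N : ℕ → Measure (Euc d)) : Prop :=
  ∀ (z : ℕ → Euc d) (C : ℝ) (τ : ℕ → ℝ), (∀ j, z j ∈ msupport (N j)) → (∀ j, ‖z j‖ ≤ C) →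
    (∀ j, 0 < τ j) → Tendsto τ UF (𝓝 0) → ∀ r : ℝ, 0 < r →
    Tendsto (fun j => (N j).real (closedBall (z j) (r * τ j)) /
      (N j).real (closedBall (z j) (τ j))) UF (𝓝 (r ^ n))

lemma real_ball_pos {μ : Measure (Euc d)} [IsLocallyFiniteMeasure μ] {x : Euc d}
    (hx : x ∈ msupport μ) {r : ℝ} (hr : 0 < r) : 0 < μ.real (closedBall x r) :=
  ENNReal.toReal_pos (hx r hr).ne' measure_closedBall_lt_top.ne

lemma tendsto_ratio_pow (R : ℝ) (n : ℕ) :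
    Tendsto (fun T : ℝ => ((T + R) / T) ^ n) atTop (𝓝 1) := by
  have h : Tendsto (fun T : ℝ => 1 + R / T) atTop (𝓝 (1 + 0)) :=
    (tendsto_const_nhds.div_atTop tendsto_id).const_add 1
  have h2 := h.pow n
  rw [add_zero, one_pow] at h2
  refine h2.congr' ?_
  filter_upwards [eventually_gt_atTop 0] with T hT
  rw [add_div, div_self hT.ne']

lemma center_change {N : ℕ → Measure (Euc d)} [∀ j, IsLocallyFiniteMeasure (N j)]
    (hN : AsympUnif n N) {z z' : ℕ → Euc d} {C : ℝ} {τ : ℕ → ℝ}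
    (hz : ∀ j, z j ∈ msupport (N j)) (hzC : ∀ j, ‖z j‖ ≤ C)
    (hz' : ∀ j, z' j ∈ msupport (N j)) (hzC' : ∀ j, ‖z' j‖ ≤ C)
    (hτ : ∀ j, 0 < τ j) (hτ0 : Tendsto τ UF (𝓝 0)) {R : ℝ} (hR : 0 ≤ R)
    (hd : ∀ j, dist (z' j) (z j) ≤ R * τ j) :
    ∀ ε : ℝ, 0 < ε → ∀ᶠ j in UF, (N j).real (closedBall (z' j) (τ j)) /
      (N j).real (closedBall (z j) (τ j)) ≤ 1 + ε := by
  intro ε hε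
  obtain ⟨T, hT1, hT⟩ := (((tendsto_ratio_pow R n).eventually
    (gt_mem_nhds (lt_add_of_pos_right 1 hε))).and (eventually_gt_atTop 0)).exists
  have h1 := hN z' C τ hz' hzC' hτ hτ0 T hT
  have h2 := hN z C τ hz hzC hτ hτ0 (T + R) (by linarith)
  have h3 := h2.div h1 (pow_pos hT n).ne'
  rw [← div_pow] at h3
  filter_upwards [h3.eventually (gt_mem_nhds hT1)] with j hj
  refine le_trans ?_ hj.le
  rw [Pi.div_apply]
  have p1 := real_ball_pos (hz j) (hτ j)
  have p2 := real_ball_pos (hz' j) (hτ j)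
  have p3 := real_ball_pos (hz' j) (mul_pos hT (hτ j))
  have hle : (N j).real (closedBall (z' j) (T * τ j)) ≤
      (N j).real (closedBall (z j) ((T + R) * τ j)) := by
    refine measureReal_mono (closedBall_subset_closedBall' ?_) measure_closedBall_lt_top.ne
    linarith [hd j]
  rw [div_div_div_eq, div_le_div_iff₀ p1 (by positivity)]
  nlinarith [mul_le_mul_of_nonneg_left hle (mul_pos p1 p2).le]

lemma center_change_tendsto {N : ℕ → Measure (Euc d)} [∀ j, IsLocallyFiniteMeasure (N j)]
    (hN : AsympUnif n N) {z z' : ℕ → Euc d} {C : ℝ} {τ : ℕ → ℝ}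
    (hz : ∀ j, z j ∈ msupport (N j)) (hzC : ∀ j, ‖z j‖ ≤ C)
    (hz' : ∀ j, z' j ∈ msupport (N j)) (hzC' : ∀ j, ‖z' j‖ ≤ C)
    (hτ : ∀ j, 0 < τ j) (hτ0 : Tendsto τ UF (𝓝 0)) {R : ℝ} (hR : 0 ≤ R)
    (hd : ∀ j, dist (z' j) (z j) ≤ R * τ j) :
    Tendsto (fun j => (N j).real (closedBall (z' j) (τ j)) /
      (N j).real (closedBall (z j) (τ j))) UF (𝓝 1) := by
  have h1 := center_change hN hz hzC hz' hzC' hτ hτ0 hR hd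
  have h2 := center_change hN hz' hzC' hz hzC hτ hτ0 hR
    (fun j => by rw [dist_comm]; exact hd j)
  rw [tendsto_order]
  constructor
  · intro a ha
    rcases le_or_gt a 0 with ha0 | ha0
    · filter_upwards with j
      exact ha0.trans_lt (div_pos (real_ball_pos (hz' j) (hτ j)) (real_ball_pos (hz j) (hτ j)))
    · have : 0 < (a⁻¹ - 1) / 2 := by
        have := (one_lt_inv₀ ha0).2 ha
        linarith
      filter_upwards [h2 _ this] with j hj
      have p1 := real_ball_pos (hz j) (hτ j)
      have p2 := real_ball_pos (hz' j) (hτ j)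
      have h3 : (N j).real (closedBall (z j) (τ j)) / (N j).real (closedBall (z' j) (τ j))
          < a⁻¹ := by linarith
      rw [lt_inv_comm₀ (by positivity) ha0, inv_div] at h3
      exact h3
  · intro a ha
    filter_upwards [h1 ((a - 1) / 2) (by linarith)] with j hj
    linarith

/-- Blow up limits of asymptotically uniform sequences are `n`-uniform. -/
lemma exists_blowup {N : ℕ → Measure (Euc d)} [∀ j, IsLocallyFiniteMeasure (N j)]
    (hN : AsympUnif n N) {z : ℕ → Euc d} {C : ℝ} {τ : ℕ → ℝ}
    (hz : ∀ j, z j ∈ msupport (N j)) (hzC : ∀ j, ‖z j‖ ≤ C)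
    (hτ : ∀ j, 0 < τ j) (hτC : ∀ j, τ j ≤ C) (hτ0 : Tendsto τ UF (𝓝 0)) :
    ∃ M : Measure (Euc d), NUnif n M ∧ ∀ x, x ∈ msupport M ↔
      Tendsto (fun j => infDist x (msupport (rescale (N j) (z j) (τ j)))) UF (𝓝 0) := by
  have : ∀ j, IsLocallyFiniteMeasure (rescale (N j) (z j) (τ j)) :=
    fun j => rescale_locFin (N j) (hz j) (hτ j)
  refine exists_limit_of_balls (fun j => rescale (N j) (z j) (τ j)) (fun j => ?_) ?_
  · rw [mem_msupport_rescale _ _ (hτ j)]; simpa using hz j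
  · intro y D hy hyD r hr
    have hD0 : 0 ≤ D := (norm_nonneg _).trans (hyD 0)
    have hC0 : 0 ≤ C := (norm_nonneg _).trans (hzC 0)
    have hz' : ∀ j, z j + τ j • y j ∈ msupport (N j) := fun j =>
      (mem_msupport_rescale _ _ (hτ j) _).1 (hy j)
    have hn : ∀ j, ‖τ j • y j‖ ≤ D * τ j := fun j => by
      rw [norm_smul, Real.norm_of_nonneg (hτ j).le, mul_comm]
      exact mul_le_mul_of_nonneg_right (hyD j) (hτ j).le
    have hzC' : ∀ j, ‖z j + τ j • y j‖ ≤ C + D * C := fun j =>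
      (norm_add_le _ _).trans (add_le_add (hzC j)
        ((hn j).trans (mul_le_mul_of_nonneg_left (hτC j) hD0)))
    have h1 := hN _ _ τ hz' hzC' hτ hτ0 r hr
    have h2 := center_change_tendsto hN hz
      (fun j => (hzC j).trans (le_add_of_nonneg_right (mul_nonneg hD0 hC0))) hz' hzC' hτ hτ0 hD0
      (fun j => by rw [dist_eq_norm, add_sub_cancel_left]; exact hn j)
    have h3 := h1.mul h2
    rw [mul_one] at h3
    refine h3.congr fun j => ?_
    rw [rescale_real _ _ (hτ j), mul_comm r, div_mul_div_cancel₀]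
    exact (real_ball_pos (hz' j) (hτ j)).ne'

lemma NUnif.asympUnif {ν : Measure (Euc d)} (h : NUnif n ν) : AsympUnif n (fun _ => ν) := by
  intro z C τ hz hzC hτ hτ0 r hr
  refine tendsto_const_nhds.congr fun j => ?_
  have h1 := hτ j
  rw [measureReal_def, measureReal_def, h.ball _ (hz j) _ (hτ j),
    h.ball _ (hz j) _ (mul_pos hr (hτ j)), ENNReal.toReal_ofReal (by positivity),
    ENNReal.toReal_ofReal (by positivity), mul_pow]
  field_simp

lemma AsympUnif.rescale {N : ℕ → Measure (Euc d)} [∀ j, IsLocallyFiniteMeasure (N j)]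
    (hN : AsympUnif n N) {x : ℕ → Euc d} {C : ℝ} {s : ℕ → ℝ}
    (hx : ∀ j, x j ∈ msupport (N j)) (hxC : ∀ j, ‖x j‖ ≤ C)
    (hs : ∀ j, 0 < s j) (hsC : ∀ j, s j ≤ C) :
    AsympUnif n (fun j => FlatStab.rescale (N j) (x j) (s j)) := by
  intro z D τ hz hzD hτ hτ0 r hr
  have hD0 : 0 ≤ D := (norm_nonneg _).trans (hzD 0)
  have hC0 : 0 ≤ C := (norm_nonneg _).trans (hxC 0)
  have h := hN (fun j => x j + s j • z j) (C + C * D) (fun j => s j * τ j)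
    (fun j => (mem_msupport_rescale _ _ (hs j) _).1 (hz j)) (fun j => ?_)
    (fun j => mul_pos (hs j) (hτ j)) ?_ r hr
  · refine h.congr fun j => ?_
    rw [rescale_real _ _ (hs j), rescale_real _ _ (hs j), div_div_div_cancel_right₀,
      mul_left_comm]
    exact (real_ball_pos (hx j) (hs j)).ne'
  · refine (norm_add_le _ _).trans (add_le_add (hxC j) ?_)
    rw [norm_smul, Real.norm_of_nonneg (hs j).le]
    exact mul_le_mul (hsC j) (hzD j) (norm_nonneg _) hC0
  · refine squeeze_zero (fun j => (mul_pos (hs j) (hτ j)).le)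
      (fun j => mul_le_mul_of_nonneg_right (hsC j) (hτ j).le) ?_
    simpa using hτ0.const_mul C

lemma AsympOptDoubling.asympUnif {μ : Measure (Euc d)} [IsLocallyFiniteMeasure μ]
    (h : AsympOptDoubling n μ) : AsympUnif n (fun _ => μ) := by
  let P : ℝ → Prop := fun r => 0 < r ∧ ∀ (z : ℕ → Euc d) (C : ℝ) (τ : ℕ → ℝ),
    (∀ j, z j ∈ msupport μ) → (∀ j, ‖z j‖ ≤ C) → (∀ j, 0 < τ j) → Tendsto τ UF (𝓝 0) →
    Tendsto (fun j => μ.real (closedBall (z j) (r * τ j)) / μ.real (closedBall (z j) (τ j)))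
      UF (𝓝 (r ^ n))
  have hsc : ∀ {r : ℝ} {τ : ℕ → ℝ}, Tendsto τ UF (𝓝 0) → Tendsto (fun j => r * τ j) UF (𝓝 0) :=
    fun {r τ} hτ => by simpa using hτ.const_mul r
  have hmul : ∀ r s, P r → P s → P (r * s) := by
    intro r s hr hs
    refine ⟨mul_pos hr.1 hs.1, fun z C τ hz hzC hτ hτ0 => ?_⟩
    have h1 := hr.2 z C (fun j => s * τ j) hz hzC (fun j => mul_pos hs.1 (hτ j)) (hsc hτ0)
    have h3 := h1.mul (hs.2 z C τ hz hzC hτ hτ0)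
    rw [← mul_pow] at h3
    refine h3.congr fun j => ?_
    rw [div_mul_div_cancel₀ (real_ball_pos (hz j) (mul_pos hs.1 (hτ j))).ne', mul_assoc]
  have hinv : ∀ r, P r → P r⁻¹ := by
    intro r hr
    refine ⟨inv_pos.2 hr.1, fun z C τ hz hzC hτ hτ0 => ?_⟩
    have h1 := hr.2 z C (fun j => r⁻¹ * τ j) hz hzC
      (fun j => mul_pos (inv_pos.2 hr.1) (hτ j)) (hsc hτ0)
    have h3 := h1.inv₀ (pow_pos hr.1 n).ne'
    rw [← inv_pow] at h3
    refine h3.congr fun j => ?_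
    rw [inv_div, mul_inv_cancel_left₀ hr.1.ne']
  have hbase : ∀ t ∈ Icc (1 / 2 : ℝ) 1, P t := by
    intro t ht
    have ht0 : 0 < t := by linarith [ht.1]
    refine ⟨ht0, fun z C τ hz hzC hτ hτ0 => ?_⟩
    let K : Set (Euc d) := msupport μ ∩ closedBall 0 C
    have hK : IsCompact K := (isCompact_closedBall 0 C).inter_left (isClosed_msupport μ)
    have h1 := h K hK inter_subset_left t ht
    have hτ' : Tendsto τ UF (𝓝[>] 0) :=
      tendsto_nhdsWithin_iff.2 ⟨hτ0, Eventually.of_forall hτ⟩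
    have h2 := h1.comp hτ'
    rw [tendsto_iff_norm_sub_tendsto_zero]
    refine squeeze_zero (fun j => norm_nonneg _) (fun j => ?_) h2
    have hzK : z j ∈ K := ⟨hz j, by simpa using hzC j⟩
    have hb : BddAbove (Set.range fun x : K => |(μ (closedBall x.1 (t * τ j)) /
        μ (closedBall x.1 (τ j))).toReal - t ^ n|) := by
      refine ⟨2, ?_⟩
      rintro _ ⟨x, rfl⟩
      have hp := real_ball_pos x.2.1 (hτ j)
      have hle : μ.real (closedBall x.1 (t * τ j)) ≤ μ.real (closedBall x.1 (τ j)) := by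
        refine measureReal_mono (closedBall_subset_closedBall ?_) measure_closedBall_lt_top.ne
        nlinarith [ht.2, hτ j]
      have h3 : (μ (closedBall x.1 (t * τ j)) / μ (closedBall x.1 (τ j))).toReal ≤ 1 := by
        rw [ENNReal.toReal_div]
        exact (div_le_one hp).2 hle
      have h4 : t ^ n ≤ 1 := pow_le_one₀ ht0.le ht.2
      have h5 : 0 ≤ t ^ n := by positivity
      dsimp only
      rw [abs_le]
      constructor <;> linarith [ENNReal.toReal_nonneg
        (a := μ (closedBall x.1 (t * τ j)) / μ (closedBall x.1 (τ j)))]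
    refine le_trans (le_of_eq ?_) (le_ciSup hb ⟨z j, hzK⟩)
    rw [ENNReal.toReal_div]
    rfl
  have hhalf : ∀ k : ℕ, P ((1 / 2) ^ k) := by
    intro k
    induction k with
    | zero => simpa using hbase 1 (by norm_num)
    | succ k ih => rw [pow_succ]; exact hmul _ _ ih (hbase _ (by norm_num))
  have hle1 : ∀ r : ℝ, 0 < r → r ≤ 1 → P r := by
    intro r hr hr1
    obtain ⟨k, hk1, hk2⟩ := exists_nat_pow_near_of_lt_one hr hr1
      (by norm_num : (0 : ℝ) < 1 / 2) (by norm_num)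
    have hp : (0 : ℝ) < (1 / 2) ^ k := by positivity
    have := hmul _ _ (hhalf k) (hbase (r / (1 / 2) ^ k) ⟨?_, ?_⟩)
    · rwa [mul_div_cancel₀ _ hp.ne'] at this
    · rw [le_div_iff₀ hp]; rw [pow_succ] at hk1; linarith
    · rw [div_le_one hp]; exact hk2
  have hall : ∀ r : ℝ, 0 < r → P r := by
    intro r hr
    rcases le_or_gt r 1 with h1 | h1
    · exact hle1 r hr h1
    · rw [← inv_inv r]
      exact hinv _ (hle1 _ (inv_pos.2 hr) (inv_le_one_of_one_le₀ h1.le))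
  intro z C τ hz hzC hτ hτ0 r hr
  exact (hall r hr).2 z C τ hz hzC hτ hτ0

lemma NUnif.ball' {ν : Measure (Euc d)} (h : NUnif n ν) (hn : 0 < n) {x : Euc d}
    (hx : x ∈ msupport ν) (r : ℝ) : ν (closedBall x r) = ENNReal.ofReal ((max r 0) ^ n) := by
  rcases lt_or_ge 0 r with hr | hr
  · rw [h.ball x hx r hr, max_eq_left hr.le]
  · rw [max_eq_right hr, zero_pow hn.ne', ENNReal.ofReal_zero]
    have ht : Tendsto (fun s : ℝ => ENNReal.ofReal (s ^ n)) (𝓝[>] 0) (𝓝 0) := by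
      have hc : Continuous fun s : ℝ => ENNReal.ofReal (s ^ n) :=
        ENNReal.continuous_ofReal.comp (continuous_pow n)
      have := (hc.tendsto 0).mono_left (nhdsWithin_le_nhds (s := Ioi 0))
      simpa [hn.ne'] using this
    refine nonpos_iff_eq_zero.1 (ge_of_tendsto ht ?_)
    filter_upwards [self_mem_nhdsWithin] with s hs
    rw [← h.ball x hx s hs]
    exact measure_mono (closedBall_subset_closedBall (hr.trans (le_of_lt hs)))

/-- An `n`-uniform measure is not carried by a subspace of dimension `< n`. -/
lemma NUnif.not_subset_of_finrank_lt {ν : Measure (Euc d)} (h : NUnif n ν)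
    (W : Submodule ℝ (Euc d)) (hW : finrank ℝ W < n) : ¬ msupport ν ⊆ W := by
  intro hsub
  have hn : 0 < n := by omega
  have hle : ν ≤ μH[(n : ℝ)] := by
    refine Measure.le_hausdorffMeasure n ν 1 one_pos fun s hs => ?_
    by_cases hd : Disjoint s (msupport ν)
    · rw [measure_eq_zero_of_disjoint hd]; exact zero_le
    · obtain ⟨x, hxs, hx⟩ := Set.not_disjoint_iff.1 hd
      have hfin : ediam s ≠ ⊤ := ne_top_of_le_ne_top ENNReal.one_ne_top hs
      have hsb : s ⊆ closedBall x (ediam s).toReal := by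
        intro y hy
        rw [mem_closedBall, dist_edist]
        exact ENNReal.toReal_mono hfin (edist_le_ediam_of_mem hy hxs)
      refine (measure_mono hsb).trans ?_
      rw [h.ball' hn hx, max_eq_left ENNReal.toReal_nonneg, ENNReal.ofReal_pow
        ENNReal.toReal_nonneg, ENNReal.ofReal_toReal hfin, ENNReal.rpow_natCast]
  have hdim : dimH (W : Set (Euc d)) < n := by
    have h1 : dimH (W : Set (Euc d)) = finrank ℝ W := by
      have h2 : (W : Set (Euc d)) = (W.subtypeₗᵢ) '' univ := by
        ext z; simp
      rw [h2, W.subtypeₗᵢ.isometry.dimH_image, Real.dimH_univ_eq_finrank]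
    rw [h1]; exact_mod_cast hW
  have h0 : μH[((n : NNReal) : ℝ)] (W : Set (Euc d)) = 0 := hausdorffMeasure_of_dimH_lt (by
    simpa using hdim)
  have h1 : ν (W : Set (Euc d)) = 0 := nonpos_iff_eq_zero.1 ((hle _).trans (by simpa using h0.le))
  have h2 : ν univ = 0 := by
    rw [← nonpos_iff_eq_zero]
    calc ν univ ≤ ν (W : Set (Euc d)) + ν (msupport ν)ᶜ := by
          refine (measure_mono fun z _ => ?_).trans (measure_union_le _ _)
          by_cases hz : z ∈ msupport ν
          · exact Or.inl (hsub hz)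
          · exact Or.inr hz
      _ = 0 := by rw [h1, measure_compl_msupport, add_zero]
  exact (h.zero_mem 1 one_pos).ne' (measure_mono_null (subset_univ _) h2)

/-- Volume of the unit ball of `ℝⁿ`. -/
def unitVol (n : ℕ) : ℝ := (volume : Measure (Euc n)).real (closedBall 0 1)

lemma unitVol_pos (n : ℕ) : 0 < unitVol n :=
  ENNReal.toReal_pos (measure_closedBall_pos volume 0 one_pos).ne' measure_closedBall_lt_top.ne

lemma NUnif.radial_measure {ν : Measure (Euc d)} (h : NUnif n ν) (hn : 0 < n) {x : Euc d}
    (hx : x ∈ msupport ν) :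
    (ENNReal.ofReal (unitVol n)) • ν.map (fun y => ‖y - x‖) =
      (volume : Measure (Euc n)).map (fun v => ‖v‖) := by
  have := h.locFin
  have hm1 : Measurable (fun y : Euc d => ‖y - x‖) := by fun_prop
  have hm2 : Measurable (fun v : Euc n => ‖v‖) := by fun_prop
  have hs1 : ∀ b : ℝ, (fun y : Euc d => ‖y - x‖) ⁻¹' Iic b = closedBall x b := by
    intro b; ext y; simp [dist_eq_norm]
  have hs2 : ∀ b : ℝ, (fun v : Euc n => ‖v‖) ⁻¹' Iic b = closedBall 0 b := by
    intro b; ext y; simp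
  have hI : ∀ b : ℝ, ((ENNReal.ofReal (unitVol n)) • ν.map (fun y => ‖y - x‖)) (Iic b) =
      ((volume : Measure (Euc n)).map (fun v => ‖v‖)) (Iic b) := by
    intro b
    rw [Measure.smul_apply, Measure.map_apply hm1 measurableSet_Iic,
      Measure.map_apply hm2 measurableSet_Iic, hs1, hs2, h.ball' hn hx, smul_eq_mul]
    have : Nonempty (Fin n) := ⟨⟨0, hn⟩⟩
    rcases le_or_gt 0 b with hb | hb
    · rw [Measure.addHaar_closedBall' _ _ hb, max_eq_left hb, unitVol, measureReal_def,
        ENNReal.ofReal_toReal measure_closedBall_lt_top.ne, mul_comm]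
      simp
    · rw [max_eq_right hb.le, zero_pow hn.ne', closedBall_eq_empty.2 hb]
      simp
  have hfin : ∀ b : ℝ, ((volume : Measure (Euc n)).map (fun v => ‖v‖)) (Iic b) ≠ ⊤ := by
    intro b
    rw [Measure.map_apply hm2 measurableSet_Iic, hs2]
    exact measure_closedBall_lt_top.ne
  refine Measure.ext_of_Ioc' _ _ (fun a b hab => ?_) (fun a b hab => ?_)
  · refine ne_top_of_le_ne_top (hfin b) ?_
    rw [← hI b]
    exact measure_mono Ioc_subset_Iic_self
  · rw [show Ioc a b = Iic b \ Iic a by ext z; simp [and_comm], measure_sdiff (Iic_subset_Iic.2 hab.le) measurableSet_Iic.nullMeasurableSet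
      (by rw [hI a]; exact hfin a), measure_sdiff (Iic_subset_Iic.2 hab.le)
      measurableSet_Iic.nullMeasurableSet (hfin a), hI, hI]

lemma NUnif.radial_integral {ν : Measure (Euc d)} (h : NUnif n ν) (hn : 0 < n) {x : Euc d}
    (hx : x ∈ msupport ν) {f : ℝ → ℝ} (hf : Continuous f) :
    unitVol n * ∫ y, f ‖y - x‖ ∂ν = ∫ v : Euc n, f ‖v‖ := by
  have hm1 : Measurable (fun y : Euc d => ‖y - x‖) := by fun_prop
  have hm2 : Measurable (fun v : Euc n => ‖v‖) := by fun_prop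
  rw [← integral_map (f := f) hm2.aemeasurable hf.aestronglyMeasurable,
    ← h.radial_measure hn hx, integral_smul_measure,
    integral_map (f := f) hm1.aemeasurable hf.aestronglyMeasurable,
    ENNReal.toReal_ofReal (unitVol_pos n).le, smul_eq_mul]

lemma NUnif.integral_gauss {ν : Measure (Euc d)} (h : NUnif n ν) (hn : 0 < n) {x : Euc d}
    (hx : x ∈ msupport ν) {s : ℝ} (hs : 0 < s) :
    ∫ y, Real.exp (-s * ‖y - x‖ ^ 2) ∂ν = (unitVol n)⁻¹ * (Real.pi / s) ^ ((n : ℝ) / 2) := by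
  have h1 := h.radial_integral hn hx (f := fun t => Real.exp (-s * t ^ 2)) (by fun_prop)
  have h2 := GaussianFourier.integral_rexp_neg_mul_sq_norm (V := Euc n) hs
  rw [finrank_euclideanSpace_fin] at h2
  rw [h2] at h1
  rw [← h1, inv_mul_cancel_left₀ (unitVol_pos n).ne']

lemma NUnif.integral_gauss_pos {ν : Measure (Euc d)} (h : NUnif n ν) (hn : 0 < n) {x : Euc d}
    (hx : x ∈ msupport ν) {s : ℝ} (hs : 0 < s) :
    0 < ∫ y, Real.exp (-s * ‖y - x‖ ^ 2) ∂ν := by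
  rw [h.integral_gauss hn hx hs]
  have := unitVol_pos n
  positivity

lemma NUnif.integrable_gauss {ν : Measure (Euc d)} (h : NUnif n ν) (hn : 0 < n) {x : Euc d}
    (hx : x ∈ msupport ν) {s : ℝ} (hs : 0 < s) :
    Integrable (fun y => Real.exp (-s * ‖y - x‖ ^ 2)) ν := by
  by_contra hc
  exact (h.integral_gauss_pos hn hx hs).ne' (integral_undef hc)

/-- The Gaussian partition function. -/
def gZ (ν : Measure (Euc d)) (s : ℝ) : ℝ := ∫ y, Real.exp (-s * ‖y‖ ^ 2) ∂ν

/-- The Gaussian probability measure with density proportional to `exp (-s ‖y‖²)`. -/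
def gM (ν : Measure (Euc d)) (s : ℝ) : Measure (Euc d) :=
  ν.withDensity fun y => ENNReal.ofReal (Real.exp (-s * ‖y‖ ^ 2) / gZ ν s)

lemma NUnif.gZ_eq {ν : Measure (Euc d)} (h : NUnif n ν) (hn : 0 < n) {s : ℝ} (hs : 0 < s) :
    gZ ν s = (unitVol n)⁻¹ * (Real.pi / s) ^ ((n : ℝ) / 2) := by
  rw [← h.integral_gauss hn h.zero_mem hs]; simp [gZ]

lemma NUnif.gZ_pos {ν : Measure (Euc d)} (h : NUnif n ν) (hn : 0 < n) {s : ℝ} (hs : 0 < s) :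
    0 < gZ ν s := by
  have := h.integral_gauss_pos hn h.zero_mem hs
  simpa [gZ] using this

lemma gM_integral (ν : Measure (Euc d)) (s : ℝ) {F : Type*} [NormedAddCommGroup F]
    [NormedSpace ℝ F] (f : Euc d → F) (hZ : 0 < gZ ν s) :
    ∫ y, f y ∂(gM ν s) = ∫ y, (Real.exp (-s * ‖y‖ ^ 2) / gZ ν s) • f y ∂ν := by
  rw [gM, integral_withDensity_eq_integral_toReal_smul (by fun_prop)
    (Eventually.of_forall fun y => ENNReal.ofReal_lt_top)]
  refine integral_congr_ae (Eventually.of_forall fun y => ?_)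
  dsimp only
  rw [ENNReal.toReal_ofReal (by positivity)]

lemma NUnif.gM_prob {ν : Measure (Euc d)} (h : NUnif n ν) (hn : 0 < n) {s : ℝ} (hs : 0 < s) :
    IsProbabilityMeasure (gM ν s) := by
  have hZ := h.gZ_pos hn hs
  have hi : Integrable (fun y => Real.exp (-s * ‖y‖ ^ 2)) ν := by
    simpa using h.integrable_gauss hn h.zero_mem hs
  refine ⟨?_⟩
  rw [gM, withDensity_apply _ MeasurableSet.univ, Measure.restrict_univ,
    ← ofReal_integral_eq_lintegral_ofReal (hi.div_const _)
      (Eventually.of_forall fun y => by positivity), integral_div]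
  change ENNReal.ofReal (gZ ν s / gZ ν s) = 1
  rw [div_self hZ.ne', ENNReal.ofReal_one]

lemma gM_ae_mem (ν : Measure (Euc d)) (s : ℝ) : ∀ᵐ y ∂(gM ν s), y ∈ msupport ν :=
  (withDensity_absolutelyContinuous ν _).ae_le (ae_mem_msupport ν)

/-- Change of Gaussian parameter. -/
lemma NUnif.gM_scale {ν : Measure (Euc d)} (h : NUnif n ν) (hn : 0 < n) {s lam : ℝ} (hs : 0 < s)
    (hl : -1 < lam) {F : Type*} [NormedAddCommGroup F]
    [NormedSpace ℝ F] (f : Euc d → F) :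
    ∫ y, Real.exp (-lam * (s * ‖y‖ ^ 2)) • f y ∂(gM ν s) =
      (1 + lam) ^ (-((n : ℝ) / 2)) • ∫ y, f y ∂(gM ν (s * (1 + lam))) := by
  have h1 : 0 < 1 + lam := by linarith
  have hs' : 0 < s * (1 + lam) := mul_pos hs h1
  rw [gM_integral _ _ _ (h.gZ_pos hn hs), gM_integral _ _ _ (h.gZ_pos hn hs'), ← integral_smul]
  refine integral_congr_ae (Eventually.of_forall fun y => ?_)
  dsimp only
  rw [smul_smul, smul_smul]
  congr 1
  rw [h.gZ_eq hn hs, h.gZ_eq hn hs', div_mul_eq_mul_div, ← Real.exp_add,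
    ← div_div Real.pi s (1 + lam), Real.div_rpow (by positivity) h1.le, Real.rpow_neg h1.le]
  have hp : 0 < (1 + lam) ^ ((n : ℝ) / 2) := by positivity
  have hp2 : 0 < (Real.pi / s) ^ ((n : ℝ) / 2) := by positivity
  have hu := unitVol_pos n
  have : -s * ‖y‖ ^ 2 + -lam * (s * ‖y‖ ^ 2) = -(s * (1 + lam)) * ‖y‖ ^ 2 := by ring
  rw [this]
  field_simp

lemma NUnif.gM_exp {ν : Measure (Euc d)} (h : NUnif n ν) (hn : 0 < n) {s lam : ℝ} (hs : 0 < s)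
    (hl : -1 < lam) :
    ∫ y, Real.exp (-lam * (s * ‖y‖ ^ 2)) ∂(gM ν s) = (1 + lam) ^ (-((n : ℝ) / 2)) := by
  have := h.gM_prob hn (s := s * (1 + lam)) (mul_pos hs (by linarith))
  have h1 := h.gM_scale hn hs hl (fun _ => (1 : ℝ))
  simpa using h1

lemma NUnif.gM_exp_integrable {ν : Measure (Euc d)} (h : NUnif n ν) (hn : 0 < n) {s lam : ℝ}
    (hs : 0 < s) (hl : -1 < lam) :
    Integrable (fun y => Real.exp (-lam * (s * ‖y‖ ^ 2))) (gM ν s) := by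
  by_contra hc
  have h1 := h.gM_exp hn hs hl
  rw [integral_undef hc] at h1
  have : 0 < (1 + lam) ^ (-((n : ℝ) / 2)) := Real.rpow_pos_of_pos (by linarith) _
  linarith

/-- The moment generating function at points of the support. -/
lemma NUnif.gM_mgf {ν : Measure (Euc d)} (h : NUnif n ν) (hn : 0 < n) {s : ℝ} (hs : 0 < s)
    {x : Euc d} (hx : x ∈ msupport ν) :
    ∫ y, Real.exp (2 * s * ⟪x, y⟫) ∂(gM ν s) = Real.exp (s * ‖x‖ ^ 2) := by
  have hZ := h.gZ_pos hn hs
  rw [gM_integral _ _ _ hZ]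
  have h1 : ∀ y, (Real.exp (-s * ‖y‖ ^ 2) / gZ ν s) • Real.exp (2 * s * ⟪x, y⟫) =
      (Real.exp (s * ‖x‖ ^ 2) / gZ ν s) * Real.exp (-s * ‖y - x‖ ^ 2) := by
    intro y
    rw [smul_eq_mul, div_mul_eq_mul_div, div_mul_eq_mul_div, ← Real.exp_add, ← Real.exp_add]
    congr 2
    rw [norm_sub_sq_real, real_inner_comm]; ring
  simp_rw [h1]
  rw [integral_const_mul, h.integral_gauss hn hx hs, ← h.gZ_eq hn hs, div_mul_cancel₀ _ hZ.ne']

lemma pow_mul_exp_le {t : ℝ} (ht : 0 ≤ t) (k : ℕ) :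
    t ^ k * Real.exp (2 * t) ≤ k.factorial * Real.exp 9 * Real.exp (t ^ 2 / 4) := by
  have h1 : t ^ k ≤ k.factorial * Real.exp t := by
    have := Real.pow_div_factorial_le_exp t ht k
    rw [div_le_iff₀ (by positivity)] at this
    linarith
  have h2 : Real.exp t * Real.exp (2 * t) ≤ Real.exp 9 * Real.exp (t ^ 2 / 4) := by
    rw [← Real.exp_add, ← Real.exp_add]
    exact Real.exp_le_exp.2 (by nlinarith [sq_nonneg (t / 2 - 3)])
  calc t ^ k * Real.exp (2 * t) ≤ (k.factorial * Real.exp t) * Real.exp (2 * t) := by gcongr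
    _ = k.factorial * (Real.exp t * Real.exp (2 * t)) := by ring
    _ ≤ k.factorial * (Real.exp 9 * Real.exp (t ^ 2 / 4)) := by gcongr
    _ = _ := by ring

/-- A universal constant bounding Gaussian moments. -/
def gC (n k : ℕ) : ℝ := k.factorial * Real.exp 9 * (3 / 4 : ℝ) ^ (-((n : ℝ) / 2))

lemma gC_nonneg (n k : ℕ) : 0 ≤ gC n k := by unfold gC; positivity

lemma NUnif.gM_moment_exp {ν : Measure (Euc d)} (h : NUnif n ν) (hn : 0 < n) {s : ℝ} (hs : 0 < s)
    (k : ℕ) :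
    Integrable (fun y => (√s * ‖y‖) ^ k * Real.exp (2 * (√s * ‖y‖))) (gM ν s) ∧
    ∫ y, (√s * ‖y‖) ^ k * Real.exp (2 * (√s * ‖y‖)) ∂(gM ν s) ≤ gC n k := by
  have hi := (h.gM_exp_integrable hn hs (lam := -(1 / 4)) (by norm_num)).const_mul
    (k.factorial * Real.exp 9)
  have hb : ∀ y : Euc d, (√s * ‖y‖) ^ k * Real.exp (2 * (√s * ‖y‖)) ≤
      k.factorial * Real.exp 9 * Real.exp (-(-(1 / 4)) * (s * ‖y‖ ^ 2)) := by
    intro y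
    refine (pow_mul_exp_le (by positivity) k).trans_eq ?_
    rw [mul_pow, Real.sq_sqrt hs.le]
    congr 2; ring
  have hintg : Integrable (fun y => (√s * ‖y‖) ^ k * Real.exp (2 * (√s * ‖y‖))) (gM ν s) := by
    refine hi.mono' (by fun_prop) (Eventually.of_forall fun y => ?_)
    rw [Real.norm_of_nonneg (by positivity)]
    exact hb y
  refine ⟨hintg, (integral_mono hintg hi hb).trans_eq ?_⟩
  rw [integral_const_mul, h.gM_exp hn hs (by norm_num), gC]
  norm_num

lemma NUnif.gM_moment {ν : Measure (Euc d)} (h : NUnif n ν) (hn : 0 < n) {s : ℝ} (hs : 0 < s)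
    (k : ℕ) :
    Integrable (fun y => (√s * ‖y‖) ^ k) (gM ν s) ∧
    ∫ y, (√s * ‖y‖) ^ k ∂(gM ν s) ≤ gC n k := by
  obtain ⟨hi, hb⟩ := h.gM_moment_exp hn hs k
  have hle : ∀ y : Euc d, (√s * ‖y‖) ^ k ≤ (√s * ‖y‖) ^ k * Real.exp (2 * (√s * ‖y‖)) := by
    intro y
    exact le_mul_of_one_le_right (by positivity) (Real.one_le_exp (by positivity))
  have hintg : Integrable (fun y => (√s * ‖y‖) ^ k) (gM ν s) := by
    refine hi.mono' (by fun_prop) (Eventually.of_forall fun y => ?_)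
    rw [Real.norm_of_nonneg (by positivity)]
    exact hle y
  exact ⟨hintg, (integral_mono hintg hi hle).trans hb⟩

lemma NUnif.gM_norm_pow_integrable {ν : Measure (Euc d)} (h : NUnif n ν) (hn : 0 < n) {s : ℝ}
    (hs : 0 < s) (k : ℕ) : Integrable (fun y => ‖y‖ ^ k) (gM ν s) := by
  have h1 := (h.gM_moment hn hs k).1
  simp_rw [mul_pow] at h1
  exact (integrable_const_mul_iff (IsUnit.mk0 _ (pow_pos (Real.sqrt_pos.2 hs) k).ne') _).1 h1

lemma NUnif.gM_integrable {ν : Measure (Euc d)} (h : NUnif n ν) (hn : 0 < n) {s : ℝ}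
    (hs : 0 < s) {F : Type*} [NormedAddCommGroup F] [SecondCountableTopology F] [MeasurableSpace F]
    [BorelSpace F] {f : Euc d → F} (hf : Continuous f) {C : ℝ} {k : ℕ}
    (hb : ∀ y, ‖f y‖ ≤ C * ‖y‖ ^ k) : Integrable f (gM ν s) :=
  ((h.gM_norm_pow_integrable hn hs k).const_mul C).mono' hf.aestronglyMeasurable
    (Eventually.of_forall hb)

/-- Scale invariant bound for integrals of functions of polynomial growth. -/
lemma NUnif.gM_bound {ν : Measure (Euc d)} (h : NUnif n ν) (hn : 0 < n) {s : ℝ}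
    (hs : 0 < s) {F : Type*} [NormedAddCommGroup F] [NormedSpace ℝ F] {f : Euc d → F}
    {C : ℝ} (hC : 0 ≤ C) {k : ℕ} (hb : ∀ y, ‖f y‖ ≤ C * ‖y‖ ^ k) :
    √s ^ k * ‖∫ y, f y ∂(gM ν s)‖ ≤ C * gC n k := by
  have h1 := h.gM_norm_pow_integrable hn hs k
  have h2 : ‖∫ y, f y ∂(gM ν s)‖ ≤ ∫ y, C * ‖y‖ ^ k ∂(gM ν s) :=
    norm_integral_le_of_norm_le (h1.const_mul C) (Eventually.of_forall hb)
  have h3 := (h.gM_moment hn hs k).2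
  simp_rw [mul_pow] at h3
  rw [integral_const_mul] at h3 h2
  calc √s ^ k * ‖∫ y, f y ∂(gM ν s)‖ ≤ √s ^ k * (C * ∫ y, ‖y‖ ^ k ∂(gM ν s)) := by gcongr
    _ = C * (√s ^ k * ∫ y, ‖y‖ ^ k ∂(gM ν s)) := by ring
    _ ≤ _ := by gcongr

lemma abs_exp_sub_sum_le (t : ℝ) (m : ℕ) :
    |(∑ k ∈ Finset.range m, t ^ k / k.factorial) - Real.exp t| ≤ |t| ^ m * Real.exp |t| := by
  have h := Complex.norm_exp_sub_sum_le_norm_mul_exp (t : ℂ) m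
  rw [Complex.norm_real, Real.norm_eq_abs] at h
  rw [abs_sub_comm]
  refine le_trans (le_of_eq ?_) h
  rw [← Real.norm_eq_abs, ← Complex.norm_real]
  push_cast
  rfl

lemma NUnif.gM_taylor {ν : Measure (Euc d)} (h : NUnif n ν) (hn : 0 < n) {s : ℝ} (hs : 0 < s)
    {x : Euc d} (hx : x ∈ msupport ν) (hsx : √s * ‖x‖ ≤ 1) (m : ℕ) :
    |(∑ k ∈ Finset.range m, ∫ y, (2 * s * ⟪x, y⟫) ^ k / k.factorial ∂(gM ν s)) -
      Real.exp (s * ‖x‖ ^ 2)| ≤ gC n m * (2 * (√s * ‖x‖)) ^ m := by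
  have := h.gM_prob hn hs
  have hk : ∀ k : ℕ, Integrable (fun y => (2 * s * ⟪x, y⟫) ^ k / k.factorial) (gM ν s) := by
    intro k
    refine h.gM_integrable hn hs (by fun_prop) (k := k)
      (C := (2 * s * ‖x‖) ^ k / k.factorial) fun y => ?_
    rw [norm_div, norm_pow, norm_mul, Real.norm_natCast, Real.norm_of_nonneg (by positivity),
      div_mul_eq_mul_div, ← mul_pow, mul_assoc (2 * s)]
    gcongr
    exact abs_real_inner_le_norm x y
  have hexp : Integrable (fun y => Real.exp (2 * s * ⟪x, y⟫)) (gM ν s) := by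
    by_contra hc
    have h1 := h.gM_mgf hn hs hx
    rw [integral_undef hc] at h1
    exact (Real.exp_pos _).ne h1
  obtain ⟨hi, hb⟩ := h.gM_moment_exp hn hs m
  rw [← h.gM_mgf hn hs hx, ← integral_finsetSum _ (fun k _ => hk k), ← integral_sub
    (integrable_finsetSum _ fun k _ => hk k) hexp]
  have hpt : ∀ y, ‖(∑ k ∈ Finset.range m, (2 * s * ⟪x, y⟫) ^ k / k.factorial) -
      Real.exp (2 * s * ⟪x, y⟫)‖ ≤
      (2 * (√s * ‖x‖)) ^ m * ((√s * ‖y‖) ^ m * Real.exp (2 * (√s * ‖y‖))) := by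
    intro y
    refine (abs_exp_sub_sum_le _ m).trans ?_
    have h1 : |2 * s * ⟪x, y⟫| ≤ 2 * (√s * ‖x‖) * (√s * ‖y‖) := by
      rw [abs_mul, abs_of_nonneg (by positivity : 0 ≤ 2 * s)]
      calc 2 * s * |⟪x, y⟫| ≤ 2 * s * (‖x‖ * ‖y‖) := by
            gcongr; exact abs_real_inner_le_norm x y
        _ = 2 * (√s * √s) * (‖x‖ * ‖y‖) := by rw [Real.mul_self_sqrt hs.le]
        _ = _ := by ring
    have h2 : |2 * s * ⟪x, y⟫| ≤ 2 * (√s * ‖y‖) := by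
      refine h1.trans ?_
      have : 0 ≤ √s * ‖y‖ := by positivity
      nlinarith
    rw [← mul_assoc, ← mul_pow]
    gcongr
  refine (norm_integral_le_of_norm_le (hi.const_mul _) (Eventually.of_forall hpt)).trans ?_
  rw [integral_const_mul, mul_comm]
  gcongr

lemma exp_neg_bounds {t : ℝ} (ht : 0 ≤ t) :
    |(Real.exp (-t) - 1) + t| ≤ t ^ 2 / 2 := by
  have h1 := Real.add_one_le_exp (-t)
  have h2 := Real.quadratic_le_exp_of_nonneg ht
  have h3 : Real.exp (-t) * Real.exp t = 1 := by rw [← Real.exp_add]; simp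
  have h4 := Real.exp_pos (-t)
  have h5 : Real.exp (-t) ≤ 1 - t + t ^ 2 / 2 := by
    have h6 : Real.exp (-t) * (1 + t + t ^ 2 / 2) ≤ 1 := by
      calc _ ≤ Real.exp (-t) * Real.exp t := by gcongr
        _ = 1 := h3
    by_contra hc
    push Not at hc
    have h7 : 0 < 1 + t + t ^ 2 / 2 := by positivity
    nlinarith [mul_lt_mul_of_pos_right hc h7, sq_nonneg (t ^ 2)]
  rw [abs_le]
  constructor <;> nlinarith [sq_nonneg t]

lemma NUnif.gM_deriv_scale {ν : Measure (Euc d)} (h : NUnif n ν) (hn : 0 < n) {s lam : ℝ}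
    (hs : 0 < s) (hl : 0 < lam) {f : Euc d → ℝ} (hf : Continuous f) {C : ℝ} {k : ℕ}
    (hb : ∀ y, ‖f y‖ ≤ C * ‖y‖ ^ k) :
    |((1 + lam) ^ (-((n : ℝ) / 2)) * ∫ y, f y ∂(gM ν (s * (1 + lam)))
        - ∫ y, f y ∂(gM ν s)) / lam + ∫ y, s * ‖y‖ ^ 2 * f y ∂(gM ν s)| ≤
      lam / 2 * ∫ y, (s * ‖y‖ ^ 2) ^ 2 * |f y| ∂(gM ν s) := by
  have h1 := h.gM_scale hn hs (by linarith : -1 < lam) f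
  simp only [smul_eq_mul] at h1
  have i1 : Integrable f (gM ν s) := h.gM_integrable hn hs hf hb
  have i2 : Integrable (fun y => s * ‖y‖ ^ 2 * f y) (gM ν s) := by
    refine h.gM_integrable hn hs (by fun_prop) (C := s * C) (k := k + 2) fun y => ?_
    rw [norm_mul, Real.norm_of_nonneg (by positivity), pow_add]
    nlinarith [mul_le_mul_of_nonneg_left (hb y) (by positivity : 0 ≤ s * ‖y‖ ^ 2)]
  have i3 : Integrable (fun y => (s * ‖y‖ ^ 2) ^ 2 * |f y|) (gM ν s) := by
    refine h.gM_integrable hn hs (by fun_prop) (C := s ^ 2 * C) (k := k + 4) fun y => ?_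
    rw [norm_mul, Real.norm_of_nonneg (by positivity), Real.norm_eq_abs, abs_abs, pow_add]
    have := mul_le_mul_of_nonneg_left (hb y) (by positivity : 0 ≤ (s * ‖y‖ ^ 2) ^ 2)
    rw [Real.norm_eq_abs] at this
    linarith [this]
  have i4 : Integrable (fun y => Real.exp (-lam * (s * ‖y‖ ^ 2)) * f y) (gM ν s) := by
    refine i1.norm.mono' (by fun_prop) (Eventually.of_forall fun y => ?_)
    rw [norm_mul, Real.norm_of_nonneg (Real.exp_pos _).le]
    refine mul_le_of_le_one_left (norm_nonneg _) (Real.exp_le_one_iff.2 ?_)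
    have : 0 ≤ lam * (s * ‖y‖ ^ 2) := by positivity
    linarith
  have e1 : ((1 + lam) ^ (-((n : ℝ) / 2)) * ∫ y, f y ∂(gM ν (s * (1 + lam)))
        - ∫ y, f y ∂(gM ν s)) / lam + ∫ y, s * ‖y‖ ^ 2 * f y ∂(gM ν s) =
      ∫ y, ((Real.exp (-lam * (s * ‖y‖ ^ 2)) * f y - f y) / lam + s * ‖y‖ ^ 2 * f y) ∂(gM ν s) := by
    have i5 : Integrable (fun y => (Real.exp (-lam * (s * ‖y‖ ^ 2)) * f y - f y) / lam) (gM ν s) :=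
      (i4.sub i1).div_const _
    rw [← h1, integral_add i5 i2, integral_div, integral_sub i4 i1]
  rw [e1, ← integral_const_mul, ← Real.norm_eq_abs]
  refine norm_integral_le_of_norm_le (i3.const_mul _) (Eventually.of_forall fun y => ?_)
  have ht : 0 ≤ lam * (s * ‖y‖ ^ 2) := by positivity
  have hb := exp_neg_bounds ht
  have e2 : (Real.exp (-lam * (s * ‖y‖ ^ 2)) * f y - f y) / lam + s * ‖y‖ ^ 2 * f y =
      ((Real.exp (-(lam * (s * ‖y‖ ^ 2))) - 1) + lam * (s * ‖y‖ ^ 2)) * (f y / lam) := by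
    rw [neg_mul]; field_simp
  rw [e2, norm_mul, Real.norm_eq_abs, norm_div, Real.norm_of_nonneg hl.le, Real.norm_eq_abs]
  calc _ ≤ (lam * (s * ‖y‖ ^ 2)) ^ 2 / 2 * (|f y| / lam) := by gcongr
    _ = _ := by field_simp

lemma tendsto_scale_slope (n : ℕ) :
    Tendsto (fun lam : ℝ => ((1 + lam) ^ (-((n : ℝ) / 2)) - 1) / lam) (𝓝[>] 0)
      (𝓝 (-((n : ℝ) / 2))) := by
  have h1 : HasDerivAt (fun lam : ℝ => (1 + lam) ^ (-((n : ℝ) / 2))) (-((n : ℝ) / 2)) 0 := by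
    have h2 : HasDerivAt (fun lam : ℝ => 1 + lam) 1 0 := (hasDerivAt_id 0).const_add 1
    have h3 := h2.rpow_const (p := -((n : ℝ) / 2)) (Or.inl (by norm_num))
    simpa using h3
  have h4 := h1.tendsto_slope_zero_right
  refine h4.congr fun lam => ?_
  simp [div_eq_inv_mul]

lemma NUnif.gM_sq_norm {ν : Measure (Euc d)} (h : NUnif n ν) (hn : 0 < n) {s : ℝ} (hs : 0 < s) :
    ∫ y, s * ‖y‖ ^ 2 ∂(gM ν s) = n / 2 := by
  have h1 : ∀ lam : ℝ, 0 < lam → |((1 + lam) ^ (-((n : ℝ) / 2)) - 1) / lam +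
      ∫ y, s * ‖y‖ ^ 2 ∂(gM ν s)| ≤ lam / 2 * ∫ y, (s * ‖y‖ ^ 2) ^ 2 ∂(gM ν s) := by
    intro lam hl
    have := h.gM_prob hn hs
    have := h.gM_prob hn (s := s * (1 + lam)) (mul_pos hs (by linarith))
    have h2 := h.gM_deriv_scale hn hs hl (f := fun _ => (1 : ℝ)) continuous_const
      (C := 1) (k := 0) (by simp)
    simpa using h2
  have h2 : Tendsto (fun lam : ℝ => |((1 + lam) ^ (-((n : ℝ) / 2)) - 1) / lam +
      ∫ y, s * ‖y‖ ^ 2 ∂(gM ν s)|) (𝓝[>] 0) (𝓝 |-((n : ℝ) / 2) + ∫ y, s * ‖y‖ ^ 2 ∂(gM ν s)|) :=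
    ((tendsto_scale_slope n).add_const _).abs
  have h3 : Tendsto (fun lam : ℝ => lam / 2 * ∫ y, (s * ‖y‖ ^ 2) ^ 2 ∂(gM ν s)) (𝓝[>] 0) (𝓝 0) := by
    have : Tendsto (fun lam : ℝ => lam / 2 * ∫ y, (s * ‖y‖ ^ 2) ^ 2 ∂(gM ν s)) (𝓝 0)
        (𝓝 (0 / 2 * ∫ y, (s * ‖y‖ ^ 2) ^ 2 ∂(gM ν s))) :=
      ((continuous_id.div_const 2).mul_const _).tendsto 0
    rw [zero_div, zero_mul] at this
    exact this.mono_left nhdsWithin_le_nhds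
  have h4 := le_of_tendsto_of_tendsto h2 h3 (by
    filter_upwards [self_mem_nhdsWithin] with lam hl using h1 lam hl)
  have h5 := abs_nonpos_iff.1 h4
  linarith

lemma NUnif.mem_of_ae {ν : Measure (Euc d)} {s : ℝ} (hZ : 0 < gZ ν s)
    {P : Set (Euc d)} (hP : IsClosed P) (hae : ∀ᵐ y ∂(gM ν s), y ∈ P) :
    msupport ν ⊆ P := by
  have hac : ν ≪ gM ν s := withDensity_absolutelyContinuous' (by fun_prop)
    (Eventually.of_forall fun y => by
      rw [Ne, ENNReal.ofReal_eq_zero, not_le]; positivity)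
  have h0 : ν Pᶜ = 0 := hac hae
  intro x hx
  by_contra hxP
  obtain ⟨r, hr, hsub⟩ := Metric.nhds_basis_closedBall.mem_iff.1 (hP.isOpen_compl.mem_nhds hxP)
  exact (hx r hr).ne' (measure_mono_null hsub h0)

/-- Blow up limits, with approximating points. -/
lemma exists_blowup_seq {N : ℕ → Measure (Euc d)} [∀ j, IsLocallyFiniteMeasure (N j)]
    (hN : AsympUnif n N) {z : ℕ → Euc d} {C : ℝ} {τ : ℕ → ℝ}
    (hz : ∀ j, z j ∈ msupport (N j)) (hzC : ∀ j, ‖z j‖ ≤ C)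
    (hτ : ∀ j, 0 < τ j) (hτC : ∀ j, τ j ≤ C) (hτ0 : Tendsto τ UF (𝓝 0)) :
    ∃ M : Measure (Euc d), NUnif n M ∧
      (∀ x ∈ msupport M, ∃ y : ℕ → Euc d, (∀ j, z j + τ j • y j ∈ msupport (N j)) ∧
        (∀ j, ‖y j‖ ≤ 2 * ‖x‖) ∧ Tendsto y UF (𝓝 x)) ∧
      (∀ x (y : ℕ → Euc d), (∀ j, z j + τ j • y j ∈ msupport (N j)) → Tendsto y UF (𝓝 x) →
        x ∈ msupport M) := by
  obtain ⟨M, hM, hsupp⟩ := exists_blowup hN hz hzC hτ hτC hτ0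
  have : ∀ j, IsLocallyFiniteMeasure (rescale (N j) (z j) (τ j)) :=
    fun j => rescale_locFin (N j) (hz j) (hτ j)
  refine ⟨M, hM, fun x hx => ?_, fun x y hy hyx => ?_⟩
  · obtain ⟨y, hy, hyb, hyx⟩ := exists_seq_of_infDist (fun j => isClosed_msupport _)
      (fun j => (mem_msupport_rescale _ _ (hτ j) _).2 (by simpa using hz j)) ((hsupp x).1 hx)
    refine ⟨y, fun j => (mem_msupport_rescale _ _ (hτ j) _).1 (hy j), fun j => ?_, hyx⟩
    have := norm_add_le (y j - x) x
    rw [sub_add_cancel] at this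
    linarith [hyb j]
  · exact (hsupp x).2 (infDist_tendsto_of_seq
      (fun j => (mem_msupport_rescale _ _ (hτ j) _).2 (hy j)) hyx)

lemma finrank_inf_orthogonal_lt {L : Submodule ℝ (Euc d)} {b e : Euc d} (he : e ∈ L)
    (hbe : ⟪b, e⟫ ≠ 0) : finrank ℝ (L ⊓ (ℝ ∙ b)ᗮ : Submodule ℝ (Euc d)) < finrank ℝ L := by
  refine Submodule.finrank_lt_finrank_of_lt (lt_of_le_of_ne inf_le_left fun hc => hbe ?_)
  rw [← hc] at he
  exact Submodule.mem_orthogonal_singleton_iff_inner_right.1 he.2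

/-- The first moment inequality at unit scale. -/
lemma NUnif.first_moment_bound {ν : Measure (Euc d)} (h : NUnif n ν) (hn : 0 < n) :
    ∃ C : ℝ, 0 ≤ C ∧ ∀ x ∈ msupport ν, ‖x‖ ≤ 1 →
      |⟪∫ y, y ∂(gM ν 1), x⟫| ≤ C * ‖x‖ ^ 2 := by
  have := h.gM_prob hn one_pos
  refine ⟨2 * gC n 2 + 1, by have := gC_nonneg n 2; linarith, fun x hx hx1 => ?_⟩
  have hid : Integrable (fun y : Euc d => y) (gM ν 1) :=
    h.gM_integrable hn one_pos continuous_id (C := 1) (k := 1) (by simp)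
  have h1 := h.gM_taylor hn one_pos hx (by simpa using hx1) 2
  have h2 : |Real.exp (1 * ‖x‖ ^ 2) - 1| ≤ 2 * ‖x‖ ^ 2 := by
    have h3 : ‖x‖ ^ 2 ≤ 1 := pow_le_one₀ (norm_nonneg _) hx1
    have := Real.abs_exp_sub_one_le (x := 1 * ‖x‖ ^ 2) (by
      rw [one_mul, abs_of_nonneg (by positivity)]; exact h3)
    rw [one_mul, abs_of_nonneg (by positivity : 0 ≤ ‖x‖ ^ 2)] at this
    rwa [one_mul]
  simp only [Finset.sum_range_succ, Finset.sum_range_zero, zero_add, pow_zero, pow_one,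
    Nat.factorial_zero, Nat.factorial_one, Nat.cast_one, div_one, mul_one, integral_const,
    probReal_univ, smul_eq_mul, Real.sqrt_one, one_mul] at h1 h2
  rw [integral_const_mul, integral_inner hid] at h1
  rw [real_inner_comm]
  rw [abs_le] at h1 h2 ⊢
  constructor <;> nlinarith

/-- No `n`-uniform measure is carried by a half space of an `n`-plane. -/
lemma NUnif.not_half {ν : Measure (Euc d)} (h : NUnif n ν) (hn : 0 < n)
    {L : Submodule ℝ (Euc d)} (hL : finrank ℝ L = n) {e : Euc d} (he : e ∈ L) (he0 : e ≠ 0)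
    (hsub : msupport ν ⊆ L) (hhalf : ∀ x ∈ msupport ν, ⟪e, x⟫ ≤ 0) : False := by
  have := h.locFin
  have := h.gM_prob hn one_pos
  have hid : Integrable (fun y : Euc d => y) (gM ν 1) :=
    h.gM_integrable hn one_pos continuous_id (C := 1) (k := 1) (by simp)
  set b : Euc d := ∫ y, y ∂(gM ν 1) with hb
  by_cases hbe : ⟪b, e⟫ = 0
  · have h1 : ∫ y, -⟪e, y⟫ ∂(gM ν 1) = 0 := by
      rw [integral_neg, integral_inner hid, ← hb, real_inner_comm, hbe, neg_zero]
    have h2 := (integral_eq_zero_iff_of_nonneg_ae (by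
      filter_upwards [gM_ae_mem ν 1] with y hy using by simpa using hhalf y hy)
      (hid.const_inner e).neg).1 h1
    have h3 : msupport ν ⊆ {y | ⟪e, y⟫ = 0} :=
      NUnif.mem_of_ae (h.gZ_pos hn one_pos) (isClosed_eq (by fun_prop) continuous_const) (by
        filter_upwards [h2] with y hy using by simpa using hy)
    refine h.not_subset_of_finrank_lt (L ⊓ (ℝ ∙ e)ᗮ) ?_ fun x hx => ⟨hsub hx, ?_⟩
    · rw [← hL]; exact finrank_inf_orthogonal_lt he (by simpa using he0)
    · exact Submodule.mem_orthogonal_singleton_iff_inner_right.2 (h3 hx)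
  · obtain ⟨C, hC0, hC⟩ := h.first_moment_bound hn
    obtain ⟨M, hM, hseq, -⟩ := exists_blowup_seq (N := fun _ => ν) h.asympUnif
      (z := fun _ => 0) (C := 1) (τ := fun j => 1 / ((j : ℝ) + 1)) (fun _ => h.zero_mem) (by simp)
      (fun j => by positivity) (fun j => by
        rw [div_le_one (by positivity)]; linarith [(Nat.cast_nonneg j : (0 : ℝ) ≤ j)]) uf_one_div
    refine hM.not_subset_of_finrank_lt (L ⊓ (ℝ ∙ b)ᗮ) ?_ fun x hx => ?_
    · rw [← hL]; exact finrank_inf_orthogonal_lt he hbe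
    obtain ⟨y, hy, hyb, hyx⟩ := hseq x hx
    have hτ : ∀ j : ℕ, (0 : ℝ) < 1 / ((j : ℝ) + 1) := fun j => by positivity
    simp only [zero_add] at hy
    refine ⟨?_, ?_⟩
    · refine L.closed_of_finiteDimensional.mem_of_tendsto hyx (Eventually.of_forall fun j => ?_)
      have := L.smul_mem (1 / ((j : ℝ) + 1))⁻¹ (hsub (hy j))
      rwa [inv_smul_smul₀ (hτ j).ne'] at this
    · rw [SetLike.mem_coe, Submodule.mem_orthogonal_singleton_iff_inner_right]
      have h1 : Tendsto (fun j => ⟪b, y j⟫) UF (𝓝 ⟪b, x⟫) := tendsto_const_nhds.inner hyx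
      have h2 : Tendsto (fun j => ⟪b, y j⟫) UF (𝓝 0) := by
        have h3 : Tendsto (fun j : ℕ => 1 / ((j : ℝ) + 1) * (C * (2 * ‖x‖) ^ 2)) UF (𝓝 0) := by
          simpa using uf_one_div.mul_const (C * (2 * ‖x‖) ^ 2)
        refine squeeze_zero_norm' ?_ h3
        have h5 : Tendsto (fun j : ℕ => 1 / ((j : ℝ) + 1) * (2 * ‖x‖)) UF (𝓝 0) := by
          simpa using uf_one_div.mul_const (2 * ‖x‖)
        filter_upwards [h5.eventually (gt_mem_nhds one_pos)] with j hj
        have hn1 : ‖(1 / ((j : ℝ) + 1)) • y j‖ = 1 / ((j : ℝ) + 1) * ‖y j‖ := by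
          rw [norm_smul, Real.norm_of_nonneg (hτ j).le]
        have hle : 1 / ((j : ℝ) + 1) * ‖y j‖ ≤ 1 / ((j : ℝ) + 1) * (2 * ‖x‖) :=
          mul_le_mul_of_nonneg_left (hyb j) (hτ j).le
        have h4 := hC _ (hy j) (by rw [hn1]; linarith)
        rw [hn1, inner_smul_right, abs_mul, abs_of_pos (hτ j)] at h4
        rw [Real.norm_eq_abs]
        have h6 : |⟪b, y j⟫| ≤ C * (1 / ((j : ℝ) + 1) * ‖y j‖ ^ 2) := by
          refine le_of_mul_le_mul_left (h4.trans_eq ?_) (hτ j)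
          ring
        refine h6.trans ?_
        have h7 : ‖y j‖ ^ 2 ≤ (2 * ‖x‖) ^ 2 := by gcongr; exact hyb j
        calc C * (1 / ((j : ℝ) + 1) * ‖y j‖ ^ 2) ≤ C * (1 / ((j : ℝ) + 1) * (2 * ‖x‖) ^ 2) := by
              have := hτ j
              gcongr
          _ = _ := by ring
      exact tendsto_nhds_unique h1 h2

/-- Limits of asymptotically uniform measures whose supports collapse onto an `n`-plane near the
origin have no holes. -/
lemma no_holes {N : ℕ → Measure (Euc d)} [∀ j, IsLocallyFiniteMeasure (N j)]
    (hN : AsympUnif n N) (hn : 0 < n) (h0 : ∀ j, (0 : Euc d) ∈ msupport (N j))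
    {L : Submodule ℝ (Euc d)} (hL : finrank ℝ L = n) {ρ : ℝ} (hρ : 0 < ρ)
    (hlim : ∀ y : ℕ → Euc d, (∀ j, y j ∈ msupport (N j)) → (∀ j, ‖y j‖ ≤ ρ) →
      ∀ q, Tendsto y UF (𝓝 q) → q ∈ L) {p : Euc d} (hpL : p ∈ L) (hp : ‖p‖ < ρ) :
    Tendsto (fun j => infDist p (msupport (N j))) UF (𝓝 0) := by
  by_contra hpS
  have hlip : ∀ x y j, infDist x (msupport (N j)) ≤ infDist y (msupport (N j)) + dist x y :=
    fun x y j => infDist_le_infDist_add_dist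
  have hlim0 : ∀ x : Euc d, ∃ D, 0 ≤ D ∧ Tendsto (fun j => infDist x (msupport (N j))) UF (𝓝 D) := by
    intro x
    obtain ⟨D, -, hD⟩ := uf_bdd (f := fun j => infDist x (msupport (N j))) (C := ‖x‖)
      (Eventually.of_forall fun j => by
        rw [Real.norm_of_nonneg infDist_nonneg]
        simpa using infDist_le_dist_of_mem (x := x) (h0 j))
    exact ⟨D, ge_of_tendsto' hD fun j => infDist_nonneg, hD⟩
  choose D hD0 hD using hlim0
  have hDlip : ∀ x y, D x ≤ D y + dist x y := fun x y =>
    le_of_tendsto_of_tendsto' (hD x) ((hD y).add_const _) fun j => hlip x y j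
  have hDcont : Continuous D := by
    refine (LipschitzWith.of_le_add_mul 1 fun x y => ?_).continuous
    simpa using hDlip x y
  have hDp : D p ≠ 0 := fun h => hpS (h ▸ hD p)
  have hA : IsCompact {t : ℝ | t ∈ Icc (0 : ℝ) 1 ∧ D (t • p) = 0} :=
    isCompact_Icc.inter_right (isClosed_eq (by fun_prop) continuous_const)
  have hD00 : D 0 = 0 := by
    refine tendsto_nhds_unique (hD 0) (tendsto_const_nhds.congr fun j => ?_)
    exact (infDist_zero_of_mem (h0 j)).symm
  obtain ⟨t, ht, htmax⟩ := hA.exists_isGreatest ⟨0, by simp [hD00]⟩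
  obtain ⟨⟨ht0, ht1⟩, htD⟩ := ht
  have ht1' : t < 1 := lt_of_le_of_ne ht1 fun h => hDp (by rw [h, one_smul] at htD; exact htD)
  obtain ⟨ε, hε, hε1, hεp⟩ : ∃ ε : ℝ, 0 < ε ∧ t + ε ≤ 1 ∧ 2 * (ε * ‖p‖) < ρ - ‖p‖ := by
    have h1 : 0 < ρ - ‖p‖ := by linarith
    refine ⟨min (1 - t) ((ρ - ‖p‖) / (2 * (‖p‖ + 1))), lt_min (by linarith) (by positivity), ?_, ?_⟩
    · linarith [min_le_left (1 - t) ((ρ - ‖p‖) / (2 * (‖p‖ + 1)))]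
    · have h2 : (ρ - ‖p‖) / (2 * (‖p‖ + 1)) * (‖p‖ + 1) = (ρ - ‖p‖) / 2 := by field_simp
      have h3 : 0 < (ρ - ‖p‖) / (2 * (‖p‖ + 1)) := by positivity
      have h4 := mul_le_mul_of_nonneg_right (min_le_right (1 - t) ((ρ - ‖p‖) / (2 * (‖p‖ + 1))))
        (norm_nonneg p)
      nlinarith
  set p' : Euc d := (t + ε) • p with hp'
  have hp'L : p' ∈ L := L.smul_mem _ hpL
  have hDp' : 0 < D p' := by
    refine lt_of_le_of_ne (hD0 _) fun h => ?_
    have := htmax (show t + ε ∈ _ from ⟨⟨by linarith, hε1⟩, h.symm⟩)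
    linarith
  have hDp'2 : D p' ≤ ε * ‖p‖ := by
    have h1 := hDlip p' (t • p)
    rw [htD, zero_add, dist_eq_norm, hp', ← sub_smul, add_sub_cancel_left, norm_smul,
      Real.norm_of_nonneg hε.le] at h1
    exact h1
  choose q hq hqd using fun j => exists_nearest (isClosed_msupport (N j)) ⟨0, h0 j⟩ p'
  have hqb : ∀ j, ‖q j‖ ≤ 2 * ‖p'‖ := fun j => by
    have h1 : dist p' (q j) ≤ ‖p'‖ := by
      rw [hqd]; simpa using infDist_le_dist_of_mem (x := p') (h0 j)
    have h2 := norm_sub_norm_le (q j) p'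
    rw [← dist_eq_norm, dist_comm] at h2
    linarith
  obtain ⟨q0, -, hqq⟩ := uf_bdd (Eventually.of_forall hqb)
  have hdist : dist p' q0 = D p' := by
    refine tendsto_nhds_unique (tendsto_const_nhds.dist hqq) ((hD p').congr fun j => (hqd j).symm)
  have hq0 : ‖q0‖ < ρ := by
    have h2 := norm_sub_norm_le q0 p'
    rw [← dist_eq_norm, dist_comm, hdist] at h2
    have h3 : ‖p'‖ ≤ ‖p‖ := by
      rw [hp', norm_smul, Real.norm_of_nonneg (by linarith)]
      exact mul_le_of_le_one_left (norm_nonneg _) hε1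
    have : 0 ≤ ε * ‖p‖ := by positivity
    linarith
  have hq0L : q0 ∈ L := by
    classical
    refine hlim (fun j => if ‖q j‖ ≤ ρ then q j else 0) (fun j => ?_) (fun j => ?_) q0 ?_
    · split_ifs; exacts [hq j, h0 j]
    · split_ifs with h; exacts [h, by simpa using hρ.le]
    · refine hqq.congr' ?_
      filter_upwards [hqq.norm.eventually (gt_mem_nhds hq0)] with j hj
      rw [if_pos hj.le]
  set g : Euc d → Euc d := fun x => Lᗮ.starProjection x with hg
  have hgc : Continuous g := by fun_prop
  have hgL : ∀ x, g x = 0 ↔ x ∈ L := fun x => by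
    rw [hg]; simp only [Submodule.starProjection_apply_eq_zero_iff, Submodule.orthogonal_orthogonal]
  have hcp : ∀ j, IsCompact (msupport (N j) ∩ closedBall 0 ρ) := fun j =>
    (isCompact_closedBall 0 ρ).inter_left (isClosed_msupport _)
  choose y hy hymax using fun j => (hcp j).exists_isMaxOn ⟨0, h0 j, by simpa using hρ.le⟩
    (f := fun x => ‖g x‖) hgc.norm.continuousOn
  have hyb : ∀ j, ‖y j‖ ≤ ρ := fun j => by simpa using (hy j).2
  obtain ⟨y0, -, hyy⟩ := uf_bdd (Eventually.of_forall hyb)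
  have hm0 : Tendsto (fun j => ‖g (y j)‖) UF (𝓝 0) := by
    have h1 := (hgc.tendsto y0).comp hyy
    rw [(hgL y0).2 (hlim y (fun j => (hy j).1) hyb y0 hyy)] at h1
    simpa using h1.norm
  set τ : ℕ → ℝ := fun j => √(‖g (y j)‖ + 1 / ((j : ℝ) + 1)) with hτdef
  have hτ : ∀ j, 0 < τ j := fun j => Real.sqrt_pos.2 (by positivity)
  have hτ0 : Tendsto τ UF (𝓝 0) := by
    have h1 := (Real.continuous_sqrt.tendsto _).comp (hm0.add uf_one_div)
    rwa [add_zero, Real.sqrt_zero] at h1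
  have hτm : ∀ j, ‖g (y j)‖ ≤ τ j ^ 2 := fun j => by
    rw [hτdef]; simp only
    rw [Real.sq_sqrt (by positivity)]
    have : 0 < 1 / ((j : ℝ) + 1) := by positivity
    linarith
  have hτC : ∀ j, τ j ≤ 2 * ‖p'‖ + (ρ + 1) := fun j => by
    have h1 : ‖g (y j)‖ ≤ ρ := (Lᗮ.norm_starProjection_apply_le _).trans (hyb j)
    have h2 : 1 / ((j : ℝ) + 1) ≤ 1 := by
      rw [div_le_one (by positivity)]; linarith [(Nat.cast_nonneg j : (0 : ℝ) ≤ j)]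
    have h3 : τ j ≤ ρ + 1 := Real.sqrt_le_iff.2 ⟨by linarith, by nlinarith⟩
    linarith [norm_nonneg p']
  obtain ⟨M, hM, hseq, -⟩ := exists_blowup_seq hN hq
    (fun j => (hqb j).trans (by linarith : 2 * ‖p'‖ ≤ 2 * ‖p'‖ + (ρ + 1))) hτ hτC hτ0
  refine hM.not_half hn hL (L.sub_mem hp'L hq0L) (fun h => ?_) (fun x hx => ?_) (fun x hx => ?_)
  · rw [dist_eq_norm, h, norm_zero] at hdist
    exact hDp'.ne hdist
  · obtain ⟨w, hw, hwb, hwx⟩ := hseq x hx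
    refine (hgL x).1 ?_
    have h1 : Tendsto (fun j => q j + τ j • w j) UF (𝓝 q0) := by
      simpa using hqq.add (hτ0.smul hwx)
    refine tendsto_nhds_unique ((hgc.tendsto x).comp hwx) (squeeze_zero_norm' ?_
      (by simpa using hτ0.const_mul 2))
    filter_upwards [h1.norm.eventually (gt_mem_nhds hq0),
      hqq.norm.eventually (gt_mem_nhds hq0)] with j hj1 hj2
    have h2 : ‖g (q j + τ j • w j)‖ ≤ ‖g (y j)‖ := hymax j ⟨hw j, by simpa using hj1.le⟩
    have h3 : ‖g (q j)‖ ≤ ‖g (y j)‖ := hymax j ⟨hq j, by simpa using hj2.le⟩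
    have h4 : g (q j + τ j • w j) - g (q j) = τ j • g (w j) := by
      simp only [hg, map_add, map_smul, add_sub_cancel_left]
    have h5 := norm_sub_le (g (q j + τ j • w j)) (g (q j))
    rw [h4, norm_smul, Real.norm_of_nonneg (hτ j).le] at h5
    refine le_of_mul_le_mul_left ?_ (hτ j)
    simp only [Function.comp_apply]
    nlinarith [hτm j]
  · obtain ⟨w, hw, hwb, hwx⟩ := hseq x hx
    have h1 : Tendsto (fun j => 2 * ⟪p' - q j, w j⟫) UF (𝓝 (2 * ⟪p' - q0, x⟫)) :=
      ((tendsto_const_nhds.sub hqq).inner hwx).const_mul 2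
    have h2 : Tendsto (fun j => τ j * ‖w j‖ ^ 2) UF (𝓝 0) := by
      simpa using hτ0.mul (hwx.norm.pow 2)
    have h3 := le_of_tendsto_of_tendsto' h1 h2 fun j => by
      have h4 : dist p' (q j) ≤ dist p' (q j + τ j • w j) := by
        rw [hqd]; exact infDist_le_dist_of_mem (hw j)
      rw [dist_eq_norm, dist_eq_norm, ← sub_sub] at h4
      have h5 := pow_le_pow_left₀ (norm_nonneg _) h4 2
      rw [norm_sub_sq_real (p' - q j), inner_smul_right, norm_smul, Real.norm_of_nonneg (hτ j).le] at h5
      refine le_of_mul_le_mul_left ?_ (hτ j)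
      nlinarith
    linarith

lemma NUnif.flat {ν : Measure (Euc d)} (h : NUnif n ν) (hn : 0 < n) {L : Submodule ℝ (Euc d)}
    (hL : finrank ℝ L = n) (hsub : msupport ν ⊆ L) : msupport ν = L := by
  have := h.locFin
  refine hsub.antisymm fun p hp => ?_
  have h1 := no_holes h.asympUnif hn (fun _ => h.zero_mem) hL (ρ := ‖p‖ + 1) (by positivity)
    (fun y hy _ q hq => L.closed_of_finiteDimensional.mem_of_tendsto hq
      (Eventually.of_forall fun j => hsub (hy j))) hp (by linarith)
  have h2 := tendsto_nhds_unique h1 tendsto_const_nhds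
  rw [← (isClosed_msupport ν).closure_eq, mem_closure_iff_infDist_zero ⟨0, h.zero_mem⟩]
  exact h2.symm

/-- The first moment of the normalised Gaussian weight. -/
def mom1 (ν : Measure (Euc d)) (s : ℝ) : Euc d := ∫ y, y ∂(gM ν s)

/-- The normalised second moments. -/
def mom2 (ν : Measure (Euc d)) (s : ℝ) (x z : Euc d) : ℝ := 2 * s * ∫ y, ⟪x, y⟫ * ⟪z, y⟫ ∂(gM ν s)

lemma NUnif.integrable_id {ν : Measure (Euc d)} (h : NUnif n ν) (hn : 0 < n) {s : ℝ} (hs : 0 < s) :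
    Integrable (fun y : Euc d => y) (gM ν s) :=
  h.gM_integrable hn hs continuous_id (C := 1) (k := 1) (by simp)

lemma norm_inner_mul_le (x z y : Euc d) : ‖⟪x, y⟫ * ⟪z, y⟫‖ ≤ ‖x‖ * ‖z‖ * ‖y‖ ^ 2 := by
  rw [norm_mul]
  calc _ ≤ (‖x‖ * ‖y‖) * (‖z‖ * ‖y‖) := by gcongr <;> exact norm_inner_le_norm _ _
    _ = _ := by ring

lemma NUnif.integrable_inner_mul {ν : Measure (Euc d)} (h : NUnif n ν) (hn : 0 < n) {s : ℝ}
    (hs : 0 < s) (x z : Euc d) : Integrable (fun y : Euc d => ⟪x, y⟫ * ⟪z, y⟫) (gM ν s) :=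
  h.gM_integrable hn hs (by fun_prop) (norm_inner_mul_le x z)

lemma NUnif.mom1_inner {ν : Measure (Euc d)} (h : NUnif n ν) (hn : 0 < n) {s : ℝ} (hs : 0 < s)
    (x : Euc d) : ⟪x, mom1 ν s⟫ = ∫ y, ⟪x, y⟫ ∂(gM ν s) :=
  (integral_inner (h.integrable_id hn hs) x).symm

lemma mom2_comm (ν : Measure (Euc d)) (s : ℝ) (x z : Euc d) : mom2 ν s x z = mom2 ν s z x := by
  simp only [mom2, mul_comm]

lemma NUnif.mom2_add {ν : Measure (Euc d)} (h : NUnif n ν) (hn : 0 < n) {s : ℝ} (hs : 0 < s)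
    (x x' z : Euc d) : mom2 ν s (x + x') z = mom2 ν s x z + mom2 ν s x' z := by
  simp only [mom2, inner_add_left, add_mul]
  rw [integral_add (h.integrable_inner_mul hn hs _ _) (h.integrable_inner_mul hn hs _ _), mul_add]

lemma mom2_smul (ν : Measure (Euc d)) (s : ℝ) (c : ℝ) (x z : Euc d) :
    mom2 ν s (c • x) z = c * mom2 ν s x z := by
  simp only [mom2, real_inner_smul_left, mul_assoc, integral_const_mul]
  ring

lemma NUnif.mom2_bound {ν : Measure (Euc d)} (h : NUnif n ν) (hn : 0 < n) {s : ℝ} (hs : 0 < s)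
    (x z : Euc d) : |mom2 ν s x z| ≤ 2 * (‖x‖ * ‖z‖ * gC n 2) := by
  have h1 := h.gM_bound hn hs (f := fun y => ⟪x, y⟫ * ⟪z, y⟫) (by positivity)
    (norm_inner_mul_le x z)
  rw [Real.sq_sqrt hs.le] at h1
  rw [mom2, abs_mul, abs_of_pos (by positivity : 0 < 2 * s), mul_assoc]
  rw [Real.norm_eq_abs] at h1
  linarith

lemma mom2_self_nonneg (ν : Measure (Euc d)) {s : ℝ} (hs : 0 < s) (x : Euc d) :
    0 ≤ mom2 ν s x x :=
  mul_nonneg (by positivity) (integral_nonneg fun y => mul_self_nonneg _)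

lemma NUnif.mom2_trace {ν : Measure (Euc d)} (h : NUnif n ν) (hn : 0 < n) {s : ℝ} (hs : 0 < s)
    (e : OrthonormalBasis (Fin d) ℝ (Euc d)) : ∑ i, mom2 ν s (e i) (e i) = n := by
  have h1 := h.gM_sq_norm hn hs
  rw [integral_const_mul] at h1
  simp only [mom2]
  rw [← Finset.mul_sum, ← integral_finsetSum _ fun i _ => h.integrable_inner_mul hn hs _ _]
  have : ∀ y : Euc d, ∑ i, ⟪e i, y⟫ * ⟪e i, y⟫ = ‖y‖ ^ 2 := fun y => by
    rw [← e.sum_sq_norm_inner_right y]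
    refine Finset.sum_congr rfl fun i _ => ?_
    rw [Real.norm_eq_abs, sq_abs, sq]
  simp only [this]
  linarith

lemma tendsto_exp_slope (c : ℝ) :
    Tendsto (fun s : ℝ => (Real.exp (s * c) - 1) / s) (𝓝[>] 0) (𝓝 c) := by
  have h1 : HasDerivAt (fun s : ℝ => Real.exp (s * c)) c 0 := by
    have h2 := ((hasDerivAt_id (0 : ℝ)).mul_const c).exp
    simpa using h2
  refine h1.tendsto_slope_zero_right.congr fun s => ?_
  simp [div_eq_inv_mul]

/-- The first order relation on the support. -/
lemma NUnif.tendsto_first_order {ν : Measure (Euc d)} (h : NUnif n ν) (hn : 0 < n) {x : Euc d}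
    (hx : x ∈ msupport ν) :
    Tendsto (fun s => 2 * ⟪x, mom1 ν s⟫ + mom2 ν s x x) (𝓝[>] 0) (𝓝 (‖x‖ ^ 2)) := by
  have hs0 : Tendsto (fun s : ℝ => √s) (𝓝[>] 0) (𝓝 0) := by
    have := Real.continuous_sqrt.tendsto 0
    rw [Real.sqrt_zero] at this
    exact this.mono_left nhdsWithin_le_nhds
  have h1 : Tendsto (fun s => 2 * ⟪x, mom1 ν s⟫ + mom2 ν s x x -
      (Real.exp (s * ‖x‖ ^ 2) - 1) / s) (𝓝[>] 0) (𝓝 0) := by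
    have h2 : Tendsto (fun s : ℝ => gC n 3 * (2 * ‖x‖) ^ 3 * √s) (𝓝[>] 0) (𝓝 0) := by
      simpa using hs0.const_mul (gC n 3 * (2 * ‖x‖) ^ 3)
    refine squeeze_zero_norm' ?_ h2
    have h3 : Tendsto (fun s : ℝ => √s * ‖x‖) (𝓝[>] 0) (𝓝 0) := by
      simpa using hs0.mul_const ‖x‖
    filter_upwards [self_mem_nhdsWithin, h3.eventually (gt_mem_nhds one_pos)] with s hs hsx
    have hs : 0 < s := hs
    have := h.gM_prob hn hs
    have h4 := h.gM_taylor hn hs hx hsx.le 3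
    simp only [Finset.sum_range_succ, Finset.sum_range_zero, zero_add, pow_zero, pow_one,
      Nat.factorial_zero, Nat.factorial_one, Nat.cast_one, div_one, integral_const,
      probReal_univ, smul_eq_mul, mul_one, Nat.factorial_two, Nat.cast_ofNat] at h4
    rw [integral_const_mul, ← h.mom1_inner hn hs] at h4
    have h5 : ∫ y, (2 * s * ⟪x, y⟫) ^ 2 / 2 ∂(gM ν s) = s * mom2 ν s x x := by
      rw [mom2, ← mul_assoc, ← integral_const_mul]
      congr 1; ext y; ring
    rw [h5] at h4
    have h6 : (2 * (√s * ‖x‖)) ^ 3 = s * ((2 * ‖x‖) ^ 3 * √s) := by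
      have := Real.mul_self_sqrt hs.le
      calc (2 * (√s * ‖x‖)) ^ 3 = (√s * √s) * ((2 * ‖x‖) ^ 3 * √s) := by ring
        _ = _ := by rw [this]
    rw [Real.norm_eq_abs]
    have h7 : 2 * ⟪x, mom1 ν s⟫ + mom2 ν s x x - (Real.exp (s * ‖x‖ ^ 2) - 1) / s =
        (1 + 2 * s * ⟪x, mom1 ν s⟫ + s * mom2 ν s x x - Real.exp (s * ‖x‖ ^ 2)) / s := by
      field_simp; ring
    rw [h7, abs_div, abs_of_pos hs, div_le_iff₀ hs]
    refine h4.trans_eq ?_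
    rw [h6]; ring
  have h2 := h1.add (tendsto_exp_slope (‖x‖ ^ 2))
  simpa using h2

lemma NUnif.mom1_mem_span {ν : Measure (Euc d)} (h : NUnif n ν) (hn : 0 < n) {s : ℝ} (hs : 0 < s) :
    mom1 ν s ∈ Submodule.span ℝ (msupport ν) := by
  rw [← Submodule.orthogonal_orthogonal (Submodule.span ℝ (msupport ν))]
  intro x hx
  rw [h.mom1_inner hn hs]
  refine integral_eq_zero_of_ae ?_
  filter_upwards [gM_ae_mem ν s] with y hy
  exact Submodule.inner_left_of_mem_orthogonal (Submodule.subset_span hy) hx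

lemma NUnif.mom1_bdd {ν : Measure (Euc d)} (h : NUnif n ν) (hn : 0 < n) :
    ∃ C : ℝ, ∀ᶠ s in 𝓝[>] 0, ‖mom1 ν s‖ ≤ C := by
  let W : Submodule ℝ (Euc d) :=
    { carrier := {x | ∃ C : ℝ, ∀ᶠ s in 𝓝[>] 0, |⟪x, mom1 ν s⟫| ≤ C}
      zero_mem' := ⟨0, by simp⟩
      add_mem' := by
        rintro x z ⟨C, hC⟩ ⟨C', hC'⟩
        refine ⟨C + C', ?_⟩
        filter_upwards [hC, hC'] with s h1 h2
        rw [inner_add_left]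
        exact (abs_add_le _ _).trans (add_le_add h1 h2)
      smul_mem' := by
        rintro c x ⟨C, hC⟩
        refine ⟨|c| * C, ?_⟩
        filter_upwards [hC] with s h1
        rw [real_inner_smul_left, abs_mul]
        gcongr }
  have hW : ∀ x, x ∈ W := by
    have h1 : Submodule.span ℝ (msupport ν) ≤ W := by
      refine Submodule.span_le.2 fun x hx => ⟨(‖x‖ ^ 2 + 1) + 2 * (‖x‖ * ‖x‖ * gC n 2), ?_⟩
      have h2 := (h.tendsto_first_order hn hx).abs
      rw [abs_of_nonneg (by positivity)] at h2
      filter_upwards [self_mem_nhdsWithin, h2.eventually (gt_mem_nhds (lt_add_one _))] with s hs h3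
      have h4 := h.mom2_bound hn hs x x
      rw [abs_lt] at h3
      rw [abs_le] at h4 ⊢
      constructor <;> nlinarith [norm_nonneg x, h3.1, h3.2]
    have h2 : (Submodule.span ℝ (msupport ν))ᗮ ≤ W := by
      refine fun x hx => ⟨0, ?_⟩
      filter_upwards [self_mem_nhdsWithin] with s hs
      rw [Submodule.inner_left_of_mem_orthogonal (h.mom1_mem_span hn hs) hx, abs_zero]
    intro x
    have := sup_le h1 h2
    rw [Submodule.sup_orthogonal_of_hasOrthogonalProjection] at this
    exact this trivial
  choose C hC using fun i : Fin d => hW (EuclideanSpace.basisFun (Fin d) ℝ i)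
  refine ⟨√(∑ i, C i ^ 2), ?_⟩
  filter_upwards [eventually_all.2 hC] with s hs
  refine Real.le_sqrt_of_sq_le ?_
  rw [← (EuclideanSpace.basisFun (Fin d) ℝ).sum_sq_norm_inner_right]
  gcongr with i
  exact hs i

/-- The first moments converge along sequences of scales tending to zero. -/
lemma NUnif.exists_mom1_limit {ν : Measure (Euc d)} (h : NUnif n ν) (hn : 0 < n) {s : ℕ → ℝ}
    (hs : Tendsto s UF (𝓝[>] 0)) :
    ∃ b, Tendsto (fun j => mom1 ν (s j)) UF (𝓝 b) ∧ b ∈ Submodule.span ℝ (msupport ν) := by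
  obtain ⟨C, hC⟩ := h.mom1_bdd hn
  obtain ⟨b, -, hb⟩ := uf_bdd (hs.eventually hC)
  refine ⟨b, hb, (Submodule.closed_of_finiteDimensional _).mem_of_tendsto hb ?_⟩
  filter_upwards [hs.eventually self_mem_nhdsWithin] with j hj using h.mom1_mem_span hn hj

/-- The second moments converge, and the limit can be diagonalised. -/
lemma NUnif.exists_mom2_limit {ν : Measure (Euc d)} (h : NUnif n ν) (hn : 0 < n) {s : ℕ → ℝ}
    (hs : Tendsto s UF (𝓝[>] 0)) :
    ∃ (e : OrthonormalBasis (Fin d) ℝ (Euc d)) (α : Fin d → ℝ), (∀ i, 0 ≤ α i) ∧ ∑ i, α i = n ∧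
      ∀ x, Tendsto (fun j => mom2 ν (s j) x x) UF (𝓝 (∑ i, α i * ⟪e i, x⟫ ^ 2)) := by
  have hs' : ∀ᶠ j in UF, 0 < s j := hs.eventually self_mem_nhdsWithin
  have h1 : ∀ x z, ∃ q, Tendsto (fun j => mom2 ν (s j) x z) UF (𝓝 q) := fun x z => by
    obtain ⟨q, -, hq⟩ := uf_bdd (f := fun j => mom2 ν (s j) x z)
      (hs'.mono fun j hj => h.mom2_bound hn hj x z)
    exact ⟨q, hq⟩
  choose q hq using h1
  have hadd : ∀ x x' z, q (x + x') z = q x z + q x' z := fun x x' z =>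
    tendsto_nhds_unique (hq _ _) (((hq x z).add (hq x' z)).congr' (hs'.mono fun j hj =>
      (h.mom2_add hn hj _ _ _).symm))
  have hsmul : ∀ c x z, q (c • x) z = c * q x z := fun c x z =>
    tendsto_nhds_unique (hq _ _) (((hq x z).const_mul c).congr fun j => (mom2_smul _ _ _ _ _).symm)
  have hcomm : ∀ x z, q x z = q z x := fun x z =>
    tendsto_nhds_unique (hq _ _) ((hq z x).congr fun j => mom2_comm _ _ _ _)
  let f := EuclideanSpace.basisFun (Fin d) ℝ
  let T : Euc d →ₗ[ℝ] Euc d :=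
    { toFun := fun x => ∑ i, q x (f i) • f i
      map_add' := fun x x' => by simp only [hadd, add_smul, Finset.sum_add_distrib]
      map_smul' := fun c x => by
        simp only [hsmul, RingHom.id_apply, Finset.smul_sum, smul_smul] }
  have hqsum : ∀ x z, q x z = ∑ i, ⟪f i, z⟫ * q x (f i) := fun x z => by
    let l : Euc d →ₗ[ℝ] ℝ :=
      { toFun := fun z => q x z
        map_add' := fun z z' => by rw [hcomm, hadd, hcomm z, hcomm z']
        map_smul' := fun c z => by rw [hcomm, hsmul, hcomm z]; rfl }
    have h2 : l z = l (∑ i, ⟪f i, z⟫ • f i) := by rw [f.sum_repr' z]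
    rw [map_sum] at h2
    simp only [map_smul, smul_eq_mul] at h2
    exact h2
  have hT : ∀ x z, ⟪T x, z⟫ = q x z := fun x z => by
    rw [hqsum x z]
    change ⟪∑ i, q x (f i) • f i, z⟫ = _
    simp only [sum_inner, real_inner_smul_left, mul_comm]
  have hTs : T.IsSymmetric := fun x z => by
    rw [hT, real_inner_comm, hT, hcomm]
  have hd : finrank ℝ (Euc d) = d := by simp
  let e := hTs.eigenvectorBasis hd
  let α := hTs.eigenvalues hd
  have hTe : ∀ i, T (e i) = α i • e i := hTs.apply_eigenvectorBasis hd
  have hqe : ∀ i, q (e i) (e i) = α i := fun i => by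
    rw [← hT, hTe, real_inner_smul_left, real_inner_self_eq_norm_sq, e.orthonormal.1 i]
    ring
  refine ⟨e, α, fun i => ?_, ?_, fun x => ?_⟩
  · rw [← hqe]
    exact ge_of_tendsto (hq _ _) (hs'.mono fun j hj => mom2_self_nonneg ν hj _)
  · simp only [← hqe]
    refine tendsto_nhds_unique (tendsto_finsetSum _ fun i _ => hq (e i) (e i)) ?_
    exact tendsto_const_nhds.congr' (hs'.mono fun j hj => (h.mom2_trace hn hj e).symm)
  · have h3 : q x x = ∑ i, α i * ⟪e i, x⟫ ^ 2 := by
      rw [← hT]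
      conv_lhs => rw [← e.sum_inner_mul_inner]
      refine Finset.sum_congr rfl fun i _ => ?_
      rw [hTs, hTe, real_inner_smul_right, real_inner_comm]
      ring
    rw [← h3]; exact hq x x

/-- `S` comes `ε R`-close to the `R`-ball of some `n`-plane, for arbitrarily large radii `R`. -/
def NearPlanes (n : ℕ) (S : Set (Euc d)) (ε : ℝ) : Prop :=
  ∀ R0 : ℝ, ∃ R, R0 ≤ R ∧ ∃ v : Fin n → Euc d, Orthonormal ℝ v ∧
    ∀ w ∈ Submodule.span ℝ (Set.range v), ‖w‖ ≤ 1 → ∃ x ∈ S, ‖x - R • w‖ ≤ ε * R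

lemma sum_sq_coord (e : OrthonormalBasis (Fin d) ℝ (Euc d)) (x : Euc d) :
    ∑ k, ⟪e k, x⟫ ^ 2 = ‖x‖ ^ 2 := by
  rw [← e.sum_sq_norm_inner_right x]
  simp

lemma quad_sub_le (e : OrthonormalBasis (Fin d) ℝ (Euc d)) {α : Fin d → ℝ} {N : ℝ}
    (h0 : ∀ k, 0 ≤ α k) (hN : ∀ k, α k ≤ N) (hN0 : 0 ≤ N) (x z : Euc d) :
    |∑ k, α k * ⟪e k, x⟫ ^ 2 - ∑ k, α k * ⟪e k, z⟫ ^ 2| ≤ N * (‖x - z‖ * ‖x + z‖) := by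
  rw [← Finset.sum_sub_distrib]
  refine (Finset.abs_sum_le_sum_abs _ _).trans ?_
  have h1 : ∀ k, |α k * ⟪e k, x⟫ ^ 2 - α k * ⟪e k, z⟫ ^ 2| ≤
      N * (|⟪e k, x - z⟫| * |⟪e k, x + z⟫|) := fun k => by
    have : α k * ⟪e k, x⟫ ^ 2 - α k * ⟪e k, z⟫ ^ 2 = α k * (⟪e k, x - z⟫ * ⟪e k, x + z⟫) := by
      rw [inner_sub_right, inner_add_right]; ring
    rw [this, abs_mul, abs_mul, abs_of_nonneg (h0 k)]
    gcongr
    exact hN k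
  refine (Finset.sum_le_sum fun k _ => h1 k).trans ?_
  rw [← Finset.mul_sum]
  gcongr
  refine (Real.sum_mul_le_sqrt_mul_sqrt _ _ _).trans_eq ?_
  simp only [sq_abs, sum_sq_coord, Real.sqrt_sq (norm_nonneg _)]

lemma abs_inner_le {x b : Euc d} {R : ℝ} (hx : ‖x‖ ≤ R) : |⟪x, b⟫| ≤ R * ‖b‖ :=
  (abs_real_inner_le_norm _ _).trans (by gcongr)

section Gap

variable {S : Set (Euc d)} {b : Euc d} {e : OrthonormalBasis (Fin d) ℝ (Euc d)} {α : Fin d → ℝ}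

set_option maxHeartbeats 1000000 in
lemma gap_frame (hn : 0 < n) (hnd : n ≤ d) (h0 : ∀ k, 0 ≤ α k) (hsum : ∑ k, α k = n)
    (hFO : ∀ x ∈ S, ‖x‖ ^ 2 = 2 * ⟪x, b⟫ + ∑ k, α k * ⟪e k, x⟫ ^ 2)
    (hF : NearPlanes n S (1 / (10 ^ 4 * (d : ℝ) ^ 4))) (R0 : ℝ) :
    ∃ R, R0 ≤ R ∧ ∃ θ : Fin d → ℝ, (∀ k, 0 ≤ θ k) ∧ (∀ k, θ k ≤ 1) ∧ ∑ k, θ k = n ∧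
      (n : ℝ) - 1 / 64 ≤ ∑ k, α k * θ k ∧ ∀ k, 1 / 2 ≤ α k → ∀ σ : ℝ, |σ| = 1 →
        ∃ x ∈ S, ‖x - (σ * R) • e k‖ ≤ R / (8 * d) := by
  have hN1 : (1 : ℝ) ≤ n := by exact_mod_cast hn
  have hND : (n : ℝ) ≤ d := by exact_mod_cast hnd
  set N : ℝ := (n : ℝ) with hN
  set D : ℝ := (d : ℝ) with hD
  have hD1 : 1 ≤ D := hN1.trans hND
  have hD0 : 0 < D := by linarith
  set ε : ℝ := 1 / (10 ^ 4 * D ^ 4) with hε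
  have hε0 : 0 < ε := by positivity
  have hNε : N ^ 2 * ε ≤ 1 / (10 ^ 4 * D ^ 2) := by
    calc N ^ 2 * ε ≤ D ^ 2 * ε := by gcongr
      _ = _ := by rw [hε]; field_simp
  have hNε2 : N ^ 2 * ε ≤ 1 / 10 ^ 4 := hNε.trans (by
    gcongr; exact le_mul_of_one_le_right (by norm_num) (one_le_pow₀ hD1))
  have hNε1 : N * ε ≤ N ^ 2 * ε := by gcongr; nlinarith
  have hε1 : ε ≤ N * ε := le_mul_of_one_le_left hε0.le hN1
  have hεD : ε ≤ 1 / (40 * D) := by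
    rw [hε]
    gcongr
    · norm_num
    · exact le_self_pow₀ hD1 (by norm_num)
  have hαN : ∀ k, α k ≤ N := fun k => by
    rw [← hsum]; exact Finset.single_le_sum (fun i _ => h0 i) (Finset.mem_univ k)
  obtain ⟨R, hR, v, hv, hvS⟩ := hF (max (max R0 1) (4 * ‖b‖ / (N * ε)))
  have hR0 : R0 ≤ R := (le_max_left _ _).trans ((le_max_left _ _).trans hR)
  have hR1 : 1 ≤ R := (le_max_right _ _).trans ((le_max_left _ _).trans hR)
  have hRp : 0 < R := by linarith
  have hRb : 4 * ‖b‖ ≤ N * ε * R := by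
    have := (le_max_right _ _).trans hR
    rw [div_le_iff₀ (by positivity)] at this
    linarith
  have hq : ∀ i, 1 - 6 * (N * ε) ≤ ∑ k, α k * ⟪e k, v i⟫ ^ 2 := fun i => by
    have hvi : ‖v i‖ = 1 := hv.1 i
    obtain ⟨x, hx, hxv⟩ := hvS (v i) (Submodule.subset_span ⟨i, rfl⟩) hvi.le
    have hRv : ‖R • v i‖ = R := by rw [norm_smul, hvi, mul_one, Real.norm_of_nonneg hRp.le]
    have h1 : ‖x‖ ≤ R + ε * R := by
      have := norm_add_le (x - R • v i) (R • v i)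
      rw [sub_add_cancel, hRv] at this; linarith
    have h2 : R - ε * R ≤ ‖x‖ := by
      have := norm_sub_norm_le (R • v i) x
      rw [hRv, norm_sub_rev] at this; linarith
    have hε2 : ε ≤ 1 := by linarith
    have h3 : ‖x‖ ≤ 2 * R := by nlinarith
    have h4 := quad_sub_le e h0 hαN (by linarith) x (R • v i)
    have h5 : ‖x - R • v i‖ * ‖x + R • v i‖ ≤ ε * R * (3 * R) := by
      gcongr
      have := norm_add_le x (R • v i)
      rw [hRv] at this; linarith
    have h6 : ∑ k, α k * ⟪e k, R • v i⟫ ^ 2 = R ^ 2 * ∑ k, α k * ⟪e k, v i⟫ ^ 2 := by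
      rw [Finset.mul_sum]
      refine Finset.sum_congr rfl fun k _ => ?_
      rw [real_inner_smul_right]; ring
    rw [h6] at h4
    have h7 := hFO x hx
    have h8 := (abs_le.1 (abs_inner_le (b := b) h3)).2
    have h9 : (R - ε * R) ^ 2 ≤ ‖x‖ ^ 2 := by
      refine pow_le_pow_left₀ ?_ h2 2
      nlinarith
    have h10 : R * (4 * ‖b‖) ≤ R * (N * ε * R) := by gcongr
    have h11 : N * (‖x - R • v i‖ * ‖x + R • v i‖) ≤ N * (ε * R * (3 * R)) := by gcongr
    have h12 := (abs_le.1 h4).2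
    refine le_of_mul_le_mul_left ?_ (by positivity : 0 < R ^ 2)
    have h13 : ε * R ^ 2 ≤ N * ε * R ^ 2 := by gcongr
    nlinarith [sq_nonneg (ε * R)]
  refine ⟨R, hR0, fun k => ∑ i, ⟪v i, e k⟫ ^ 2, fun k => Finset.sum_nonneg fun i _ => sq_nonneg _,
    ?_⟩
  set θ : Fin d → ℝ := fun k => ∑ i, ⟪v i, e k⟫ ^ 2 with hθ
  have hθ1 : ∀ k, θ k ≤ 1 := fun k => by
    have := hv.sum_inner_products_le (e k) (s := Finset.univ)
    rw [e.orthonormal.1 k] at this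
    simpa [hθ] using this
  have hαθ : N - 6 * (N ^ 2 * ε) ≤ ∑ k, α k * θ k := by
    have h1 : ∑ k, α k * θ k = ∑ i, ∑ k, α k * ⟪e k, v i⟫ ^ 2 := by
      rw [Finset.sum_comm]
      refine Finset.sum_congr rfl fun k _ => ?_
      rw [hθ, Finset.mul_sum]
      exact Finset.sum_congr rfl fun i _ => by rw [real_inner_comm]
    rw [h1]
    have h2 := Finset.sum_le_sum fun i (_ : i ∈ Finset.univ) => hq i
    rw [Finset.sum_const, Finset.card_univ, Fintype.card_fin, nsmul_eq_mul] at h2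
    refine le_trans (le_of_eq ?_) h2
    rw [← hN]; ring
  refine ⟨hθ1, ?_, by linarith, fun k hk σ hσ => ?_⟩
  · rw [hθ, Finset.sum_comm]
    have : ∀ i, ∑ k, ⟪v i, e k⟫ ^ 2 = 1 := fun i => by
      have h := sum_sq_coord e (v i)
      rw [hv.1 i, one_pow] at h
      exact Eq.trans (Finset.sum_congr rfl fun k _ => by rw [real_inner_comm]) h
    rw [Finset.sum_congr rfl fun i _ => this i]
    simp [hN]
  · have h1 : 1 - θ k ≤ 12 * (N ^ 2 * ε) := by
      have h2 : α k * (1 - θ k) ≤ ∑ l, α l * (1 - θ l) :=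
        Finset.single_le_sum (f := fun l => α l * (1 - θ l))
          (fun l _ => mul_nonneg (h0 l) (by linarith [hθ1 l])) (Finset.mem_univ k)
      have h3 : ∑ l, α l * (1 - θ l) = N - ∑ l, α l * θ l := by
        rw [← hsum, ← Finset.sum_sub_distrib]
        exact Finset.sum_congr rfl fun l _ => by ring
      nlinarith [hθ1 k]
    set p : Euc d := ∑ i, ⟪v i, e k⟫ • v i with hp
    have hpe : ⟪e k, p⟫ = θ k := by
      rw [hp, inner_sum]
      refine Finset.sum_congr rfl fun i _ => ?_
      rw [real_inner_smul_right, real_inner_comm]; ring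
    have hpp : ‖p‖ ^ 2 = θ k := by
      rw [← real_inner_self_eq_norm_sq, hp, hv.inner_sum]
      refine Finset.sum_congr rfl fun i _ => ?_
      simp [sq]
    have hep : ‖e k - p‖ ≤ 1 / (10 * D) := by
      refine le_of_sq_le_sq ?_ (by positivity)
      rw [norm_sub_sq_real, hpe, hpp, e.orthonormal.1 k]
      have : (1 / (10 * D)) ^ 2 = 100 * (1 / (10 ^ 4 * D ^ 2)) := by field_simp; norm_num
      rw [this]
      have : 0 < 1 / (10 ^ 4 * D ^ 2) := by positivity
      linarith
    have hpm : p ∈ Submodule.span ℝ (Set.range v) :=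
      Submodule.sum_mem _ fun i _ => Submodule.smul_mem _ _ (Submodule.subset_span ⟨i, rfl⟩)
    have hp1 : ‖p‖ ≤ 1 := by
      refine le_of_sq_le_sq ?_ one_pos.le
      rw [hpp]; simpa using hθ1 k
    obtain ⟨x, hx, hxp⟩ := hvS (σ • p) (Submodule.smul_mem _ _ hpm)
      (by rw [norm_smul, Real.norm_eq_abs, hσ, one_mul]; exact hp1)
    refine ⟨x, hx, ?_⟩
    have h2 : x - (σ * R) • e k = (x - R • σ • p) - (σ * R) • (e k - p) := by
      rw [smul_sub, smul_smul R σ p, mul_comm R σ]; abel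
    rw [h2]
    refine (norm_sub_le _ _).trans ?_
    rw [norm_smul, norm_mul, Real.norm_eq_abs σ, hσ, one_mul, Real.norm_of_nonneg hRp.le]
    calc _ ≤ 1 / (40 * D) * R + R * (1 / (10 * D)) := by
          refine add_le_add (hxp.trans ?_) ?_ <;> gcongr
      _ = _ := by field_simp; norm_num

/-- Points of `S` far out near a coordinate axis. -/
def AxisPoint (S : Set (Euc d)) (e : OrthonormalBasis (Fin d) ℝ (Euc d)) (k : Fin d) (σ R : ℝ)
    (x : Euc d) : Prop :=
  x ∈ S ∧ ‖x‖ ≤ 2 * R ∧ |⟪e k, x⟫ - σ * R| ≤ R / (8 * d) ∧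
    ∑ l ∈ Finset.univ.erase k, ⟪e l, x⟫ ^ 2 ≤ (R / (8 * d)) ^ 2

lemma axisPoint_of_norm (hd : 0 < d) {k : Fin d} {σ R : ℝ} (hσ : |σ| = 1) (hR : 0 ≤ R)
    {x : Euc d} (hx : x ∈ S) (h : ‖x - (σ * R) • e k‖ ≤ R / (8 * d)) : AxisPoint S e k σ R x := by
  have hd1 : (1 : ℝ) ≤ d := by exact_mod_cast hd
  have h1 : R / (8 * d) ≤ R := div_le_self hR (by linarith)
  have h2 : ‖(σ * R) • e k‖ = R := by
    rw [norm_smul, norm_mul, Real.norm_eq_abs σ, hσ, e.orthonormal.1 k, Real.norm_of_nonneg hR]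
    ring
  have hc : ∀ l, ⟪e l, x - (σ * R) • e k⟫ = ⟪e l, x⟫ - if l = k then σ * R else 0 := fun l => by
    rw [inner_sub_right, real_inner_smul_right, orthonormal_iff_ite.1 e.orthonormal l k]
    split_ifs <;> ring
  have hs := sum_sq_coord e (x - (σ * R) • e k)
  have h3 : ‖x - (σ * R) • e k‖ ^ 2 ≤ (R / (8 * d)) ^ 2 := by gcongr
  rw [← hs, ← Finset.add_sum_erase _ _ (Finset.mem_univ k), hc, if_pos rfl] at h3
  have h4 : ∑ l ∈ Finset.univ.erase k, ⟪e l, x - (σ * R) • e k⟫ ^ 2 =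
      ∑ l ∈ Finset.univ.erase k, ⟪e l, x⟫ ^ 2 := Finset.sum_congr rfl fun l hl => by
    rw [hc, if_neg (Finset.ne_of_mem_erase hl), sub_zero]
  rw [h4] at h3
  have h5 : 0 ≤ ∑ l ∈ Finset.univ.erase k, ⟪e l, x⟫ ^ 2 := Finset.sum_nonneg fun l _ => sq_nonneg _
  refine ⟨hx, ?_, ?_, by nlinarith [sq_nonneg (⟪e k, x⟫ - σ * R)]⟩
  · have := norm_add_le (x - (σ * R) • e k) ((σ * R) • e k)
    rw [sub_add_cancel, h2] at this; linarith
  · exact abs_le_of_sq_le_sq (by linarith) (by positivity)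

/-- The first order relation forces the spectrum of the second moments into `{0, 1}`. -/
lemma gap (hn : 0 < n) (hnd : n ≤ d) (h0 : ∀ k, 0 ≤ α k) (hsum : ∑ k, α k = n)
    (hFO : ∀ x ∈ S, ‖x‖ ^ 2 = 2 * ⟪x, b⟫ + ∑ k, α k * ⟪e k, x⟫ ^ 2)
    (hF : NearPlanes n S (1 / (10 ^ 4 * (d : ℝ) ^ 4))) :
    ∃ E : Finset (Fin d), E.card = n ∧ (∀ k ∈ E, ⟪e k, b⟫ = 0) ∧
      ∀ x ∈ S, ∑ k ∈ Eᶜ, ⟪e k, x⟫ ^ 2 = 2 * ⟪x, b⟫ := by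
  classical
  have hd : 0 < d := hn.trans_le hnd
  have hN1 : (1 : ℝ) ≤ n := by exact_mod_cast hn
  have hND : (n : ℝ) ≤ d := by exact_mod_cast hnd
  have hframe := gap_frame hn hnd h0 hsum hFO hF
  set N : ℝ := (n : ℝ) with hN
  set D : ℝ := (d : ℝ) with hD
  have hD1 : 1 ≤ D := hN1.trans hND
  have hD0 : 0 < D := by linarith
  have hαN : ∀ k, α k ≤ N := fun k => by
    rw [← hsum]; exact Finset.single_le_sum (fun i _ => h0 i) (Finset.mem_univ k)
  set E : Finset (Fin d) := Finset.univ.filter fun k => 1 / 2 ≤ α k with hE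
  have hmemE : ∀ k, k ∈ E ↔ 1 / 2 ≤ α k := fun k => by simp [hE]
  have hcardD : (E.card : ℝ) ≤ D := by
    have := Finset.card_le_univ E
    rw [Fintype.card_fin] at this
    rw [hD]; exact_mod_cast this
  have hax : ∀ k ∈ E, ∀ σ : ℝ, |σ| = 1 → ∀ R0 : ℝ, ∃ R, R0 ≤ R ∧ 1 ≤ R ∧ ∃ x, AxisPoint S e k σ R x := by
    intro k hk σ hσ R0
    obtain ⟨R, hR, θ, -, -, -, -, h⟩ := hframe (max R0 1)
    have hR1 : 1 ≤ R := (le_max_right _ _).trans hR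
    obtain ⟨x, hx, hxR⟩ := h k ((hmemE k).1 hk) σ hσ
    exact ⟨R, (le_max_left _ _).trans hR, hR1, x, axisPoint_of_norm hd hσ (by linarith) hx hxR⟩
  have hid : ∀ x ∈ S, ∑ k, (1 - α k) * ⟪e k, x⟫ ^ 2 = 2 * ⟪x, b⟫ := fun x hx => by
    have h1 : ∑ k, (1 - α k) * ⟪e k, x⟫ ^ 2 =
        ∑ k, ⟪e k, x⟫ ^ 2 - ∑ k, α k * ⟪e k, x⟫ ^ 2 := by
      rw [← Finset.sum_sub_distrib]
      exact Finset.sum_congr rfl fun k _ => by ring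
    rw [h1, sum_sq_coord, hFO x hx]; ring
  have hck : ∀ {k : Fin d} {R : ℝ} {x : Euc d}, 1 ≤ R → AxisPoint S e k 1 R x →
      3 / 4 * R ^ 2 ≤ ⟪e k, x⟫ ^ 2 := by
    intro k R x hR hx
    have h1 := (abs_le.1 hx.2.2.1).1
    have h2 : R / (8 * D) ≤ R / 8 := by gcongr; linarith
    nlinarith
  have hsmall : ∀ R : ℝ, D * (R / (8 * D)) ^ 2 ≤ R ^ 2 / 64 := fun R => by
    have : D * (R / (8 * D)) ^ 2 = R ^ 2 / (64 * D) := by field_simp; norm_num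
    rw [this]; gcongr; linarith
  have hnear : ∀ k ∈ E, |1 - α k| ≤ 1 / (4 * D) := by
    intro k hk
    obtain ⟨R, hR, hR1, x, hx⟩ := hax k hk 1 (by simp) (64 * D * ‖b‖)
    have h1 := hid x hx.1
    rw [← Finset.add_sum_erase _ _ (Finset.mem_univ k)] at h1
    have h2 : |∑ l ∈ Finset.univ.erase k, (1 - α l) * ⟪e l, x⟫ ^ 2| ≤ D * (R / (8 * D)) ^ 2 := by
      refine (Finset.abs_sum_le_sum_abs _ _).trans ?_
      calc _ ≤ ∑ l ∈ Finset.univ.erase k, D * ⟪e l, x⟫ ^ 2 := by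
            refine Finset.sum_le_sum fun l _ => ?_
            rw [abs_mul, abs_of_nonneg (sq_nonneg (⟪e l, x⟫ : ℝ))]
            gcongr
            rw [abs_le]; constructor <;> linarith [h0 l, hαN l]
        _ ≤ _ := by rw [← Finset.mul_sum]; gcongr; exact hx.2.2.2
    have h3 := abs_inner_le (b := b) hx.2.1
    have h4 := hck hR1 hx
    have h5 : D * (R / (8 * D)) ^ 2 = R ^ 2 / (64 * D) := by field_simp; norm_num
    rw [h5] at h2
    have h6 : 4 * (R * ‖b‖) ≤ R ^ 2 / (16 * D) := by
      rw [le_div_iff₀ (by positivity)]; nlinarith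
    have h7 : |1 - α k| * (3 / 4 * R ^ 2) ≤ R ^ 2 / (16 * D) + R ^ 2 / (64 * D) := by
      calc |1 - α k| * (3 / 4 * R ^ 2) ≤ |1 - α k| * ⟪e k, x⟫ ^ 2 := by gcongr
        _ = |(1 - α k) * ⟪e k, x⟫ ^ 2| := by rw [abs_mul, abs_of_nonneg (sq_nonneg (⟪e k, x⟫ : ℝ))]
        _ ≤ _ := by
          rw [abs_le] at h2 h3 ⊢
          constructor <;> linarith [h2.1, h2.2, h3.1, h3.2]
    have h8 : R ^ 2 / (16 * D) + R ^ 2 / (64 * D) = 1 / (4 * D) * (5 / 16 * R ^ 2) := by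
      field_simp; norm_num
    have h9 : |1 - α k| * (3 / 4 * R ^ 2) ≤ 1 / (4 * D) * (3 / 4 * R ^ 2) := by
      rw [h8] at h7
      refine h7.trans ?_
      exact mul_le_mul_of_nonneg_left (by nlinarith [sq_nonneg R]) (by positivity)
    exact le_of_mul_le_mul_right h9 (by positivity)
  have hcard : n ≤ E.card := by
    obtain ⟨R, -, θ, hθ0, hθ1, hθs, hθα, -⟩ := hframe 0
    have h1 : ∑ k, (1 - α k) * θ k ≤ 1 / 64 := by
      have : ∑ k, (1 - α k) * θ k = N - ∑ k, α k * θ k := by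
        rw [← hθs, ← Finset.sum_sub_distrib]
        exact Finset.sum_congr rfl fun k _ => by ring
      linarith
    rw [← Finset.sum_add_sum_compl E] at h1 hθs
    have h2 : -(1 / 4) ≤ ∑ k ∈ E, (1 - α k) * θ k := by
      have h3 : ∑ k ∈ E, -(1 / (4 * D)) ≤ ∑ k ∈ E, (1 - α k) * θ k := by
        refine Finset.sum_le_sum fun k hk => ?_
        have h4 := abs_le.1 (hnear k hk)
        have h5 : 0 < 1 / (4 * D) := by positivity
        nlinarith [hθ0 k, hθ1 k, h4.1]
      rw [Finset.sum_const, nsmul_eq_mul] at h3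
      refine le_trans ?_ h3
      have : D * (1 / (4 * D)) = 1 / 4 := by field_simp
      nlinarith [(by positivity : 0 < 1 / (4 * D))]
    have h3 : ∑ k ∈ Eᶜ, 1 / 2 * θ k ≤ ∑ k ∈ Eᶜ, (1 - α k) * θ k := by
      refine Finset.sum_le_sum fun k hk => ?_
      have : ¬ (1 / 2 ≤ α k) := by rw [← hmemE]; exact Finset.mem_compl.1 hk
      push Not at this
      have := hθ0 k
      gcongr; linarith
    rw [← Finset.mul_sum] at h3
    have h4 : ∑ k ∈ E, θ k ≤ E.card := by
      have := Finset.sum_le_sum fun k (_ : k ∈ E) => hθ1 k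
      simpa using this
    have h5 : N < E.card + 1 := by linarith
    rw [hN] at h5
    have : n < E.card + 1 := by exact_mod_cast h5
    omega
  have hcardR : N ≤ E.card := by rw [hN]; exact_mod_cast hcard
  have hEα : ∑ k ∈ E, α k ≤ N := by
    rw [← hsum]
    exact Finset.sum_le_sum_of_subset_of_nonneg (Finset.subset_univ _) fun k _ _ => h0 k
  have hEne : E.Nonempty := Finset.card_pos.1 (hn.trans_le hcard)
  have hsumE : ∑ k ∈ E, (1 - α k) = E.card - ∑ k ∈ E, α k := by
    rw [Finset.sum_sub_distrib]; simp
  have hnonpos : ∀ k ∈ E, 1 - α k ≤ 0 := by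
    obtain ⟨k0, hk0, hmax⟩ := E.exists_max_image (fun k => 1 - α k) hEne
    have hA : 1 - α k0 ≤ 0 := by
      by_contra hc
      push Not at hc
      set A := 1 - α k0 with hAdef
      have hlow : ∀ l, -(D * A) ≤ 1 - α l := by
        intro l
        by_cases hl : l ∈ E
        · have h1 := Finset.add_sum_erase E (fun k => 1 - α k) hl
          have h2 : ∑ k ∈ E.erase l, (1 - α k) ≤ D * A := by
            have h3 := Finset.sum_le_sum fun k (hk : k ∈ E.erase l) =>
              hmax k (Finset.mem_of_mem_erase hk)
            rw [Finset.sum_const, nsmul_eq_mul] at h3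
            refine h3.trans ?_
            have h4 : ((E.erase l).card : ℝ) ≤ E.card := by exact_mod_cast Finset.card_erase_le
            gcongr
            linarith
          linarith
        · rw [hmemE] at hl
          push Not at hl
          have : 0 < D * A := by positivity
          linarith
      obtain ⟨R, hR, hR1, x, hx⟩ := hax k0 hk0 1 (by simp) (8 * ‖b‖ / A + 1)
      have h1 := hid x hx.1
      rw [← Finset.add_sum_erase _ _ (Finset.mem_univ k0)] at h1
      have h2 : -(A * (R ^ 2 / 64)) ≤
          ∑ l ∈ Finset.univ.erase k0, (1 - α l) * ⟪e l, x⟫ ^ 2 := by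
        calc -(A * (R ^ 2 / 64)) ≤ -(A * (D * (R / (8 * D)) ^ 2)) := by
              have := hsmall R
              gcongr
          _ ≤ -(A * (D * ∑ l ∈ Finset.univ.erase k0, ⟪e l, x⟫ ^ 2)) := by
              have := hx.2.2.2
              gcongr
          _ = ∑ l ∈ Finset.univ.erase k0, -(D * A) * ⟪e l, x⟫ ^ 2 := by
              rw [← Finset.mul_sum]; ring
          _ ≤ _ := by
              refine Finset.sum_le_sum fun l _ => ?_
              have := hlow l
              gcongr
      have h3 := (abs_le.1 (abs_inner_le (b := b) hx.2.1)).2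
      have h4 := mul_le_mul_of_nonneg_left (hck hR1 hx) hc.le
      have h5 : 8 * ‖b‖ + A ≤ A * R := by
        have := mul_le_mul_of_nonneg_left hR hc.le
        rwa [mul_add, mul_div_cancel₀ _ hc.ne', mul_one] at this
      nlinarith [mul_pos hc (by linarith : 0 < R)]
    exact fun k hk => (hmax k hk).trans hA
  have hzero : ∀ k ∈ E, 1 - α k = 0 := by
    have h1 : ∑ k ∈ E, (1 - α k) = 0 :=
      le_antisymm (Finset.sum_nonpos hnonpos) (by rw [hsumE]; linarith)
    exact (Finset.sum_eq_zero_iff_of_nonpos hnonpos).1 h1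
  have hsumEα : ∑ k ∈ E, α k = E.card := by
    have h1 : ∑ k ∈ E, α k = ∑ k ∈ E, 1 := Finset.sum_congr rfl fun k hk => by
      linarith [hzero k hk]
    rw [h1]; simp
  have hcard2 : E.card = n := by
    have : (E.card : ℝ) ≤ N := by rw [← hsumEα]; exact hEα
    refine le_antisymm ?_ hcard
    rw [hN] at this
    exact_mod_cast this
  have hF0 : ∀ k ∈ Eᶜ, α k = 0 := by
    have h1 := Finset.sum_add_sum_compl E α
    rw [hsum, hsumEα, hcard2] at h1
    exact (Finset.sum_eq_zero_iff_of_nonneg fun k _ => h0 k).1 (by linarith)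
  have htube : ∀ x ∈ S, ∑ k ∈ Eᶜ, ⟪e k, x⟫ ^ 2 = 2 * ⟪x, b⟫ := by
    intro x hx
    have h := hid x hx
    rw [← Finset.sum_add_sum_compl E,
      Finset.sum_eq_zero fun k hk => by rw [hzero k hk, zero_mul], zero_add] at h
    rw [← h]
    exact Finset.sum_congr rfl fun k hk => by rw [hF0 k hk]; ring
  refine ⟨E, hcard2, ?_, htube⟩
  obtain ⟨k0, hk0, hmax⟩ := E.exists_max_image (fun k => |⟪e k, b⟫|) hEne
  suffices hβ : |⟪e k0, b⟫| = 0 from fun k hk =>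
    abs_eq_zero.1 (le_antisymm ((hmax k hk).trans_eq hβ) (abs_nonneg _))
  by_contra hc
  set β := |⟪e k0, b⟫| with hβ
  have hβ0 : 0 < β := lt_of_le_of_ne (abs_nonneg _) (Ne.symm hc)
  obtain ⟨σ, hσ, hσb⟩ : ∃ σ : ℝ, |σ| = 1 ∧ σ * ⟪e k0, b⟫ = -β := by
    rcases le_total 0 (⟪e k0, b⟫ : ℝ) with h | h
    · exact ⟨-1, by simp, by rw [hβ, abs_of_nonneg h]; ring⟩
    · exact ⟨1, by simp, by rw [hβ, abs_of_nonpos h]; ring⟩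
  obtain ⟨R, hR, hR1, x, hx⟩ := hax k0 hk0 σ hσ (‖b‖ ^ 2 / β + 1)
  have hRβ : ‖b‖ ^ 2 + β ≤ β * R := by
    have := mul_le_mul_of_nonneg_left hR hβ0.le
    rwa [mul_add, mul_div_cancel₀ _ hβ0.ne', mul_one] at this
  have h1 := htube x hx.1
  have h2 : (⟪x, b⟫ : ℝ) = ∑ k ∈ E, ⟪e k, x⟫ * ⟪e k, b⟫ + ∑ k ∈ Eᶜ, ⟪e k, x⟫ * ⟪e k, b⟫ := by
    rw [Finset.sum_add_sum_compl, ← e.sum_inner_mul_inner]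
    exact Finset.sum_congr rfl fun i _ => by rw [real_inner_comm]
  have h3 : -‖b‖ ^ 2 ≤ ∑ k ∈ Eᶜ, ⟪e k, x⟫ ^ 2 - 2 * ∑ k ∈ Eᶜ, ⟪e k, x⟫ * ⟪e k, b⟫ := by
    have h4 : ∑ k ∈ Eᶜ, ⟪e k, b⟫ ^ 2 ≤ ‖b‖ ^ 2 := by
      rw [← sum_sq_coord e b]
      exact Finset.sum_le_sum_of_subset_of_nonneg (Finset.subset_univ _) fun k _ _ => sq_nonneg _
    have h5 : 0 ≤ ∑ k ∈ Eᶜ, (⟪e k, x⟫ - ⟪e k, b⟫) ^ 2 := Finset.sum_nonneg fun k _ => sq_nonneg _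
    have h6 : ∑ k ∈ Eᶜ, (⟪e k, x⟫ - ⟪e k, b⟫) ^ 2 = ∑ k ∈ Eᶜ, ⟪e k, x⟫ ^ 2 -
        2 * ∑ k ∈ Eᶜ, ⟪e k, x⟫ * ⟪e k, b⟫ + ∑ k ∈ Eᶜ, ⟪e k, b⟫ ^ 2 := by
      rw [Finset.mul_sum, ← Finset.sum_sub_distrib, ← Finset.sum_add_distrib]
      exact Finset.sum_congr rfl fun k _ => by ring
    linarith
  have h4 : ∑ k ∈ E, ⟪e k, x⟫ * ⟪e k, b⟫ ≤ -(3 / 4) * (β * R) := by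
    rw [← Finset.add_sum_erase _ _ hk0]
    have h5 : ⟪e k0, x⟫ * ⟪e k0, b⟫ ≤ -(7 / 8) * (β * R) := by
      have h6 : |(⟪e k0, x⟫ - σ * R) * ⟪e k0, b⟫| ≤ R / 8 * β := by
        rw [abs_mul, ← hβ]
        gcongr
        refine hx.2.2.1.trans ?_
        gcongr; linarith
      have h7 := (abs_le.1 h6).2
      have h8 : σ * R * ⟪e k0, b⟫ = -β * R := by rw [← hσb]; ring
      nlinarith
    have h6 : ∑ k ∈ E.erase k0, ⟪e k, x⟫ * ⟪e k, b⟫ ≤ 1 / 8 * (β * R) := by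
      have h7 : ∀ k ∈ E.erase k0, ⟪e k, x⟫ * ⟪e k, b⟫ ≤ R / (8 * D) * β := fun k hk => by
        have h8 : |⟪e k, x⟫| ≤ R / (8 * D) := by
          refine abs_le_of_sq_le_sq ?_ (by positivity)
          refine le_trans ?_ hx.2.2.2
          exact Finset.single_le_sum (f := fun l => ⟪e l, x⟫ ^ 2) (fun l _ => sq_nonneg _)
            (Finset.mem_erase.2 ⟨Finset.ne_of_mem_erase hk, Finset.mem_univ _⟩)
        refine (le_abs_self _).trans ?_
        rw [abs_mul]
        gcongr
        exact hmax k (Finset.mem_of_mem_erase hk)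
      refine (Finset.sum_le_sum h7).trans ?_
      rw [Finset.sum_const, nsmul_eq_mul]
      have h9 : ((E.erase k0).card : ℝ) ≤ D :=
        le_trans (by exact_mod_cast Finset.card_erase_le) hcardD
      calc _ ≤ D * (R / (8 * D) * β) := by gcongr
        _ = _ := by field_simp
    linarith
  nlinarith

end Gap

/-- A sequence of positive scales tending to zero along the ultrafilter. -/
structure Scale (s : ℕ → ℝ) : Prop where
  pos : ∀ j, 0 < s j
  lim : Tendsto s UF (𝓝 0)

lemma Scale.within {s : ℕ → ℝ} (hs : Scale s) : Tendsto s UF (𝓝[>] 0) :=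
  tendsto_nhdsWithin_iff.2 ⟨hs.lim, Eventually.of_forall hs.pos⟩

lemma Scale.mul {s : ℕ → ℝ} (hs : Scale s) {c : ℝ} (hc : 0 < c) : Scale fun j => s j * c :=
  ⟨fun j => mul_pos (hs.pos j) hc, by simpa using hs.lim.mul_const c⟩

lemma Scale.sqrt {s : ℕ → ℝ} (hs : Scale s) : Tendsto (fun j => √(s j)) UF (𝓝 0) := by
  simpa using hs.lim.sqrt

lemma Scale.sqrt_pow {s : ℕ → ℝ} (hs : Scale s) {m : ℕ} (hm : m ≠ 0) :
    Tendsto (fun j => √(s j) ^ m) UF (𝓝 0) := by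
  simpa [hm] using hs.sqrt.pow m

lemma scale_one_div : Scale fun j : ℕ => 1 / ((j : ℝ) + 1) :=
  ⟨fun j => by positivity, uf_one_div⟩

section Bounds

variable {ν : Measure (Euc d)}

lemma NUnif.gM_bound_on (h : NUnif n ν) (hn : 0 < n) {s : ℝ}
    (hs : 0 < s) {f : Euc d → ℝ} (hf : Continuous f) {C : ℝ} (hC : 0 ≤ C) {k : ℕ}
    (hb : ∀ y ∈ msupport ν, |f y| ≤ C * ‖y‖ ^ k) :
    Integrable f (gM ν s) ∧ √s ^ k * |∫ y, f y ∂(gM ν s)| ≤ C * gC n k := by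
  have h1 := h.gM_norm_pow_integrable hn hs k
  have hae : ∀ᵐ y ∂(gM ν s), ‖f y‖ ≤ C * ‖y‖ ^ k := by
    filter_upwards [gM_ae_mem ν s] with y hy using hb y hy
  refine ⟨(h1.const_mul C).mono' hf.aestronglyMeasurable hae, ?_⟩
  have h2 : ‖∫ y, f y ∂(gM ν s)‖ ≤ ∫ y, C * ‖y‖ ^ k ∂(gM ν s) :=
    norm_integral_le_of_norm_le (h1.const_mul C) hae
  have h3 := (h.gM_moment hn hs k).2
  simp_rw [mul_pow] at h3
  rw [integral_const_mul] at h3 h2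
  calc √s ^ k * |∫ y, f y ∂(gM ν s)| ≤ √s ^ k * (C * ∫ y, ‖y‖ ^ k ∂(gM ν s)) := by
        gcongr; exact h2
    _ = C * (√s ^ k * ∫ y, ‖y‖ ^ k ∂(gM ν s)) := by ring
    _ ≤ _ := by gcongr

lemma NUnif.tendsto_pow_mul_zero (h : NUnif n ν) (hn : 0 < n) {s : ℕ → ℝ} (hs : Scale s)
    {f : Euc d → ℝ} (hf : Continuous f) {C : ℝ} (hC : 0 ≤ C) {k p : ℕ} (hk : k < 2 * p)
    (hb : ∀ y ∈ msupport ν, |f y| ≤ C * ‖y‖ ^ k) :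
    Tendsto (fun j => s j ^ p * ∫ y, f y ∂(gM ν (s j))) UF (𝓝 0) := by
  have h1 := (hs.sqrt_pow (m := 2 * p - k) (by omega)).const_mul (C * gC n k)
  rw [mul_zero] at h1
  refine squeeze_zero_norm (fun j => ?_) h1
  have h2 := (h.gM_bound_on hn (hs.pos j) hf hC hb).2
  have h3 : s j ^ p = √(s j) ^ (2 * p - k) * √(s j) ^ k := by
    rw [← pow_add, Nat.sub_add_cancel hk.le, pow_mul, Real.sq_sqrt (hs.pos j).le]
  rw [norm_mul, Real.norm_of_nonneg (pow_nonneg (hs.pos j).le _), Real.norm_eq_abs, h3, mul_assoc,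
    mul_comm]
  gcongr

lemma NUnif.exists_pow_mul_limit (h : NUnif n ν) (hn : 0 < n) {s : ℕ → ℝ} (hs : Scale s)
    {f : Euc d → ℝ} (hf : Continuous f) {C : ℝ} (hC : 0 ≤ C) {p : ℕ}
    (hb : ∀ y ∈ msupport ν, |f y| ≤ C * ‖y‖ ^ (2 * p)) :
    ∃ l, |l| ≤ C * gC n (2 * p) ∧
      Tendsto (fun j => s j ^ p * ∫ y, f y ∂(gM ν (s j))) UF (𝓝 l) := by
  refine uf_bdd (C := C * gC n (2 * p)) (Eventually.of_forall fun j => ?_)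
  have h2 := (h.gM_bound_on hn (hs.pos j) hf hC hb).2
  rw [pow_mul, Real.sq_sqrt (hs.pos j).le] at h2
  rwa [norm_mul, Real.norm_of_nonneg (pow_nonneg (hs.pos j).le _), Real.norm_eq_abs]

/-- Normalised moments depend continuously on the direction, uniformly in the scale. -/
lemma NUnif.tendsto_moment_sub (h : NUnif n ν) (hn : 0 < n) {s : ℕ → ℝ} (hs : Scale s) (p : ℕ)
    {w : ℕ → Euc d} {u : Euc d} (hw : Tendsto w UF (𝓝 u)) :
    Tendsto (fun j => √(s j) ^ p * ∫ y, ⟪w j, y⟫ ^ p ∂(gM ν (s j)) -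
      √(s j) ^ p * ∫ y, ⟪u, y⟫ ^ p ∂(gM ν (s j))) UF (𝓝 0) := by
  have h1 : Tendsto (fun j => ‖w j - u‖ * p * (max ‖w j‖ ‖u‖) ^ (p - 1) * gC n p) UF
      (𝓝 (‖u - u‖ * p * (max ‖u‖ ‖u‖) ^ (p - 1) * gC n p)) :=
    ((((hw.sub_const u).norm.mul_const _).mul ((hw.norm.max tendsto_const_nhds).pow _)).mul_const _)
  rw [sub_self, norm_zero, zero_mul, zero_mul, zero_mul] at h1
  refine squeeze_zero_norm (fun j => ?_) h1
  have hI : ∀ x : Euc d, Integrable (fun y => ⟪x, y⟫ ^ p) (gM ν (s j)) := fun x =>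
    h.gM_integrable hn (hs.pos j) (by fun_prop) (C := ‖x‖ ^ p) (k := p) fun y => by
      rw [norm_pow, ← mul_pow]; gcongr; exact norm_inner_le_norm _ _
  rw [← mul_sub, ← integral_sub (hI _) (hI _), norm_mul, norm_pow,
    Real.norm_of_nonneg (Real.sqrt_nonneg _)]
  refine h.gM_bound hn (hs.pos j) (f := fun y => ⟪w j, y⟫ ^ p - ⟪u, y⟫ ^ p) (by positivity)
    fun y => ?_
  rcases Nat.eq_zero_or_pos p with rfl | hp
  · simp
  rw [Real.norm_eq_abs]
  refine (abs_pow_sub_pow_le _ _ _).trans ?_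
  have h2 : |⟪w j, y⟫ - ⟪u, y⟫| ≤ ‖w j - u‖ * ‖y‖ := by
    rw [← inner_sub_left]; exact abs_real_inner_le_norm _ _
  have h3 : max |⟪w j, y⟫| |⟪u, y⟫| ≤ max ‖w j‖ ‖u‖ * ‖y‖ := by
    refine max_le ((abs_real_inner_le_norm _ _).trans ?_) ((abs_real_inner_le_norm _ _).trans ?_)
    · gcongr; exact le_max_left _ _
    · gcongr; exact le_max_right _ _
  calc _ ≤ ‖w j - u‖ * ‖y‖ * p * (max ‖w j‖ ‖u‖ * ‖y‖) ^ (p - 1) := by gcongr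
    _ = ‖w j - u‖ * p * max ‖w j‖ ‖u‖ ^ (p - 1) * (‖y‖ ^ (p - 1) * ‖y‖) := by rw [mul_pow]; ring
    _ = _ := by rw [← pow_succ, Nat.sub_add_cancel hp]

end Bounds

/-- The coordinate subspace spanned by the vectors `e k`, `k ∈ E`. -/
def coordPlane (e : OrthonormalBasis (Fin d) ℝ (Euc d)) (E : Finset (Fin d)) :
    Submodule ℝ (Euc d) where
  carrier := {x | ∀ k, k ∉ E → ⟪e k, x⟫ = 0}
  add_mem' := fun hx hy k hk => by rw [inner_add_right, hx k hk, hy k hk, add_zero]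
  zero_mem' := fun k _ => inner_zero_right _
  smul_mem' := fun c x hx k hk => by rw [real_inner_smul_right, hx k hk, mul_zero]

section CoordPlane

variable (e : OrthonormalBasis (Fin d) ℝ (Euc d)) (E : Finset (Fin d))

/-- The orthogonal projection onto `coordPlane e E`. -/
def coordProj (x : Euc d) : Euc d := ∑ k ∈ E, ⟪e k, x⟫ • e k

lemma inner_coordProj (l : Fin d) (x : Euc d) :
    ⟪e l, coordProj e E x⟫ = if l ∈ E then ⟪e l, x⟫ else 0 := by
  rw [coordProj, inner_sum]
  simp only [real_inner_smul_right, orthonormal_iff_ite.1 e.orthonormal, mul_ite, mul_one,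
    mul_zero]
  rw [Finset.sum_ite_eq]

lemma coordProj_mem (x : Euc d) : coordProj e E x ∈ coordPlane e E := fun k hk => by
  rw [inner_coordProj, if_neg hk]

lemma norm_coordProj (x : Euc d) : ‖coordProj e E x‖ ^ 2 = ∑ k ∈ E, ⟪e k, x⟫ ^ 2 := by
  rw [← sum_sq_coord e]
  simp only [inner_coordProj, ite_pow, ne_eq, OfNat.ofNat_ne_zero, not_false_eq_true, zero_pow]
  rw [← Finset.sum_filter]; simp

lemma coordProj_eq_self {x : Euc d} (hx : x ∈ coordPlane e E) : coordProj e E x = x := by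
  refine InnerProductSpace.ext_inner_left_basis e.toBasis fun l => ?_
  rw [OrthonormalBasis.coe_toBasis, inner_coordProj]
  split_ifs with hl
  · rfl
  · exact (hx l hl).symm

lemma coordPlane_eq_span : coordPlane e E = Submodule.span ℝ (Set.range fun k : E => e k) := by
  refine le_antisymm (fun x hx => ?_) (Submodule.span_le.2 ?_)
  · rw [← coordProj_eq_self e E hx, coordProj]
    exact Submodule.sum_mem _ fun k hk => Submodule.smul_mem _ _ (Submodule.subset_span ⟨⟨k, hk⟩, rfl⟩)
  · rintro _ ⟨k, rfl⟩ l hl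
    exact e.orthonormal.2 (fun h => hl (h ▸ k.2))

lemma finrank_coordPlane : finrank ℝ (coordPlane e E) = E.card := by
  have h := finrank_span_eq_card
    (e.orthonormal.linearIndependent.comp (fun k : E => (k : Fin d)) Subtype.val_injective)
  rw [Fintype.card_coe] at h
  rw [coordPlane_eq_span]
  exact h

end CoordPlane

/-- The support of `ν` lies in a tube around a coordinate `n`-plane. -/
structure Tube (n : ℕ) (ν : Measure (Euc d)) (e : OrthonormalBasis (Fin d) ℝ (Euc d))
    (E : Finset (Fin d)) (b : Euc d) : Prop where
  card : E.card = n
  perp : ∀ k ∈ E, ⟪e k, b⟫ = 0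
  mem : b ∈ Submodule.span ℝ (msupport ν)
  tube : ∀ x ∈ msupport ν, ∑ k ∈ Eᶜ, ⟪e k, x⟫ ^ 2 = 2 * ⟪x, b⟫

section Tube

variable {ν : Measure (Euc d)} {e : OrthonormalBasis (Fin d) ℝ (Euc d)} {E : Finset (Fin d)}
  {b : Euc d}

lemma Tube.inner_b (hT : Tube n ν e E b) (x : Euc d) :
    ⟪x, b⟫ = ∑ k ∈ Eᶜ, ⟪e k, x⟫ * ⟪e k, b⟫ := by
  rw [← e.sum_inner_mul_inner, ← Finset.sum_add_sum_compl E,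
    Finset.sum_eq_zero fun k hk => by rw [hT.perp k hk, mul_zero], zero_add]
  exact Finset.sum_congr rfl fun i _ => by rw [real_inner_comm]

lemma Tube.sum_b (hT : Tube n ν e E b) : ∑ k ∈ Eᶜ, ⟪e k, b⟫ ^ 2 = ‖b‖ ^ 2 := by
  rw [← real_inner_self_eq_norm_sq, hT.inner_b]
  exact Finset.sum_congr rfl fun i _ => sq _

lemma Tube.sum_sub (hT : Tube n ν e E b) {x : Euc d} (hx : x ∈ msupport ν) :
    ∑ k ∈ Eᶜ, (⟪e k, x⟫ - ⟪e k, b⟫) ^ 2 = ‖b‖ ^ 2 := by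
  have h1 := hT.tube x hx
  have h2 := hT.inner_b x
  have h3 := hT.sum_b
  have h4 : ∑ k ∈ Eᶜ, (⟪e k, x⟫ - ⟪e k, b⟫) ^ 2 = ∑ k ∈ Eᶜ, ⟪e k, x⟫ ^ 2 -
      2 * ∑ k ∈ Eᶜ, ⟪e k, x⟫ * ⟪e k, b⟫ + ∑ k ∈ Eᶜ, ⟪e k, b⟫ ^ 2 := by
    rw [Finset.mul_sum, ← Finset.sum_sub_distrib, ← Finset.sum_add_distrib]
    exact Finset.sum_congr rfl fun k _ => by ring
  rw [h4]; linarith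

lemma Tube.coord_le (hT : Tube n ν e E b) {x : Euc d} (hx : x ∈ msupport ν) {k : Fin d}
    (hk : k ∉ E) : |⟪e k, x⟫| ≤ 2 * ‖b‖ := by
  have h1 : (⟪e k, x⟫ - ⟪e k, b⟫) ^ 2 ≤ ‖b‖ ^ 2 := by
    rw [← hT.sum_sub hx]
    exact Finset.single_le_sum (f := fun l => (⟪e l, x⟫ - ⟪e l, b⟫) ^ 2) (fun l _ => sq_nonneg _)
      (Finset.mem_compl.2 hk)
  have h2 := abs_le_of_sq_le_sq h1 (norm_nonneg _)
  have h3 : |⟪e k, b⟫| ≤ ‖b‖ := by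
    simpa [e.orthonormal.1 k] using abs_real_inner_le_norm (e k) b
  calc |⟪e k, x⟫| = |(⟪e k, x⟫ - ⟪e k, b⟫) + ⟪e k, b⟫| := by rw [sub_add_cancel]
    _ ≤ _ := abs_add_le _ _
    _ ≤ _ := by linarith

lemma Tube.norm_sq (hT : Tube n ν e E b) {x : Euc d} (hx : x ∈ msupport ν) :
    ‖x‖ ^ 2 = 2 * ⟪x, b⟫ + ‖coordProj e E x‖ ^ 2 := by
  rw [norm_coordProj, ← sum_sq_coord e, ← Finset.sum_add_sum_compl E, hT.tube x hx, add_comm]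

lemma Tube.inner_b_nonneg (hT : Tube n ν e E b) {x : Euc d} (hx : x ∈ msupport ν) :
    0 ≤ ⟪x, b⟫ := by
  have := hT.tube x hx
  have h2 : 0 ≤ ∑ k ∈ Eᶜ, ⟪e k, x⟫ ^ 2 := Finset.sum_nonneg fun k _ => sq_nonneg _
  linarith

lemma Tube.inner_b_le (hT : Tube n ν e E b) {x : Euc d} (hx : x ∈ msupport ν) :
    |⟪x, b⟫| ≤ d * (2 * ‖b‖) ^ 2 := by
  rw [abs_of_nonneg (hT.inner_b_nonneg hx)]
  have h1 : ∑ k ∈ Eᶜ, ⟪e k, x⟫ ^ 2 ≤ ∑ k ∈ Eᶜ, (2 * ‖b‖) ^ 2 :=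
    Finset.sum_le_sum fun k hk => by
      rw [← sq_abs]
      have := hT.coord_le hx (Finset.mem_compl.1 hk)
      gcongr
  rw [Finset.sum_const, nsmul_eq_mul, hT.tube x hx] at h1
  have h2 : ((Eᶜ).card : ℝ) ≤ d := by
    exact_mod_cast (Finset.card_le_univ _).trans_eq (Fintype.card_fin d)
  have h3 : ((Eᶜ).card : ℝ) * (2 * ‖b‖) ^ 2 ≤ d * (2 * ‖b‖) ^ 2 := by gcongr
  have := hT.inner_b_nonneg hx
  linarith

/-- Every direction of the plane is realised by points of the support at infinity. -/
lemma Tube.growth (hT : Tube n ν e E b) (h : NUnif n ν) (hn : 0 < n) {s : ℕ → ℝ} (hs : Scale s)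
    {u : Euc d} (hu : u ∈ coordPlane e E) :
    ∃ x : ℕ → Euc d, (∀ j, x j ∈ msupport ν) ∧ Tendsto (fun j => √(s j) • x j) UF (𝓝 u) := by
  have := h.locFin
  have hsq : ∀ j, 0 < √(s j) := fun j => Real.sqrt_pos.2 (hs.pos j)
  set N : ℕ → Measure (Euc d) := fun j => rescale ν 0 (√(s j))⁻¹ with hN
  have hmem : ∀ j y, y ∈ msupport (N j) ↔ (√(s j))⁻¹ • y ∈ msupport ν := fun j y => by
    rw [hN, mem_msupport_rescale ν 0 (inv_pos.2 (hsq j)), zero_add]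
  have hloc : ∀ j, IsLocallyFiniteMeasure (N j) := fun j =>
    rescale_locFin ν h.zero_mem (inv_pos.2 (hsq j))
  have hA : AsympUnif n N := by
    intro z C τ hz hzC hτ hτ0 r hr
    refine tendsto_const_nhds.congr fun j => ?_
    have h1 := hτ j
    have h2 := hsq j
    have h3 := (hmem j _).1 (hz j)
    have h4 : ∀ t : ℝ, 0 < t → (N j).real (closedBall (z j) t) = t ^ n := fun t ht => by
      have h5 : 0 < (√(s j))⁻¹ * t := by positivity
      rw [hN, rescale_real ν 0 (inv_pos.2 h2), zero_add, measureReal_def, measureReal_def,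
        h.ball _ h3 _ h5, h.ball _ h.zero_mem _ (inv_pos.2 h2),
        ENNReal.toReal_ofReal (by positivity), ENNReal.toReal_ofReal (by positivity), mul_pow]
      field_simp
    rw [h4 _ h1, h4 _ (mul_pos hr h1), mul_pow]
    field_simp
  have h0 : ∀ j, (0 : Euc d) ∈ msupport (N j) := fun j => by
    rw [hmem, smul_zero]; exact h.zero_mem
  have hlim := no_holes hA hn h0 (L := coordPlane e E) (by rw [finrank_coordPlane, hT.card])
    (ρ := ‖u‖ + 1) (by positivity) (fun y hy _ q hq k hk => ?_) hu (lt_add_one _)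
  · obtain ⟨y, hy, -, hyu⟩ := exists_seq_of_infDist (fun j => isClosed_msupport _) h0 hlim
    refine ⟨fun j => (√(s j))⁻¹ • y j, fun j => (hmem j _).1 (hy j), hyu.congr fun j => ?_⟩
    rw [smul_smul, mul_inv_cancel₀ (hsq j).ne', one_smul]
  · have h1 : Tendsto (fun j => ⟪e k, y j⟫) UF (𝓝 ⟪e k, q⟫) :=
      ((continuous_const.inner continuous_id).tendsto q).comp hq
    have h2 : Tendsto (fun j => ⟪e k, y j⟫) UF (𝓝 0) := by
      have h3 : Tendsto (fun j => √(s j) * (2 * ‖b‖)) UF (𝓝 0) := by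
        simpa using hs.sqrt.mul_const (2 * ‖b‖)
      refine squeeze_zero_norm (fun j => ?_) h3
      have h4 := hT.coord_le ((hmem j _).1 (hy j)) hk
      rw [real_inner_smul_right, abs_mul, abs_of_pos (inv_pos.2 (hsq j)),
        inv_mul_le_iff₀ (hsq j)] at h4
      exact h4
    exact tendsto_nhds_unique h1 h2

end Tube

section CoordPlane

variable (e : OrthonormalBasis (Fin d) ℝ (Euc d)) (E : Finset (Fin d))

lemma coordProj_add (x z : Euc d) : coordProj e E (x + z) = coordProj e E x + coordProj e E z := by
  simp only [coordProj, inner_add_right, add_smul, Finset.sum_add_distrib]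

lemma inner_coordProj_basis (i j : Fin d) :
    ⟪coordProj e E (e i), coordProj e E (e j)⟫ = if i ∈ E ∧ i = j then 1 else 0 := by
  rw [coordProj, sum_inner]
  simp only [real_inner_smul_left, inner_coordProj, orthonormal_iff_ite.1 e.orthonormal]
  by_cases hi : i ∈ E
  · rw [Finset.sum_eq_single i]
    · simp [hi]
    · intro k _ hk
      simp [hk]
    · exact fun h => absurd hi h
  · rw [Finset.sum_eq_zero]
    · simp [hi]
    · intro k hk
      have : k ≠ i := fun h => hi (h ▸ hk)
      simp [this]

lemma norm_coordProj_le (x : Euc d) : ‖coordProj e E x‖ ≤ ‖x‖ := by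
  refine le_of_sq_le_sq ?_ (norm_nonneg _)
  rw [norm_coordProj, ← sum_sq_coord e x]
  exact Finset.sum_le_sum_of_subset_of_nonneg (Finset.subset_univ _) fun k _ _ => sq_nonneg _

lemma inner_sub_coordProj (x y : Euc d) :
    ⟪x - coordProj e E x, y⟫ = ∑ k ∈ Eᶜ, ⟪e k, x⟫ * ⟪e k, y⟫ := by
  rw [← e.sum_inner_mul_inner, ← Finset.sum_add_sum_compl E]
  rw [Finset.sum_eq_zero fun k hk => by
    rw [real_inner_comm, inner_sub_right, inner_coordProj, if_pos hk, sub_self, zero_mul], zero_add]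
  refine Finset.sum_congr rfl fun k hk => ?_
  rw [real_inner_comm, inner_sub_right, inner_coordProj, if_neg (Finset.mem_compl.1 hk), sub_zero]

end CoordPlane

lemma abs_coord_le (e : OrthonormalBasis (Fin d) ℝ (Euc d)) (k : Fin d) (y : Euc d) :
    |⟪e k, y⟫| ≤ ‖y‖ := by
  simpa [e.orthonormal.1 k] using abs_real_inner_le_norm (e k) y

section Tube

variable {ν : Measure (Euc d)} {e : OrthonormalBasis (Fin d) ℝ (Euc d)} {E : Finset (Fin d)}
  {b : Euc d}

lemma Tube.perp_le (hT : Tube n ν e E b) (x : Euc d) :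
    ∃ M, 0 ≤ M ∧ ∀ y ∈ msupport ν, |⟪x - coordProj e E x, y⟫| ≤ M := by
  refine ⟨∑ k ∈ Eᶜ, |⟪e k, x⟫| * (2 * ‖b‖), by positivity, fun y hy => ?_⟩
  rw [inner_sub_coordProj]
  refine (Finset.abs_sum_le_sum_abs _ _).trans (Finset.sum_le_sum fun k hk => ?_)
  rw [abs_mul]
  have := hT.coord_le hy (Finset.mem_compl.1 hk)
  gcongr

lemma Tube.tendsto_moment_proj (hT : Tube n ν e E b) (h : NUnif n ν) (hn : 0 < n) {s : ℕ → ℝ}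
    (hs : Scale s) (x : Euc d) {p : ℕ} (hp : 0 < p) :
    Tendsto (fun j => s j ^ p * ∫ y, ⟪x, y⟫ ^ (2 * p) ∂(gM ν (s j)) -
      s j ^ p * ∫ y, ⟪coordProj e E x, y⟫ ^ (2 * p) ∂(gM ν (s j))) UF (𝓝 0) := by
  obtain ⟨M, hM, hMb⟩ := hT.perp_le x
  have h1 := h.tendsto_pow_mul_zero hn hs
    (f := fun y => ⟪x, y⟫ ^ (2 * p) - ⟪coordProj e E x, y⟫ ^ (2 * p)) (by fun_prop)
    (C := M * (2 * p : ℕ) * ‖x‖ ^ (2 * p - 1)) (by positivity) (k := 2 * p - 1) (p := p) (by omega)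
    (fun y hy => by
      refine (abs_pow_sub_pow_le _ _ _).trans ?_
      have h2 : |⟪x, y⟫ - ⟪coordProj e E x, y⟫| ≤ M := by
        rw [← inner_sub_left]; exact hMb y hy
      have h3 : max |⟪x, y⟫| |⟪coordProj e E x, y⟫| ≤ ‖x‖ * ‖y‖ := by
        refine max_le (abs_real_inner_le_norm _ _) ((abs_real_inner_le_norm _ _).trans ?_)
        gcongr; exact norm_coordProj_le e E x
      rw [mul_assoc _ (‖x‖ ^ _), ← mul_pow]
      gcongr)
  refine h1.congr fun j => ?_
  have hI : ∀ x : Euc d, Integrable (fun y => ⟪x, y⟫ ^ (2 * p)) (gM ν (s j)) := fun x =>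
    h.gM_integrable hn (hs.pos j) (by fun_prop) (C := ‖x‖ ^ (2 * p)) (k := 2 * p) fun y => by
      rw [norm_pow, ← mul_pow]; gcongr; exact norm_inner_le_norm _ _
  rw [integral_sub (hI _) (hI _), mul_sub]

lemma mom2_self (s : ℝ) (x : Euc d) : mom2 ν s x x = 2 * (s ^ 1 * ∫ y, ⟪x, y⟫ ^ (2 * 1) ∂(gM ν s)) := by
  simp only [mom2, pow_one, mul_one, sq, mul_assoc]

/-- The first and second moments converge to those of the limiting plane. -/
lemma Tube.tendsto_mom (hT : Tube n ν e E b) (h : NUnif n ν) (hn : 0 < n) {s : ℕ → ℝ}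
    (hs : Scale s) : Tendsto (fun j => mom1 ν (s j)) UF (𝓝 b) ∧
      ∀ x, Tendsto (fun j => mom2 ν (s j) x x) UF (𝓝 (‖coordProj e E x‖ ^ 2)) := by
  obtain ⟨b', hb', hb's⟩ := h.exists_mom1_limit hn hs.within
  obtain ⟨e', α, -, -, hQ⟩ := h.exists_mom2_limit hn hs.within
  set Q : Euc d → ℝ := fun x => ∑ i, α i * ⟪e' i, x⟫ ^ 2 with hQd
  have hQc : Continuous Q := by rw [hQd]; fun_prop
  have hQs : ∀ (c : ℝ) x, Q (c • x) = c ^ 2 * Q x := fun c x => by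
    simp only [hQd, Finset.mul_sum, real_inner_smul_right]
    exact Finset.sum_congr rfl fun i _ => by ring
  have hFO : ∀ x ∈ msupport ν, ‖x‖ ^ 2 = 2 * ⟪x, b'⟫ + Q x := fun x hx => by
    refine tendsto_nhds_unique ((h.tendsto_first_order hn hx).comp hs.within) ?_
    exact (((continuous_const.inner continuous_id).tendsto b').comp hb').const_mul 2 |>.add (hQ x)
  have hQE : ∀ u ∈ coordPlane e E, Q u = ‖u‖ ^ 2 := fun u hu => by
    obtain ⟨x, hx, hxu⟩ := hT.growth h hn hs hu
    have h1 : Tendsto (fun j => 2 * (√(s j) * ⟪√(s j) • x j, b'⟫) + Q (√(s j) • x j)) UF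
        (𝓝 (2 * (0 * ⟪u, b'⟫) + Q u)) :=
      ((hs.sqrt.mul (((continuous_id.inner continuous_const).tendsto u).comp hxu)).const_mul 2).add
        ((hQc.tendsto u).comp hxu)
    have h2 := hxu.norm.pow 2
    rw [zero_mul, mul_zero, zero_add] at h1
    refine tendsto_nhds_unique h1 (h2.congr fun j => ?_)
    rw [norm_smul, Real.norm_of_nonneg (Real.sqrt_nonneg _), hQs, real_inner_smul_left, mul_pow,
      hFO _ (hx j)]
    ring
  have hQP : ∀ x, Tendsto (fun j => mom2 ν (s j) x x) UF (𝓝 (‖coordProj e E x‖ ^ 2)) := fun x => by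
    have h1 := (hT.tendsto_moment_proj h hn hs x one_pos).const_mul 2
    have h2 := hQ (coordProj e E x)
    rw [show ∑ i, α i * ⟪e' i, coordProj e E x⟫ ^ 2 = Q (coordProj e E x) from rfl,
      hQE _ (coordProj_mem e E x)] at h2
    have h3 := h1.add h2
    rw [mul_zero, zero_add] at h3
    refine h3.congr fun j => ?_
    rw [mom2_self, mom2_self]; ring
  have hbb : b' = b := by
    have h1 : ∀ x ∈ msupport ν, ⟪b' - b, x⟫ = 0 := fun x hx => by
      have h2 := hFO x hx
      rw [show Q x = _ from tendsto_nhds_unique (hQ x) (hQP x)] at h2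
      have h3 := hT.norm_sq hx
      rw [inner_sub_left, real_inner_comm, real_inner_comm x b]; linarith
    have h2 : b' - b ∈ (Submodule.span ℝ (msupport ν))ᗮ := by
      rw [Submodule.mem_orthogonal']
      intro u hu
      induction hu using Submodule.span_induction with
      | mem x hx => exact h1 x hx
      | zero => exact inner_zero_right _
      | add x y _ _ hx hy => rw [inner_add_right, hx, hy, add_zero]
      | smul c x _ hx => rw [real_inner_smul_right, hx, mul_zero]
    have h3 := Submodule.inner_left_of_mem_orthogonal (Submodule.sub_mem _ hb's hT.mem) h2
    exact sub_eq_zero.1 (inner_self_eq_zero.1 h3)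
  exact ⟨hbb ▸ hb', hQP⟩

lemma Tube.tendsto_mom2 (hT : Tube n ν e E b) (h : NUnif n ν) (hn : 0 < n) {s : ℕ → ℝ}
    (hs : Scale s) (i j : Fin d) :
    Tendsto (fun m => mom2 ν (s m) (e i) (e j)) UF (𝓝 (if i ∈ E ∧ i = j then 1 else 0)) := by
  have hQ := (hT.tendsto_mom h hn hs).2
  have h1 := (((hQ (e i + e j)).sub (hQ (e i))).sub (hQ (e j))).div_const 2
  rw [coordProj_add, norm_add_sq_real, inner_coordProj_basis] at h1
  convert h1.congr fun m => ?_ using 1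
  · congr 1; ring
  · rw [h.mom2_add hn (hs.pos m), mom2_comm ν _ (e i) (e i + e j), mom2_comm ν _ (e j) (e i + e j),
      h.mom2_add hn (hs.pos m), h.mom2_add hn (hs.pos m), mom2_comm ν _ (e j) (e i)]
    ring

lemma Tube.mgf_limit (hT : Tube n ν e E b) (h : NUnif n ν) (hn : 0 < n) {s : ℕ → ℝ}
    (hs : Scale s) {u : Euc d} (hu : u ∈ coordPlane e E) (hu1 : ‖u‖ < 1) {m : ℕ → ℝ}
    (hm : ∀ k, Tendsto (fun j => √(s j) ^ k * ∫ y, ⟪u, y⟫ ^ k ∂(gM ν (s j))) UF (𝓝 (m k))) (p : ℕ) :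
    |(∑ k ∈ Finset.range p, 2 ^ k / k.factorial * m k) - Real.exp (‖u‖ ^ 2)| ≤
      gC n p * (2 * ‖u‖) ^ p := by
  obtain ⟨x, hx, hxu⟩ := hT.growth h hn hs hu
  have hmw : ∀ k, Tendsto (fun j => √(s j) ^ k * ∫ y, ⟪√(s j) • x j, y⟫ ^ k ∂(gM ν (s j))) UF
      (𝓝 (m k)) := fun k => by
    have := (h.tendsto_moment_sub hn hs k hxu).add (hm k)
    simpa using this
  have h1 : Tendsto (fun j => |(∑ k ∈ Finset.range p, 2 ^ k / k.factorial *
      (√(s j) ^ k * ∫ y, ⟪√(s j) • x j, y⟫ ^ k ∂(gM ν (s j)))) -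
      Real.exp (‖√(s j) • x j‖ ^ 2)|) UF
      (𝓝 |(∑ k ∈ Finset.range p, 2 ^ k / k.factorial * m k) - Real.exp (‖u‖ ^ 2)|) :=
    ((tendsto_finsetSum _ fun k _ => (hmw k).const_mul _).sub
      ((Real.continuous_exp.tendsto _).comp (hxu.norm.pow 2))).abs
  have h2 : Tendsto (fun j => gC n p * (2 * ‖√(s j) • x j‖) ^ p) UF (𝓝 (gC n p * (2 * ‖u‖) ^ p)) :=
    ((hxu.norm.const_mul 2).pow p).const_mul _
  refine le_of_tendsto_of_tendsto h1 h2 ?_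
  filter_upwards [hxu.norm.eventually (gt_mem_nhds hu1)] with j hj
  have hsj := hs.pos j
  have h3 : ‖√(s j) • x j‖ = √(s j) * ‖x j‖ := by
    rw [norm_smul, Real.norm_of_nonneg (Real.sqrt_nonneg _)]
  rw [h3] at hj ⊢
  have h4 := h.gM_taylor hn hsj (hx j) hj.le p
  have h5 : ∑ k ∈ Finset.range p, 2 ^ k / k.factorial *
      (√(s j) ^ k * ∫ y, ⟪√(s j) • x j, y⟫ ^ k ∂(gM ν (s j))) =
      ∑ k ∈ Finset.range p, ∫ y, (2 * s j * ⟪x j, y⟫) ^ k / k.factorial ∂(gM ν (s j)) := by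
    refine Finset.sum_congr rfl fun k _ => ?_
    rw [← mul_assoc, ← integral_const_mul]
    congr 1
    ext y
    have h6 : s j ^ k = √(s j) ^ k * √(s j) ^ k := by
      rw [← mul_pow, Real.mul_self_sqrt hsj.le]
    rw [real_inner_smul_left, mul_pow, mul_pow, mul_pow, h6]
    ring
  have h6 : (√(s j) * ‖x j‖) ^ 2 = s j * ‖x j‖ ^ 2 := by rw [mul_pow, Real.sq_sqrt hsj.le]
  rw [h5, h6]
  exact h4

/-- The fourth moments converge to those of the limiting plane. -/
lemma Tube.tendsto_moment_four (hT : Tube n ν e E b) (h : NUnif n ν) (hn : 0 < n) {s : ℕ → ℝ}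
    (hs : Scale s) (x : Euc d) :
    Tendsto (fun j => s j ^ 2 * ∫ y, ⟪x, y⟫ ^ 4 ∂(gM ν (s j))) UF
      (𝓝 (3 / 4 * ‖coordProj e E x‖ ^ 4)) := by
  suffices H : ∀ u ∈ coordPlane e E, Tendsto (fun j => s j ^ 2 * ∫ y, ⟪u, y⟫ ^ 4 ∂(gM ν (s j))) UF
      (𝓝 (3 / 4 * ‖u‖ ^ 4)) by
    have := (hT.tendsto_moment_proj h hn hs x two_pos).add (H _ (coordProj_mem e E x))
    simpa using this
  intro u hu
  have hlim : ∀ k, ∃ l, |l| ≤ ‖u‖ ^ k * gC n k ∧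
      Tendsto (fun j => √(s j) ^ k * ∫ y, ⟪u, y⟫ ^ k ∂(gM ν (s j))) UF (𝓝 l) := fun k =>
    uf_bdd (Eventually.of_forall fun j => by
      have := h.gM_bound hn (hs.pos j) (f := fun y => ⟪u, y⟫ ^ k) (C := ‖u‖ ^ k) (by positivity)
        (k := k) (fun y => by rw [norm_pow, ← mul_pow]; gcongr; exact norm_inner_le_norm _ _)
      rwa [norm_mul, norm_pow, Real.norm_of_nonneg (Real.sqrt_nonneg _)])
  choose m hmb hm using hlim
  have h0 : m 0 = 1 := by
    refine tendsto_nhds_unique (hm 0) (tendsto_const_nhds.congr fun j => ?_)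
    have := h.gM_prob hn (hs.pos j)
    simp
  obtain ⟨hb, hQ⟩ := hT.tendsto_mom h hn hs
  have h1 : m 1 = 0 := by
    have h2 := hs.sqrt.mul (((continuous_const.inner continuous_id).tendsto b (f := fun z => ⟪u, z⟫)).comp hb)
    rw [zero_mul] at h2
    refine tendsto_nhds_unique (hm 1) (h2.congr fun j => ?_)
    change √(s j) * ⟪u, mom1 ν (s j)⟫ = _
    rw [h.mom1_inner hn (hs.pos j)]
    simp only [pow_one]
  have h2 : m 2 = ‖u‖ ^ 2 / 2 := by
    have h3 := (hQ u).div_const 2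
    rw [coordProj_eq_self e E hu] at h3
    refine tendsto_nhds_unique (hm 2) (h3.congr fun j => ?_)
    rw [mom2_self, Real.sq_sqrt (hs.pos j).le]; ring
  have h4 : Tendsto (fun j => s j ^ 2 * ∫ y, ⟪u, y⟫ ^ 4 ∂(gM ν (s j))) UF (𝓝 (m 4)) := by
    refine (hm 4).congr fun j => ?_
    rw [show √(s j) ^ 4 = (√(s j) ^ 2) ^ 2 by ring, Real.sq_sqrt (hs.pos j).le]
  suffices h5 : m 4 = 3 / 4 * ‖u‖ ^ 4 by rwa [← h5]
  set c := ‖u‖ with hc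
  have hc0 : 0 ≤ c := norm_nonneg _
  set A := 2 / 3 * m 4 - c ^ 4 / 2 with hA
  have key : ∀ t : ℝ, |t| * c < 1 → |t| ≤ 1 → |4 / 3 * m 3 * t ^ 3 + A * t ^ 4| ≤
      (gC n 5 * (2 * c) ^ 5 + c ^ 6 * Real.exp (c ^ 2)) * |t| ^ 5 := by
    intro t ht ht1
    have htn : ‖t • u‖ = |t| * c := by rw [norm_smul, Real.norm_eq_abs]
    have h5 := hT.mgf_limit h hn hs (Submodule.smul_mem _ t hu) (by rwa [htn])
      (m := fun k => t ^ k * m k) (fun k => by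
        refine ((hm k).const_mul (t ^ k)).congr fun j => ?_
        simp only [real_inner_smul_left, mul_pow, integral_const_mul]; ring) 5
    have h6 := abs_exp_sub_sum_le ((|t| * c) ^ 2) 3
    rw [htn] at h5
    simp only [Finset.sum_range_succ, Finset.sum_range_zero, h0, h1, h2, Nat.factorial] at h5 h6
    have h7 : |(|t| * c) ^ 2| ^ 3 * Real.exp |(|t| * c) ^ 2| ≤ c ^ 6 * Real.exp (c ^ 2) * |t| ^ 5 := by
      rw [abs_of_nonneg (by positivity)]
      have h8 : (|t| * c) ^ 2 ≤ c ^ 2 := by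
        rw [mul_pow]
        exact mul_le_of_le_one_left (by positivity) (pow_le_one₀ (abs_nonneg _) ht1)
      calc ((|t| * c) ^ 2) ^ 3 * Real.exp ((|t| * c) ^ 2)
          = |t| * (|t| ^ 5 * c ^ 6) * Real.exp ((|t| * c) ^ 2) := by ring
        _ ≤ 1 * (|t| ^ 5 * c ^ 6) * Real.exp (c ^ 2) := by gcongr
        _ = _ := by ring
    have h9 := h6.trans h7
    have h10 : gC n 5 * (2 * (|t| * c)) ^ 5 = gC n 5 * (2 * c) ^ 5 * |t| ^ 5 := by ring
    rw [h10] at h5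
    have h11 : (|t| * c) ^ 2 = t ^ 2 * c ^ 2 := by rw [mul_pow, sq_abs]
    rw [h11] at h5 h9
    have h12 : 4 / 3 * m 3 * t ^ 3 + A * t ^ 4 =
      (((0 + 2 ^ 0 / ((1 : ℕ) : ℝ) * (t ^ 0 * 1) + 2 ^ 1 / ((1 : ℕ) : ℝ) * (t ^ 1 * 0) +
        2 ^ 2 / ((2 : ℕ) : ℝ) * (t ^ 2 * (c ^ 2 / 2)) + 2 ^ 3 / ((6 : ℕ) : ℝ) * (t ^ 3 * m 3) +
        2 ^ 4 / ((24 : ℕ) : ℝ) * (t ^ 4 * m 4)) - Real.exp (t ^ 2 * c ^ 2)) -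
      ((0 + (t ^ 2 * c ^ 2) ^ 0 / ((1 : ℕ) : ℝ) + (t ^ 2 * c ^ 2) ^ 1 / ((1 : ℕ) : ℝ) +
        (t ^ 2 * c ^ 2) ^ 2 / ((2 : ℕ) : ℝ)) - Real.exp (t ^ 2 * c ^ 2))) := by
      rw [hA]; push_cast; ring
    rw [h12, add_mul]
    exact (abs_sub _ _).trans (add_le_add (by simpa using h5) (by simpa using h9))
  have hA0 : |A| ≤ 0 := by
    set M := gC n 5 * (2 * c) ^ 5 + c ^ 6 * Real.exp (c ^ 2) with hM
    have h5 : Tendsto (fun t : ℝ => M * t) (𝓝[>] 0) (𝓝 0) := by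
      have : Tendsto (fun t : ℝ => M * t) (𝓝 0) (𝓝 (M * 0)) := tendsto_id.const_mul M
      rw [mul_zero] at this
      exact this.mono_left nhdsWithin_le_nhds
    refine ge_of_tendsto h5 ?_
    have h6 : Tendsto (fun t : ℝ => t * c) (𝓝[>] 0) (𝓝 0) := by
      have : Tendsto (fun t : ℝ => t * c) (𝓝 0) (𝓝 (0 * c)) := tendsto_id.mul_const c
      rw [zero_mul] at this
      exact this.mono_left nhdsWithin_le_nhds
    filter_upwards [self_mem_nhdsWithin, h6.eventually (gt_mem_nhds one_pos),
      nhdsWithin_le_nhds (gt_mem_nhds one_pos)] with t ht htc ht1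
    have ht : 0 < t := ht
    have hta : |t| = t := abs_of_pos ht
    have h7 := key t (by rwa [hta]) (by rw [hta]; exact ht1.le)
    have h8 := key (-t) (by rwa [abs_neg, hta]) (by rw [abs_neg, hta]; exact ht1.le)
    rw [abs_neg] at h8
    rw [hta] at h7 h8
    have h9 : |A| * t ^ 4 ≤ M * t * t ^ 4 := by
      have h10 : |A| * t ^ 4 = |A * t ^ 4| := by rw [abs_mul, abs_of_pos (pow_pos ht 4)]
      rw [h10, abs_le]
      rw [abs_le] at h7 h8
      constructor <;> nlinarith [h7.1, h7.2, h8.1, h8.2]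
    exact le_of_mul_le_mul_right h9 (pow_pos ht 4)
  have := abs_nonpos_iff.1 hA0
  rw [hA] at this
  linarith

/-- Correlation of the squared norm with a transversal coordinate. -/
lemma Tube.tendsto_sq_mul_coord (hT : Tube n ν e E b) (h : NUnif n ν) (hn : 0 < n) {s : ℕ → ℝ}
    (hs : Scale s) {k : Fin d} (hk : k ∉ E) :
    Tendsto (fun j => s j ^ 1 * ∫ y, ‖y‖ ^ 2 * ⟪e k, y⟫ ∂(gM ν (s j))) UF
      (𝓝 ((n : ℝ) / 2 * ⟪e k, b⟫)) := by
  obtain ⟨l, -, hl⟩ := h.exists_pow_mul_limit hn hs (f := fun y => ‖y‖ ^ 2 * ⟪e k, y⟫) (by fun_prop)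
    (C := 2 * ‖b‖) (by positivity) (p := 1) (fun y hy => by
      rw [abs_mul, abs_of_nonneg (sq_nonneg ‖y‖), mul_comm]
      have := hT.coord_le hy hk
      gcongr)
  suffices l = (n : ℝ) / 2 * ⟪e k, b⟫ by rwa [← this]
  have hb : ∀ {s : ℕ → ℝ}, Scale s → Tendsto (fun j => ∫ y, ⟪e k, y⟫ ∂(gM ν (s j))) UF
      (𝓝 ⟪e k, b⟫) := fun {s} hs =>
    (((continuous_const.inner continuous_id).tendsto b).comp (hT.tendsto_mom h hn hs).1).congr
      fun j => h.mom1_inner hn (hs.pos j) _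
  set C := 2 * ‖b‖ * gC n 4 with hC
  have hlam : ∀ lam : ℝ, 0 < lam →
      |((1 + lam) ^ (-((n : ℝ) / 2)) - 1) / lam * ⟪e k, b⟫ + l| ≤ lam / 2 * C := by
    intro lam hlam
    have h1 : Tendsto (fun j => |((1 + lam) ^ (-((n : ℝ) / 2)) *
        ∫ y, ⟪e k, y⟫ ∂(gM ν (s j * (1 + lam))) - ∫ y, ⟪e k, y⟫ ∂(gM ν (s j))) / lam +
        s j ^ 1 * ∫ y, ‖y‖ ^ 2 * ⟪e k, y⟫ ∂(gM ν (s j))|) UF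
        (𝓝 |((1 + lam) ^ (-((n : ℝ) / 2)) * ⟪e k, b⟫ - ⟪e k, b⟫) / lam + l|) :=
      (((((hb (hs.mul (by linarith))).const_mul _).sub (hb hs)).div_const lam).add hl).abs
    have h2 : ((1 + lam) ^ (-((n : ℝ) / 2)) * ⟪e k, b⟫ - ⟪e k, b⟫) / lam + l =
      ((1 + lam) ^ (-((n : ℝ) / 2)) - 1) / lam * ⟪e k, b⟫ + l := by ring
    rw [h2] at h1
    refine le_of_tendsto h1 (Eventually.of_forall fun j => ?_)
    have hsj := hs.pos j
    have h3 := h.gM_deriv_scale hn hsj hlam (f := fun y => ⟪e k, y⟫) (by fun_prop) (C := 1) (k := 1)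
      (fun y => by rw [one_mul, pow_one]; exact abs_coord_le e k y)
    have h4 : ∫ y, s j * ‖y‖ ^ 2 * ⟪e k, y⟫ ∂(gM ν (s j)) =
        s j ^ 1 * ∫ y, ‖y‖ ^ 2 * ⟪e k, y⟫ ∂(gM ν (s j)) := by
      rw [← integral_const_mul]; congr 1; ext y; ring
    rw [h4] at h3
    refine h3.trans ?_
    have h5 := (h.gM_bound_on hn hsj (f := fun y => ‖y‖ ^ 4 * |⟪e k, y⟫|) (by fun_prop)
      (C := 2 * ‖b‖) (by positivity) (k := 4) (fun y hy => by
        rw [abs_mul, abs_abs, abs_of_nonneg (by positivity : 0 ≤ ‖y‖ ^ 4), mul_comm]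
        have := hT.coord_le hy hk
        gcongr)).2
    have h6 : ∫ y, (s j * ‖y‖ ^ 2) ^ 2 * |⟪e k, y⟫| ∂(gM ν (s j)) =
        √(s j) ^ 4 * ∫ y, ‖y‖ ^ 4 * |⟪e k, y⟫| ∂(gM ν (s j)) := by
      rw [show √(s j) ^ 4 = (√(s j) ^ 2) ^ 2 by ring, Real.sq_sqrt hsj.le, ← integral_const_mul]
      congr 1; ext y; ring
    rw [h6]
    gcongr
    refine le_trans ?_ h5
    gcongr
    exact le_abs_self _
  have h1 : Tendsto (fun lam : ℝ => |((1 + lam) ^ (-((n : ℝ) / 2)) - 1) / lam * ⟪e k, b⟫ + l|)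
      (𝓝[>] 0) (𝓝 |-((n : ℝ) / 2) * ⟪e k, b⟫ + l|) :=
    (((tendsto_scale_slope n).mul_const _).add_const l).abs
  have h2 : Tendsto (fun lam : ℝ => lam / 2 * C) (𝓝[>] 0) (𝓝 0) := by
    have : Tendsto (fun lam : ℝ => lam / 2 * C) (𝓝 0) (𝓝 (0 / 2 * C)) :=
      (tendsto_id.div_const 2).mul_const C
    rw [zero_div, zero_mul] at this
    exact this.mono_left nhdsWithin_le_nhds
  have h3 : |-((n : ℝ) / 2) * ⟪e k, b⟫ + l| ≤ 0 :=
    le_of_tendsto_of_tendsto h1 h2 (by filter_upwards [self_mem_nhdsWithin] with lam hl using hlam lam hl)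
  have := abs_nonpos_iff.1 h3
  linarith

end Tube

/-- Convergence of the Gaussian averages of a sequence of integrable functions. -/
structure MLim (ν : Measure (Euc d)) (s : ℕ → ℝ) (F : ℕ → Euc d → ℝ) (l : ℝ) : Prop where
  int : ∀ j, Integrable (F j) (gM ν (s j))
  lim : Tendsto (fun j => ∫ y, F j y ∂(gM ν (s j))) UF (𝓝 l)

section MLim

variable {ν : Measure (Euc d)} {s : ℕ → ℝ} {F G : ℕ → Euc d → ℝ} {l m : ℝ}

lemma MLim.add (hF : MLim ν s F l) (hG : MLim ν s G m) :
    MLim ν s (fun j y => F j y + G j y) (l + m) :=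
  ⟨fun j => (hF.int j).add (hG.int j), (hF.lim.add hG.lim).congr fun j =>
    (integral_add (hF.int j) (hG.int j)).symm⟩

lemma MLim.seq_mul (hF : MLim ν s F l) {c : ℕ → ℝ} (hc : Tendsto c UF (𝓝 m)) :
    MLim ν s (fun j y => c j * F j y) (m * l) :=
  ⟨fun j => (hF.int j).const_mul _, (hc.mul hF.lim).congr fun _ => (integral_const_mul _ _).symm⟩

lemma MLim.const_mul (hF : MLim ν s F l) (c : ℝ) : MLim ν s (fun j y => c * F j y) (c * l) :=
  hF.seq_mul tendsto_const_nhds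

lemma MLim.sub (hF : MLim ν s F l) (hG : MLim ν s G m) :
    MLim ν s (fun j y => F j y - G j y) (l - m) :=
  ⟨fun j => (hF.int j).sub (hG.int j), (hF.lim.sub hG.lim).congr fun j =>
    (integral_sub (hF.int j) (hG.int j)).symm⟩

lemma MLim.sum {ι : Type*} {t : Finset ι} {F : ι → ℕ → Euc d → ℝ} {l : ι → ℝ}
    (hF : ∀ i, MLim ν s (F i) (l i)) :
    MLim ν s (fun j y => ∑ i ∈ t, F i j y) (∑ i ∈ t, l i) :=
  ⟨fun j => integrable_finsetSum _ fun i _ => (hF i).int j,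
    (tendsto_finsetSum _ fun i _ => (hF i).lim).congr fun j =>
      (integral_finsetSum _ fun i _ => (hF i).int j).symm⟩

lemma MLim.congr (hF : MLim ν s F l) (hFG : ∀ j, ∀ y ∈ msupport ν, F j y = G j y) (hlm : l = m) :
    MLim ν s G m := by
  have h : ∀ j, F j =ᵐ[gM ν (s j)] G j := fun j => by
    filter_upwards [gM_ae_mem ν (s j)] with y hy using hFG j y hy
  exact ⟨fun j => (hF.int j).congr (h j), hlm ▸ hF.lim.congr fun j => integral_congr_ae (h j)⟩

lemma MLim.unique (hF : MLim ν s F l) (hG : MLim ν s G m)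
    (hFG : ∀ j, ∀ y ∈ msupport ν, F j y = G j y) : l = m :=
  tendsto_nhds_unique (hF.congr hFG rfl).lim hG.lim

lemma NUnif.mLim (h : NUnif n ν) (hn : 0 < n) (hs : Scale s) {f : Euc d → ℝ} (hf : Continuous f)
    {C : ℝ} (hC : 0 ≤ C) {k : ℕ} (hb : ∀ y ∈ msupport ν, |f y| ≤ C * ‖y‖ ^ k) {c : ℕ → ℝ}
    (hl : Tendsto (fun j => c j * ∫ y, f y ∂(gM ν (s j))) UF (𝓝 l)) :
    MLim ν s (fun j y => c j * f y) l :=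
  ⟨fun j => ((h.gM_bound_on hn (hs.pos j) hf hC hb).1).const_mul _,
    hl.congr fun _ => (integral_const_mul _ _).symm⟩

lemma NUnif.mLim_one (h : NUnif n ν) (hn : 0 < n) (hs : Scale s) : MLim ν s (fun _ _ => 1) 1 := by
  have : ∀ j, IsProbabilityMeasure (gM ν (s j)) := fun j => h.gM_prob hn (hs.pos j)
  exact ⟨fun j => integrable_const _, tendsto_const_nhds.congr fun j => by simp⟩

lemma NUnif.mLim_const (h : NUnif n ν) (hn : 0 < n) (hs : Scale s) (c : ℝ) :
    MLim ν s (fun _ _ => c) c :=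
  ((h.mLim_one hn hs).const_mul c).congr (fun _ _ _ => mul_one c) (mul_one c)

end MLim

section CoordPlane

variable (e : OrthonormalBasis (Fin d) ℝ (Euc d)) (E : Finset (Fin d))

/-- The matrix of the orthogonal projection onto `coordPlane e E`. -/
def cP (i j : Fin d) : ℝ := if i ∈ E ∧ i = j then 1 else 0

lemma cP_comm (i j : Fin d) : cP E i j = cP E j i := by
  unfold cP
  by_cases h : i = j
  · subst h; rfl
  · simp [h, Ne.symm h]

lemma cP_self (i : Fin d) : cP E i i = if i ∈ E then 1 else 0 := by simp [cP]

lemma coordProj_smul (c : ℝ) (x : Euc d) : coordProj e E (c • x) = c • coordProj e E x := by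
  simp only [coordProj, real_inner_smul_right, Finset.smul_sum, smul_smul]

lemma norm_coordProj_comb (i j k l : Fin d) (a b c : ℝ) :
    ‖coordProj e E (e i + a • e j + b • e k + c • e l)‖ ^ 2 =
      cP E i i + a ^ 2 * cP E j j + b ^ 2 * cP E k k + c ^ 2 * cP E l l +
      2 * (a * cP E i j + b * cP E i k + c * cP E i l + a * b * cP E j k + a * c * cP E j l +
        b * c * cP E k l) := by
  have hc : ∀ i j, ⟪coordProj e E (e i), coordProj e E (e j)⟫ = cP E i j :=
    inner_coordProj_basis e E
  rw [← real_inner_self_eq_norm_sq]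
  simp only [coordProj_add, coordProj_smul, inner_add_left, inner_add_right, real_inner_smul_left,
    real_inner_smul_right, hc]
  change cP E i i + a * cP E j i + b * cP E k i + c * cP E l i +
    (a * cP E i j + a * (a * cP E j j) + a * (b * cP E k j) + a * (c * cP E l j)) +
    (b * cP E i k + b * (a * cP E j k) + b * (b * cP E k k) + b * (c * cP E l k)) +
    (c * cP E i l + c * (a * cP E j l) + c * (b * cP E k l) + c * (c * cP E l l)) = _
  rw [cP_comm E j i, cP_comm E k i, cP_comm E l i, cP_comm E k j, cP_comm E l j, cP_comm E l k]
  ring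

/-- The component of a basis vector orthogonal to `coordPlane e E`. -/
def cN (k : Fin d) : Euc d := if k ∈ E then 0 else e k

variable {e E}

lemma inner_cN_of_notMem {k : Fin d} (hk : k ∉ E) (y : Euc d) : ⟪cN e E k, y⟫ = ⟪e k, y⟫ := by
  rw [cN, if_neg hk]

lemma inner_cN_of_mem {k : Fin d} (hk : k ∈ E) (y : Euc d) : ⟪cN e E k, y⟫ = 0 := by
  rw [cN, if_pos hk, inner_zero_left]

end CoordPlane

section Tube

variable {ν : Measure (Euc d)} {e : OrthonormalBasis (Fin d) ℝ (Euc d)} {E : Finset (Fin d)}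
  {b : Euc d} {s : ℕ → ℝ}

lemma Tube.cN_le (hT : Tube n ν e E b) {y : Euc d} (hy : y ∈ msupport ν) (k : Fin d) :
    |⟪cN e E k, y⟫| ≤ 2 * ‖b‖ := by
  by_cases hk : k ∈ E
  · rw [inner_cN_of_mem hk, abs_zero]; positivity
  · rw [inner_cN_of_notMem hk]; exact hT.coord_le hy hk

lemma Tube.sum_cN_sq (hT : Tube n ν e E b) {y : Euc d} (hy : y ∈ msupport ν) :
    ∑ k, ⟪cN e E k, y⟫ ^ 2 = 2 * ⟪b, y⟫ := by
  rw [real_inner_comm, ← hT.tube y hy, ← Finset.sum_add_sum_compl E,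
    Finset.sum_eq_zero fun k hk => by rw [inner_cN_of_mem hk, sq, mul_zero], zero_add]
  exact Finset.sum_congr rfl fun k hk => by rw [inner_cN_of_notMem (Finset.mem_compl.1 hk)]

lemma Tube.sum_b_cN (hT : Tube n ν e E b) (y : Euc d) :
    ∑ k, ⟪e k, b⟫ * ⟪cN e E k, y⟫ = ⟪b, y⟫ := by
  rw [real_inner_comm, hT.inner_b, ← Finset.sum_add_sum_compl E,
    Finset.sum_eq_zero fun k hk => by rw [inner_cN_of_mem hk, mul_zero], zero_add]
  exact Finset.sum_congr rfl fun k hk => by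
    rw [inner_cN_of_notMem (Finset.mem_compl.1 hk), mul_comm]

lemma Tube.mLim_one (hT : Tube n ν e E b) (h : NUnif n ν) (hn : 0 < n) (hs : Scale s)
    (x : Euc d) : MLim ν s (fun _ y => ⟪x, y⟫) ⟪x, b⟫ :=
  (h.mLim hn hs (f := fun y => ⟪x, y⟫) (by fun_prop) (norm_nonneg x) (k := 1) (c := fun _ => 1)
    (fun y _ => by rw [pow_one]; exact abs_real_inner_le_norm _ _)
    (((((continuous_const.inner continuous_id).tendsto b).comp (hT.tendsto_mom h hn hs).1).congr
      fun j => h.mom1_inner hn (hs.pos j) x).congr fun j => (one_mul _).symm)).congr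
    (fun _ _ _ => one_mul _) rfl

lemma coord_mul_le (i j : Fin d) (y : Euc d) :
    |⟪e i, y⟫ * ⟪e j, y⟫| ≤ 1 * ‖y‖ ^ 2 := by
  rw [abs_mul, one_mul, sq]
  exact mul_le_mul (abs_coord_le e i y) (abs_coord_le e j y) (abs_nonneg _) (norm_nonneg _)

lemma Tube.mLim_two (hT : Tube n ν e E b) (h : NUnif n ν) (hn : 0 < n) (hs : Scale s)
    (i j : Fin d) : MLim ν s (fun m y => s m * (⟪e i, y⟫ * ⟪e j, y⟫)) (cP E i j / 2) :=
  h.mLim hn hs (by fun_prop) zero_le_one (fun y _ => coord_mul_le i j y)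
    (((hT.tendsto_mom2 h hn hs i j).div_const 2).congr fun m => by rw [mom2]; ring)

lemma Tube.mLim_four_pow (hT : Tube n ν e E b) (h : NUnif n ν) (hn : 0 < n) (hs : Scale s)
    (x : Euc d) : MLim ν s (fun m y => s m ^ 2 * ⟪x, y⟫ ^ 4) (3 / 4 * ‖coordProj e E x‖ ^ 4) :=
  h.mLim hn hs (f := fun y => ⟪x, y⟫ ^ 4) (by fun_prop) (C := ‖x‖ ^ 4) (by positivity) (k := 4)
    (fun y _ => by
      rw [abs_pow, ← mul_pow]
      exact pow_le_pow_left₀ (abs_nonneg _) (abs_real_inner_le_norm _ _) 4)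
    (hT.tendsto_moment_four h hn hs x)

lemma Tube.mLim_four (hT : Tube n ν e E b) (h : NUnif n ν) (hn : 0 < n) (hs : Scale s)
    (i j k l : Fin d) :
    MLim ν s (fun m y => s m ^ 2 * (⟪e i, y⟫ * ⟪e j, y⟫ * (⟪e k, y⟫ * ⟪e l, y⟫)))
      ((cP E i j * cP E k l + cP E i k * cP E j l + cP E i l * cP E j k) / 4) := by
  have H : ∀ a b c : ℝ, MLim ν s (fun m y => s m ^ 2 *
      (⟪e i, y⟫ + a * ⟪e j, y⟫ + b * ⟪e k, y⟫ + c * ⟪e l, y⟫) ^ 4)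
      (3 / 4 * (cP E i i + a ^ 2 * cP E j j + b ^ 2 * cP E k k + c ^ 2 * cP E l l +
      2 * (a * cP E i j + b * cP E i k + c * cP E i l + a * b * cP E j k + a * c * cP E j l +
        b * c * cP E k l)) ^ 2) := fun a b c => by
    refine (hT.mLim_four_pow h hn hs (e i + a • e j + b • e k + c • e l)).congr
      (fun m y _ => ?_) ?_
    · simp only [inner_add_left, real_inner_smul_left]
    · rw [← norm_coordProj_comb]; ring
  refine (((((((((H 1 1 1).sub (H 1 1 (-1))).sub (H 1 (-1) 1)).sub (H (-1) 1 1)).add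
    (H 1 (-1) (-1))).add (H (-1) 1 (-1))).add (H (-1) (-1) 1)).sub (H (-1) (-1) (-1))).const_mul
    (1 / 192)).congr (fun m y _ => by ring) (by ring)

/-- The mixed third moments with one transversal factor. -/
lemma Tube.exists_third (hT : Tube n ν e E b) (h : NUnif n ν) (hn : 0 < n) (hs : Scale s) :
    ∃ B : Fin d → Fin d → Fin d → ℝ,
      (∀ i j k, MLim ν s (fun m y => s m * (⟪e i, y⟫ * ⟪e j, y⟫ * ⟪cN e E k, y⟫)) (B i j k)) ∧
      (∀ i j k, i ∉ E → B i j k = 0) ∧ (∀ i j k, j ∉ E → B i j k = 0) ∧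
      (∀ i j k, k ∈ E → B i j k = 0) ∧ ∀ k, ∑ i, B i i k = n / 2 * ⟪e k, b⟫ := by
  have hbd : ∀ i j k, ∀ y ∈ msupport ν,
      |⟪e i, y⟫ * ⟪e j, y⟫ * ⟪cN e E k, y⟫| ≤ 2 * ‖b‖ * ‖y‖ ^ 2 := fun i j k y hy => by
    rw [abs_mul, mul_comm]
    have h1 := coord_mul_le (e := e) i j y
    rw [one_mul] at h1
    exact mul_le_mul (hT.cN_le hy k) h1 (abs_nonneg _) (by positivity)
  have hex : ∀ i j k, ∃ l,
      MLim ν s (fun m y => s m * (⟪e i, y⟫ * ⟪e j, y⟫ * ⟪cN e E k, y⟫)) l := fun i j k => by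
    obtain ⟨l, -, hl⟩ := h.exists_pow_mul_limit hn hs
      (f := fun y => ⟪e i, y⟫ * ⟪e j, y⟫ * ⟪cN e E k, y⟫) (by fun_prop) (C := 2 * ‖b‖)
      (by positivity) (p := 1) (hbd i j k)
    exact ⟨l, h.mLim hn hs (by fun_prop) (by positivity) (hbd i j k) (by simpa using hl)⟩
  choose B hB using hex
  have hsymm : ∀ i j k, B i j k = B j i k := fun i j k =>
    (hB i j k).unique (hB j i k) fun m y _ => by ring
  have hzero : ∀ i j k, i ∉ E → B i j k = 0 := fun i j k hi => by
    have h1 := h.tendsto_pow_mul_zero hn hs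
      (f := fun y => ⟪e i, y⟫ * ⟪e j, y⟫ * ⟪cN e E k, y⟫) (by fun_prop) (C := (2 * ‖b‖) * (2 * ‖b‖))
      (by positivity) (p := 1) (k := 1) (by norm_num) (fun y hy => by
        rw [abs_mul, abs_mul, pow_one]
        calc |⟪e i, y⟫| * |⟪e j, y⟫| * |⟪cN e E k, y⟫| ≤ (2 * ‖b‖) * ‖y‖ * (2 * ‖b‖) := by
              have h1 := hT.coord_le hy hi
              have h2 := abs_coord_le e j y
              have h3 := hT.cN_le hy k
              gcongr
          _ = _ := by ring)
    refine tendsto_nhds_unique (hB i j k).lim (h1.congr fun m => ?_)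
    rw [pow_one, integral_const_mul]
  refine ⟨B, hB, hzero, fun i j k hj => by rw [hsymm]; exact hzero _ _ _ hj, fun i j k hk => ?_,
    fun k => ?_⟩
  · refine (hB i j k).unique (m := 0) ((h.mLim_const hn hs 0)) fun m y _ => ?_
    rw [inner_cN_of_mem hk, mul_zero, mul_zero]
  · by_cases hk : k ∈ E
    · rw [hT.perp k hk, mul_zero]
      refine Finset.sum_eq_zero fun i _ => (hB i i k).unique (m := 0) ((h.mLim_const hn hs 0))
        fun m y _ => ?_
      rw [inner_cN_of_mem hk, mul_zero, mul_zero]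
    · refine tendsto_nhds_unique (MLim.sum (t := Finset.univ) fun i => hB i i k).lim
        ((hT.tendsto_sq_mul_coord h hn hs hk).congr fun m => ?_)
      rw [pow_one, ← integral_const_mul]
      congr 1
      ext y
      rw [← Finset.mul_sum, ← Finset.sum_mul, inner_cN_of_notMem hk, ← sum_sq_coord e y]
      simp only [sq]

end Tube

section Forms

variable (e : OrthonormalBasis (Fin d) ℝ (Euc d))

/-- The quadratic form with coefficients `D`. -/
def qd (D : Fin d → Fin d → ℝ) (x : Euc d) : ℝ := ∑ i, ∑ j, D i j * (⟪e i, x⟫ * ⟪e j, x⟫)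

/-- The cubic form with coefficients `T`. -/
def cb (T : Fin d → Fin d → Fin d → ℝ) (x : Euc d) : ℝ :=
  ∑ i, ∑ j, ∑ k, T i j k * (⟪e i, x⟫ * ⟪e j, x⟫ * ⟪e k, x⟫)

lemma inner_eq_sum (x y : Euc d) : ⟪x, y⟫ = ∑ i, ⟪e i, x⟫ * ⟪e i, y⟫ := by
  rw [← e.sum_inner_mul_inner]
  exact Finset.sum_congr rfl fun i _ => by rw [real_inner_comm]

lemma qd_inner (x y : Euc d) : qd e (fun i j => ⟪e i, y⟫ * ⟪e j, y⟫) x = ⟪x, y⟫ ^ 2 := by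
  rw [inner_eq_sum e, sq, Finset.sum_mul_sum, qd]
  exact Finset.sum_congr rfl fun i _ => Finset.sum_congr rfl fun j _ => by ring

lemma cb_inner (x y : Euc d) :
    cb e (fun i j k => ⟪e i, y⟫ * ⟪e j, y⟫ * ⟪e k, y⟫) x = ⟪x, y⟫ ^ 3 := by
  rw [inner_eq_sum e, pow_succ, sq, Finset.sum_mul_sum, Finset.sum_mul, cb]
  refine Finset.sum_congr rfl fun i _ => ?_
  rw [Finset.sum_mul_sum]
  exact Finset.sum_congr rfl fun j _ => Finset.sum_congr rfl fun k _ => by ring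

lemma qd_cP (E : Finset (Fin d)) (x : Euc d) : qd e (cP E) x = ‖coordProj e E x‖ ^ 2 := by
  rw [norm_coordProj, qd, ← Finset.sum_add_sum_compl E]
  rw [Finset.sum_eq_zero (s := Eᶜ) fun i hi => by simp [cP, Finset.mem_compl.1 hi], add_zero]
  refine Finset.sum_congr rfl fun i hi => ?_
  rw [Finset.sum_eq_single i]
  · rw [cP_self, if_pos hi, one_mul, sq]
  · intro j _ hj
    rw [cP, if_neg fun h => hj h.2.symm, zero_mul]
  · simp

lemma qd_smul (D : Fin d → Fin d → ℝ) (c : ℝ) (x : Euc d) : qd e D (c • x) = c ^ 2 * qd e D x := by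
  simp only [qd, real_inner_smul_right, Finset.mul_sum]
  exact Finset.sum_congr rfl fun i _ => Finset.sum_congr rfl fun j _ => by ring

lemma cb_smul (T : Fin d → Fin d → Fin d → ℝ) (c : ℝ) (x : Euc d) :
    cb e T (c • x) = c ^ 3 * cb e T x := by
  simp only [cb, real_inner_smul_right, Finset.mul_sum]
  exact Finset.sum_congr rfl fun i _ => Finset.sum_congr rfl fun j _ =>
    Finset.sum_congr rfl fun k _ => by ring

lemma continuous_qd (D : Fin d → Fin d → ℝ) : Continuous (qd e D) := by
  unfold qd; fun_prop

lemma continuous_cb (T : Fin d → Fin d → Fin d → ℝ) : Continuous (cb e T) := by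
  unfold cb; fun_prop

variable {e} {ν : Measure (Euc d)} {s : ℕ → ℝ}

lemma MLim.qd {F : Fin d → Fin d → ℕ → Euc d → ℝ} {D : Fin d → Fin d → ℝ}
    (hF : ∀ i j, MLim ν s (F i j) (D i j)) (x : Euc d) :
    MLim ν s (fun m y => qd e (fun i j => F i j m y) x) (qd e D x) :=
  MLim.sum fun i => MLim.sum fun j =>
    ((hF i j).const_mul (⟪e i, x⟫ * ⟪e j, x⟫)).congr (fun _ _ _ => mul_comm _ _) (mul_comm _ _)

lemma MLim.cb {F : Fin d → Fin d → Fin d → ℕ → Euc d → ℝ} {T : Fin d → Fin d → Fin d → ℝ}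
    (hF : ∀ i j k, MLim ν s (F i j k) (T i j k)) (x : Euc d) :
    MLim ν s (fun m y => cb e (fun i j k => F i j k m y) x) (cb e T x) :=
  MLim.sum fun i => MLim.sum fun j => MLim.sum fun k =>
    ((hF i j k).const_mul (⟪e i, x⟫ * ⟪e j, x⟫ * ⟪e k, x⟫)).congr (fun _ _ _ => mul_comm _ _)
      (mul_comm _ _)

end Forms

/-- The normalized second-order data of `ν` at infinity. -/
structure SecondOrder (ν : Measure (Euc d)) (s : ℕ → ℝ) (e : OrthonormalBasis (Fin d) ℝ (Euc d))
    (E : Finset (Fin d)) (b : Euc d) (κ : ℕ → ℝ) (a : Euc d) (D : Fin d → Fin d → ℝ)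
    (T : Fin d → Fin d → Fin d → ℝ) (g : ℝ) : Prop where
  le : ∀ m, s m ≤ κ m
  ratio : Tendsto (fun m => s m / κ m) UF (𝓝 g)
  lin : ∀ x, MLim ν s (fun m y => (κ m)⁻¹ * (⟪x, y⟫ - ⟪x, b⟫)) ⟪x, a⟫
  quad : ∀ i j,
    MLim ν s (fun m y => (κ m)⁻¹ * (2 * s m * (⟪e i, y⟫ * ⟪e j, y⟫) - cP E i j)) (D i j)
  cubic : ∀ i j k,
    MLim ν s (fun m y => (κ m)⁻¹ * (4 / 3 * s m ^ 2 * (⟪e i, y⟫ * ⟪e j, y⟫ * ⟪e k, y⟫))) (T i j k)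
  norm : g + ‖a‖ + ∑ i, ∑ j, |D i j| + ∑ i, ∑ j, ∑ k, |T i j k| = 1
  mem : a ∈ Submodule.span ℝ (msupport ν)

section Tube

variable {ν : Measure (Euc d)} {e : OrthonormalBasis (Fin d) ℝ (Euc d)} {E : Finset (Fin d)}
  {b : Euc d} {s : ℕ → ℝ}

lemma uf_bdd_mul {κ w : ℕ → ℝ} (hκ : ∀ m, 0 < κ m) (hw : ∀ m, |w m| ≤ κ m) :
    ∃ l, Tendsto (fun m => (κ m)⁻¹ * w m) UF (𝓝 l) := by
  obtain ⟨l, -, hl⟩ := uf_bdd (f := fun m => (κ m)⁻¹ * w m) (C := 1) (Eventually.of_forall fun m => by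
    rw [norm_mul, norm_inv, Real.norm_of_nonneg (hκ m).le, Real.norm_eq_abs, inv_mul_le_iff₀ (hκ m),
      mul_one]
    exact hw m)
  exact ⟨l, hl⟩

lemma Tube.exists_secondOrder (hT : Tube n ν e E b) (h : NUnif n ν) (hn : 0 < n) (hs : Scale s) :
    ∃ κ a D T g, SecondOrder ν s e E b κ a D T g := by
  have hP : ∀ m, IsProbabilityMeasure (gM ν (s m)) := fun m => h.gM_prob hn (hs.pos m)
  set v : ℕ → Euc d := fun m => mom1 ν (s m) - b with hv
  set w2 : Fin d → Fin d → ℕ → ℝ := fun i j m =>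
    ∫ y, (2 * s m * (⟪e i, y⟫ * ⟪e j, y⟫) - cP E i j) ∂(gM ν (s m)) with hw2
  set w3 : Fin d → Fin d → Fin d → ℕ → ℝ := fun i j k m =>
    ∫ y, 4 / 3 * s m ^ 2 * (⟪e i, y⟫ * ⟪e j, y⟫ * ⟪e k, y⟫) ∂(gM ν (s m)) with hw3
  set κ : ℕ → ℝ := fun m => s m + ‖v m‖ + ∑ i, ∑ j, |w2 i j m| + ∑ i, ∑ j, ∑ k, |w3 i j k m|
    with hκd
  have hn2 : ∀ m, 0 ≤ ∑ i, ∑ j, |w2 i j m| := fun m => by positivity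
  have hn3 : ∀ m, 0 ≤ ∑ i, ∑ j, ∑ k, |w3 i j k m| := fun m => by positivity
  have hle : ∀ m, s m ≤ κ m := fun m => by
    have := hn2 m; have := hn3 m; have := norm_nonneg (v m)
    simp only [hκd]; linarith
  have hκ : ∀ m, 0 < κ m := fun m => (hs.pos m).trans_le (hle m)
  obtain ⟨g, hg⟩ := uf_bdd_mul hκ (w := s) fun m => by rw [abs_of_pos (hs.pos m)]; exact hle m
  obtain ⟨a, -, ha⟩ := uf_bdd (f := fun m => (κ m)⁻¹ • v m) (C := 1)
    (Eventually.of_forall fun m => by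
      rw [norm_smul, norm_inv, Real.norm_of_nonneg (hκ m).le, inv_mul_le_iff₀ (hκ m), mul_one]
      have := hn2 m; have := hn3 m; have := hs.pos m
      simp only [hκd]; linarith)
  have h2 : ∀ i j, ∃ l, Tendsto (fun m => (κ m)⁻¹ * w2 i j m) UF (𝓝 l) := fun i j =>
    uf_bdd_mul hκ fun m => by
      have h1 : |w2 i j m| ≤ ∑ i, ∑ j, |w2 i j m| :=
        (Finset.single_le_sum (f := fun j => |w2 i j m|) (fun _ _ => abs_nonneg _)
          (Finset.mem_univ j)).trans
        (Finset.single_le_sum (f := fun i => ∑ j, |w2 i j m|) (fun _ _ => by positivity)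
          (Finset.mem_univ i))
      have := hn3 m; have := hs.pos m; have := norm_nonneg (v m)
      simp only [hκd]; linarith
  have h3 : ∀ i j k, ∃ l, Tendsto (fun m => (κ m)⁻¹ * w3 i j k m) UF (𝓝 l) := fun i j k =>
    uf_bdd_mul hκ fun m => by
      have h1 : |w3 i j k m| ≤ ∑ i, ∑ j, ∑ k, |w3 i j k m| :=
        (Finset.single_le_sum (f := fun k => |w3 i j k m|) (fun _ _ => abs_nonneg _)
          (Finset.mem_univ k)).trans
        ((Finset.single_le_sum (f := fun j => ∑ k, |w3 i j k m|) (fun _ _ => by positivity)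
          (Finset.mem_univ j)).trans
        (Finset.single_le_sum (f := fun i => ∑ j, ∑ k, |w3 i j k m|) (fun _ _ => by positivity)
          (Finset.mem_univ i)))
      have := hn2 m; have := hs.pos m; have := norm_nonneg (v m)
      simp only [hκd]; linarith
  choose D hD using h2
  choose T hTl using h3
  have hi2 : ∀ i j m, Integrable (fun y => 2 * s m * (⟪e i, y⟫ * ⟪e j, y⟫) - cP E i j) (gM ν (s m)) :=
    fun i j m => (((h.gM_bound_on hn (hs.pos m) (f := fun y => ⟪e i, y⟫ * ⟪e j, y⟫) (by fun_prop)
      zero_le_one (k := 2) fun y _ => coord_mul_le i j y).1).const_mul _).sub (integrable_const _)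
  have hi3 : ∀ i j k m,
      Integrable (fun y => 4 / 3 * s m ^ 2 * (⟪e i, y⟫ * ⟪e j, y⟫ * ⟪e k, y⟫)) (gM ν (s m)) :=
    fun i j k m => ((h.gM_bound_on hn (hs.pos m) (f := fun y => ⟪e i, y⟫ * ⟪e j, y⟫ * ⟪e k, y⟫)
      (by fun_prop) zero_le_one (k := 3) fun y _ => by
        rw [abs_mul, pow_succ, ← mul_assoc]
        exact mul_le_mul (coord_mul_le i j y) (abs_coord_le e k y) (abs_nonneg _)
          (by positivity)).1).const_mul _
  have hi1 : ∀ x m, Integrable (fun y => ⟪x, y⟫ - ⟪x, b⟫) (gM ν (s m)) := fun x m =>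
    ((hT.mLim_one h hn hs x).int m).sub (integrable_const _)
  refine ⟨κ, a, D, T, g, hle, hg.congr fun m => by rw [mul_comm, div_eq_mul_inv], fun x => ?_,
    fun i j => ⟨fun m => (hi2 i j m).const_mul _, (hD i j).congr fun m =>
      (integral_const_mul _ _).symm⟩,
    fun i j k => ⟨fun m => (hi3 i j k m).const_mul _, (hTl i j k).congr fun m =>
      (integral_const_mul _ _).symm⟩, ?_, ?_⟩
  · refine ⟨fun m => (hi1 x m).const_mul _,
      (((continuous_const.inner continuous_id).tendsto a).comp ha).congr fun m => ?_⟩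
    change ⟪x, (κ m)⁻¹ • v m⟫ = _
    rw [integral_const_mul, integral_sub ((hT.mLim_one h hn hs x).int m) (integrable_const _),
      real_inner_smul_right, hv, inner_sub_right, h.mom1_inner hn (hs.pos m)]
    simp
  · have h4 : Tendsto (fun m => (κ m)⁻¹ * s m + ‖(κ m)⁻¹ • v m‖ +
        ∑ i, ∑ j, |(κ m)⁻¹ * w2 i j m| + ∑ i, ∑ j, ∑ k, |(κ m)⁻¹ * w3 i j k m|) UF
        (𝓝 (g + ‖a‖ + ∑ i, ∑ j, |D i j| + ∑ i, ∑ j, ∑ k, |T i j k|)) :=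
      (((hg.add ha.norm).add (tendsto_finsetSum _ fun i _ => tendsto_finsetSum _ fun j _ =>
        (hD i j).abs)).add (tendsto_finsetSum _ fun i _ => tendsto_finsetSum _ fun j _ =>
        tendsto_finsetSum _ fun k _ => (hTl i j k).abs))
    refine tendsto_nhds_unique h4 (tendsto_const_nhds.congr fun m => ?_)
    have h5 : |(κ m)⁻¹| = (κ m)⁻¹ := abs_of_pos (inv_pos.2 (hκ m))
    simp only [norm_smul, Real.norm_eq_abs, abs_mul, h5, ← Finset.mul_sum, ← mul_add]
    exact (inv_mul_cancel₀ (hκ m).ne').symm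
  · refine (Submodule.closed_of_finiteDimensional _).mem_of_tendsto ha
      (Eventually.of_forall fun m => ?_)
    exact Submodule.smul_mem _ _ (Submodule.sub_mem _ (h.mom1_mem_span hn (hs.pos m)) hT.mem)

lemma SecondOrder.identity {κ a D T g} (hS : SecondOrder ν s e E b κ a D T g)
    (hT : Tube n ν e E b) (h : NUnif n ν) (hn : 0 < n) (hs : Scale s) {x : Euc d}
    (hx : x ∈ msupport ν) :
    2 * ⟪x, a⟫ + qd e D x + cb e T x +
      g * (1 / 2 * ‖coordProj e E x‖ ^ 4 - 1 / 2 * ‖x‖ ^ 4) = 0 := by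
  have hP : ∀ m, IsProbabilityMeasure (gM ν (s m)) := fun m => h.gM_prob hn (hs.pos m)
  have hκ : ∀ m, 0 < κ m := fun m => (hs.pos m).trans_le (hS.le m)
  have M1 := (hS.lin x).const_mul 2
  have M2 : MLim ν s (fun m y => (κ m)⁻¹ * (2 * s m * ⟪x, y⟫ ^ 2 - ‖coordProj e E x‖ ^ 2))
      (qd e D x) := (MLim.qd hS.quad x).congr (fun m y _ => by
    rw [← qd_inner e x y, ← qd_cP]
    simp only [qd, Finset.mul_sum, ← Finset.sum_sub_distrib]
    exact Finset.sum_congr rfl fun i _ => Finset.sum_congr rfl fun j _ => by ring) rfl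
  have M3 : MLim ν s (fun m y => (κ m)⁻¹ * (4 / 3 * s m ^ 2 * ⟪x, y⟫ ^ 3)) (cb e T x) :=
    (MLim.cb hS.cubic x).congr (fun m y _ => by
      rw [← cb_inner e x y]
      simp only [cb, Finset.mul_sum]
      exact Finset.sum_congr rfl fun i _ => Finset.sum_congr rfl fun j _ =>
        Finset.sum_congr rfl fun k _ => by ring) rfl
  have M4 := (((hT.mLim_four_pow h hn hs x).const_mul (2 / 3)).sub
    (h.mLim_const hn hs (1 / 2 * ‖x‖ ^ 4))).seq_mul hS.ratio
  have M := ((M1.add M2).add M3).add M4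
  rw [show (2 : ℝ) / 3 * (3 / 4 * ‖coordProj e E x‖ ^ 4) = 1 / 2 * ‖coordProj e E x‖ ^ 4 by ring]
    at M
  refine tendsto_nhds_unique M.lim ?_
  set C := gC n 5 * (2 * ‖x‖) ^ 5 + ‖x‖ ^ 6 * Real.exp (‖x‖ ^ 2) with hC
  have hlim : Tendsto (fun m => C * √(s m)) UF (𝓝 0) := by simpa using hs.sqrt.const_mul C
  have hsx : Tendsto (fun m => √(s m) * ‖x‖) UF (𝓝 0) := by simpa using hs.sqrt.mul_const ‖x‖
  refine squeeze_zero_norm' ?_ hlim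
  filter_upwards [hsx.eventually (gt_mem_nhds one_pos), hs.sqrt.eventually (gt_mem_nhds one_pos)]
    with m hm hm1
  have hsm := hs.pos m
  have hm1' := hm1.le
  set σ := √(s m) with hσ
  have hσ0 : 0 < σ := Real.sqrt_pos.2 hsm
  have hσs : s m = σ ^ 2 := (Real.sq_sqrt hsm.le).symm
  have h5 := h.gM_taylor hn hsm hx hm.le 5
  have h6 := abs_exp_sub_sum_le (s m * ‖x‖ ^ 2) 3
  have hI : ∀ k : ℕ, Integrable (fun y => ⟪x, y⟫ ^ k) (gM ν (s m)) := fun k =>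
    h.gM_integrable hn hsm (by fun_prop) (C := ‖x‖ ^ k) (k := k) fun y => by
      rw [norm_pow, ← mul_pow]; gcongr; exact norm_inner_le_norm _ _
  have hI1 : Integrable (fun y => ⟪x, y⟫) (gM ν (s m)) := by simpa using hI 1
  have h7 : (∫ y, (2 * ((κ m)⁻¹ * (⟪x, y⟫ - ⟪x, b⟫)) +
      (κ m)⁻¹ * (2 * s m * ⟪x, y⟫ ^ 2 - ‖coordProj e E x‖ ^ 2) +
      (κ m)⁻¹ * (4 / 3 * s m ^ 2 * ⟪x, y⟫ ^ 3) +
      s m / κ m * (2 / 3 * (s m ^ 2 * ⟪x, y⟫ ^ 4) - 1 / 2 * ‖x‖ ^ 4)) ∂(gM ν (s m))) =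
      (κ m)⁻¹ * (s m)⁻¹ * ((∑ k ∈ Finset.range 5,
        ∫ y, (2 * s m * ⟪x, y⟫) ^ k / k.factorial ∂(gM ν (s m))) -
        (1 + s m * ‖x‖ ^ 2 + s m ^ 2 * ‖x‖ ^ 4 / 2)) := by
    rw [integral_add ((((M1.add M2).add M3)).int m) (M4.int m),
      integral_add (((M1.add M2)).int m) (M3.int m), integral_add (M1.int m) (M2.int m)]
    have hN := hT.norm_sq hx
    simp only [integral_const_mul, Finset.sum_range_succ, Finset.sum_range_zero, mul_pow,
      integral_div]
    rw [integral_sub hI1 (integrable_const _), integral_sub ((hI 2).const_mul _)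
      (integrable_const _), integral_sub (((hI 4).const_mul _).const_mul _) (integrable_const _)]
    simp only [integral_const_mul, integral_const, probReal_univ, one_smul, pow_zero, pow_one,
      Nat.factorial]
    have hκm := (hκ m).ne'
    push_cast
    field_simp
    rw [hN]
    ring
  have h8 : |s m * ‖x‖ ^ 2| ^ 3 * Real.exp |s m * ‖x‖ ^ 2| ≤
      ‖x‖ ^ 6 * Real.exp (‖x‖ ^ 2) * σ ^ 5 := by
    rw [abs_of_nonneg (by positivity), hσs]
    have h9 : σ ^ 2 * ‖x‖ ^ 2 ≤ ‖x‖ ^ 2 :=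
      mul_le_of_le_one_left (by positivity) (pow_le_one₀ hσ0.le hm1')
    calc (σ ^ 2 * ‖x‖ ^ 2) ^ 3 * Real.exp (σ ^ 2 * ‖x‖ ^ 2)
        = σ * (σ ^ 5 * ‖x‖ ^ 6) * Real.exp (σ ^ 2 * ‖x‖ ^ 2) := by ring
      _ ≤ 1 * (σ ^ 5 * ‖x‖ ^ 6) * Real.exp (‖x‖ ^ 2) := by gcongr
      _ = _ := by ring
  have h9 := h6.trans h8
  have h10 : (∑ k ∈ Finset.range 3, (s m * ‖x‖ ^ 2) ^ k / (k.factorial : ℝ)) =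
      1 + s m * ‖x‖ ^ 2 + s m ^ 2 * ‖x‖ ^ 4 / 2 := by
    simp only [Finset.sum_range_succ, Finset.sum_range_zero, Nat.factorial]
    push_cast; ring
  rw [h10] at h9
  rw [h7, norm_mul, norm_mul, norm_inv, norm_inv, Real.norm_of_nonneg (hκ m).le,
    Real.norm_of_nonneg hsm.le, Real.norm_eq_abs]
  have h11 : ∀ A B X : ℝ, |A - B| ≤ |A - X| + |B - X| := fun A B X => by
    rw [abs_sub_comm B X]; exact abs_sub_le _ _ _
  have h12 := (h11 _ _ _).trans (add_le_add h5 h9)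
  calc (κ m)⁻¹ * (s m)⁻¹ * _ ≤ (s m)⁻¹ * (s m)⁻¹ *
        (gC n 5 * (2 * (σ * ‖x‖)) ^ 5 + ‖x‖ ^ 6 * Real.exp (‖x‖ ^ 2) * σ ^ 5) := by
        have := hS.le m
        gcongr
    _ = _ := by
        rw [hσs, hC]; field_simp

end Tube

/-- The limits of the mixed third moments with one transversal factor. -/
structure ThirdMoments (n : ℕ) (ν : Measure (Euc d)) (s : ℕ → ℝ)
    (e : OrthonormalBasis (Fin d) ℝ (Euc d)) (E : Finset (Fin d)) (b : Euc d)
    (B : Fin d → Fin d → Fin d → ℝ) : Prop where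
  lim : ∀ i j k, MLim ν s (fun m y => s m * (⟪e i, y⟫ * ⟪e j, y⟫ * ⟪cN e E k, y⟫)) (B i j k)
  left : ∀ i j k, i ∉ E → B i j k = 0
  mid : ∀ i j k, j ∉ E → B i j k = 0
  right : ∀ i j k, k ∈ E → B i j k = 0
  trace : ∀ k, ∑ i, B i i k = n / 2 * ⟪e k, b⟫

section Tube

variable {ν : Measure (Euc d)} {e : OrthonormalBasis (Fin d) ℝ (Euc d)} {E : Finset (Fin d)}
  {b : Euc d} {s : ℕ → ℝ} {κ : ℕ → ℝ} {a : Euc d} {D : Fin d → Fin d → ℝ}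
  {T B : Fin d → Fin d → Fin d → ℝ} {g : ℝ}

lemma Tube.coordProj_b (hT : Tube n ν e E b) : coordProj e E b = 0 := by
  rw [coordProj]
  exact Finset.sum_eq_zero fun k hk => by rw [hT.perp k hk, zero_smul]

lemma SecondOrder.cubic_right (hS : SecondOrder ν s e E b κ a D T g)
    (hB : ThirdMoments n ν s e E b B) (i j : Fin d) {k : Fin d} (hk : k ∉ E) :
    T i j k = 4 / 3 * g * B i j k := by
  refine (hS.cubic i j k).unique (((hB.lim i j k).seq_mul (hS.ratio.const_mul (4 / 3))))
    fun m y _ => ?_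
  rw [inner_cN_of_notMem hk]; ring

lemma SecondOrder.cubic_rot (hS : SecondOrder ν s e E b κ a D T g) (i j k : Fin d) :
    T i j k = T j k i :=
  (hS.cubic i j k).unique (hS.cubic j k i) fun m y _ => by ring

lemma SecondOrder.cubic_decomp (hS : SecondOrder ν s e E b κ a D T g)
    (hB : ThirdMoments n ν s e E b B) (i j k : Fin d) :
    T i j k = (if i ∈ E then 1 else 0) * (if j ∈ E then 1 else 0) * (if k ∈ E then 1 else 0) *
      T i j k + 4 / 3 * g * (B i j k + B j k i + B k i j) := by
  by_cases hk : k ∈ E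
  · by_cases hj : j ∈ E
    · by_cases hi : i ∈ E
      · rw [hB.right i j k hk, hB.right j k i hi, hB.right k i j hj]; simp [hi, hj, hk]
      · rw [hB.right i j k hk, hB.right k i j hj, hS.cubic_rot, hS.cubic_right hB j k hi]
        simp [hi]
    · rw [hB.right i j k hk, hB.left j k i hj, ← hS.cubic_rot, hS.cubic_right hB k i hj]
      simp [hj]
  · rw [hB.mid j k i hk, hB.left k i j hk, hS.cubic_right hB i j hk]
    simp [hk]

lemma SecondOrder.cb_plane (hS : SecondOrder ν s e E b κ a D T g)
    (hT : Tube n ν e E b) (h : NUnif n ν) (hn : 0 < n) (hs : Scale s) {u : Euc d}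
    (hu : u ∈ coordPlane e E) : cb e T u = 0 := by
  obtain ⟨x, hx, hxu⟩ := hT.growth h hn hs hu
  set w : ℕ → Euc d := fun j => √(s j) • x j with hw
  have hbd : Tendsto (fun j => √(s j) * ⟪x j, b⟫) UF (𝓝 0) := by
    refine squeeze_zero_norm (a := fun j => √(s j) * (d * (2 * ‖b‖) ^ 2)) (fun j => ?_)
      (by simpa using hs.sqrt.mul_const (d * (2 * ‖b‖) ^ 2))
    rw [norm_mul, Real.norm_of_nonneg (Real.sqrt_nonneg _)]
    exact mul_le_mul_of_nonneg_left (hT.inner_b_le (hx j)) (Real.sqrt_nonneg _)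
  have hPc : Continuous (coordProj e E) := by unfold coordProj; fun_prop
  have h1 : Tendsto (fun j => 2 * s j * ⟪w j, a⟫ + √(s j) * qd e D (w j) + cb e T (w j) -
      2 * g * (‖coordProj e E (w j)‖ ^ 2 * (√(s j) * ⟪x j, b⟫) +
        √(s j) * (√(s j) * ⟪x j, b⟫) ^ 2)) UF
      (𝓝 (2 * 0 * ⟪u, a⟫ + 0 * qd e D u + cb e T u -
        2 * g * (‖coordProj e E u‖ ^ 2 * 0 + 0 * 0 ^ 2))) :=
    ((((hs.lim.const_mul 2).mul (((continuous_id.inner continuous_const).tendsto u).comp hxu)).add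
      (hs.sqrt.mul (((continuous_qd e D).tendsto u).comp hxu))).add
      (((continuous_cb e T).tendsto u).comp hxu)).sub
      ((((((hPc.tendsto u).comp hxu).norm.pow 2).mul hbd).add (hs.sqrt.mul (hbd.pow 2))).const_mul _)
  have h2 : 2 * 0 * ⟪u, a⟫ + 0 * qd e D u + cb e T u -
        2 * g * (‖coordProj e E u‖ ^ 2 * 0 + 0 * 0 ^ 2) = cb e T u := by ring
  rw [h2] at h1
  refine tendsto_nhds_unique h1 (tendsto_const_nhds.congr fun j => ?_)
  have h3 := hS.identity hT h hn hs (hx j)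
  have h4 : (‖x j‖ ^ 4 : ℝ) = (2 * ⟪x j, b⟫ + ‖coordProj e E (x j)‖ ^ 2) ^ 2 := by
    rw [← hT.norm_sq (hx j)]; ring
  rw [h4] at h3
  have h5 : s j = √(s j) ^ 2 := (Real.sq_sqrt (hs.pos j).le).symm
  simp only [hw, coordProj_smul, norm_smul, qd_smul, cb_smul, real_inner_smul_left,
    Real.norm_of_nonneg (Real.sqrt_nonneg (s j))]
  generalize √(s j) = σ at *
  rw [h5]
  linear_combination (-σ ^ 3) * h3

lemma cb_decomp (hS : SecondOrder ν s e E b κ a D T g)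
    (hB : ThirdMoments n ν s e E b B) (x : Euc d) :
    cb e T x = cb e T (coordProj e E x) + 4 * g * cb e B x := by
  have h1 : cb e T (coordProj e E x) = cb e (fun i j k => (if i ∈ E then 1 else 0) *
      (if j ∈ E then 1 else 0) * (if k ∈ E then 1 else 0) * T i j k) x := by
    unfold cb
    refine Finset.sum_congr rfl fun i _ => Finset.sum_congr rfl fun j _ =>
      Finset.sum_congr rfl fun k _ => ?_
    simp only [inner_coordProj]
    split_ifs <;> ring
  have h2 : cb e (fun i j k => B j k i) x = cb e B x := by
    unfold cb
    rw [Finset.sum_comm]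
    refine Finset.sum_congr rfl fun j _ => ?_
    rw [Finset.sum_comm]
    exact Finset.sum_congr rfl fun k _ => Finset.sum_congr rfl fun i _ => by ring
  have h3 : cb e (fun i j k => B k i j) x = cb e B x := by
    rw [← h2]
    unfold cb
    rw [Finset.sum_comm]
    refine Finset.sum_congr rfl fun j _ => ?_
    rw [Finset.sum_comm]
    exact Finset.sum_congr rfl fun k _ => Finset.sum_congr rfl fun i _ => by ring
  have h4 : cb e T x = cb e (fun i j k => (if i ∈ E then 1 else 0) *
      (if j ∈ E then 1 else 0) * (if k ∈ E then 1 else 0) * T i j k) x + 4 / 3 * g *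
      (cb e B x + cb e (fun i j k => B j k i) x + cb e (fun i j k => B k i j) x) := by
    unfold cb
    simp only [Finset.mul_sum, ← Finset.sum_add_distrib]
    refine Finset.sum_congr rfl fun i _ => Finset.sum_congr rfl fun j _ =>
      Finset.sum_congr rfl fun k _ => ?_
    conv_lhs => rw [hS.cubic_decomp hB i j k]
    ring
  rw [h4, h1, h2, h3]; ring

/-- The second-order identity on the support. -/
lemma SecondOrder.identity' (hS : SecondOrder ν s e E b κ a D T g)
    (hB : ThirdMoments n ν s e E b B) (hT : Tube n ν e E b) (h : NUnif n ν) (hn : 0 < n)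
    (hs : Scale s) {x : Euc d} (hx : x ∈ msupport ν) :
    2 * ⟪a, x⟫ + qd e D x + 4 * g * cb e B x -
      2 * g * (‖coordProj e E x‖ ^ 2 * ⟪b, x⟫ + ⟪b, x⟫ ^ 2) = 0 := by
  have h3 := hS.identity hT h hn hs hx
  have h4 : (‖x‖ ^ 4 : ℝ) = (2 * ⟪x, b⟫ + ‖coordProj e E x‖ ^ 2) ^ 2 := by
    rw [← hT.norm_sq hx]; ring
  rw [h4, cb_decomp hS hB, hS.cb_plane hT h hn hs (coordProj_mem e E x)] at h3
  rw [real_inner_comm x a, real_inner_comm x b]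
  linear_combination h3

lemma SecondOrder.trace (hS : SecondOrder ν s e E b κ a D T g) (h : NUnif n ν)
    (hT : Tube n ν e E b) (hn : 0 < n) (hs : Scale s) :
    ∑ i, ∑ j, D i j * cP E i j = -4 * g * ‖b‖ ^ 2 := by
  have hP : ∀ m, IsProbabilityMeasure (gM ν (s m)) := fun m => h.gM_prob hn (hs.pos m)
  have h1 : ∑ i, D i i = 0 := by
    refine tendsto_nhds_unique (MLim.sum (t := Finset.univ) fun i => hS.quad i i).lim
      (tendsto_const_nhds.congr fun m => ?_)
    have h2 := h.gM_sq_norm hn (hs.pos m)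
    rw [integral_const_mul] at h2
    have h3 : ∀ y : Euc d, ∑ i, (κ m)⁻¹ * (2 * s m * (⟪e i, y⟫ * ⟪e i, y⟫) - cP E i i) =
        (κ m)⁻¹ * (2 * s m * ‖y‖ ^ 2 - n) := fun y => by
      rw [← Finset.mul_sum, Finset.sum_sub_distrib, ← Finset.mul_sum, ← sum_sq_coord e y]
      simp only [cP_self, Finset.sum_ite_mem, Finset.univ_inter, Finset.sum_const, hT.card,
        nsmul_eq_mul, mul_one, sq]
    simp only [h3]
    rw [integral_const_mul, integral_sub ((h.gM_norm_pow_integrable hn (hs.pos m) 2).const_mul _)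
      (integrable_const _), integral_const_mul]
    simp only [integral_const, probReal_univ, one_smul]
    rw [mul_assoc, h2]; ring
  have h4 : ∑ k ∈ Eᶜ, D k k = 2 * g * (2 * ⟪b, b⟫) := by
    refine (MLim.sum (t := Eᶜ) fun i => hS.quad i i).unique
      ((((hT.mLim_one h hn hs b).const_mul 2)).seq_mul (hS.ratio.const_mul 2)) fun m y hy => ?_
    rw [real_inner_comm, ← hT.tube y hy, Finset.mul_sum]
    refine Finset.sum_congr rfl fun k hk => ?_
    rw [cP_self, if_neg (Finset.mem_compl.1 hk)]; ring
  have h5 : ∑ i, ∑ j, D i j * cP E i j = ∑ i ∈ E, D i i := by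
    rw [← Finset.sum_add_sum_compl E]
    rw [Finset.sum_eq_zero (s := Eᶜ) fun i hi => by simp [cP, Finset.mem_compl.1 hi], add_zero]
    refine Finset.sum_congr rfl fun i hi => ?_
    rw [Finset.sum_eq_single i]
    · rw [cP_self, if_pos hi, mul_one]
    · intro j _ hj
      rw [cP, if_neg fun h => hj h.2.symm, mul_zero]
    · simp
  rw [← Finset.sum_add_sum_compl E, h4, real_inner_self_eq_norm_sq] at h1
  rw [h5]; linarith

lemma ThirdMoments.mLim_cb (hB : ThirdMoments n ν s e E b B) (C : Fin d → Fin d → Fin d → ℝ)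
    (hC : ∀ i j k, k ∈ E → C i j k = 0) :
    MLim ν s (fun m y => s m * cb e C y) (∑ i, ∑ j, ∑ k, C i j k * B i j k) := by
  refine (MLim.sum (t := Finset.univ) fun i => MLim.sum (t := Finset.univ) fun j =>
    MLim.sum (t := Finset.univ) fun k => (hB.lim i j k).const_mul (C i j k)).congr
    (fun m y _ => ?_) rfl
  simp only [cb, Finset.mul_sum]
  refine Finset.sum_congr rfl fun i _ => Finset.sum_congr rfl fun j _ =>
      Finset.sum_congr rfl fun k _ => ?_
  by_cases hk : k ∈ E
  · rw [hC i j k hk]; ring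
  · rw [inner_cN_of_notMem hk]; ring

lemma ThirdMoments.sum_cP (hB : ThirdMoments n ν s e E b B) :
    ∑ i, ∑ j, ∑ k, cP E i j * ⟪e k, b⟫ * B i j k = n / 2 * ‖b‖ ^ 2 := by
  have h1 : ∀ i, ∑ j, ∑ k, cP E i j * ⟪e k, b⟫ * B i j k = ∑ k, ⟪e k, b⟫ * B i i k := fun i => by
    rw [Finset.sum_eq_single i]
    · refine Finset.sum_congr rfl fun k _ => ?_
      rw [cP_self]
      split_ifs with hi
      · ring
      · rw [hB.left i i k hi]; ring
    · intro j _ hj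
      refine Finset.sum_eq_zero fun k _ => ?_
      rw [cP, if_neg fun h => hj h.2.symm]; ring
    · simp
  simp only [h1]
  rw [Finset.sum_comm, ← sum_sq_coord e b, Finset.mul_sum]
  refine Finset.sum_congr rfl fun k _ => ?_
  rw [← Finset.mul_sum, hB.trace]; ring

lemma cb_cP (b y : Euc d) :
    cb e (fun i j k => cP E i j * ⟪e k, b⟫) y = ‖coordProj e E y‖ ^ 2 * ⟪b, y⟫ := by
  rw [← qd_cP, inner_eq_sum e b y]
  simp only [qd, cb, Finset.sum_mul]
  refine Finset.sum_congr rfl fun i _ => Finset.sum_congr rfl fun j _ => ?_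
  rw [Finset.mul_sum]
  exact Finset.sum_congr rfl fun k _ => by ring

/-- Averaging the second-order identity. -/
lemma SecondOrder.average (hS : SecondOrder ν s e E b κ a D T g)
    (hB : ThirdMoments n ν s e E b B) (hT : Tube n ν e E b) (h : NUnif n ν) (hn : 0 < n)
    (hs : Scale s) :
    g * (∑ i, ∑ j, ∑ k, B i j k * B i j k) = g * ((n + 2) / 4 * ‖b‖ ^ 2) := by
  have M1 := (hT.mLim_one h hn hs a).seq_mul (hs.lim.const_mul 4)
  have M2 := MLim.sum (t := Finset.univ) fun i => MLim.sum (t := Finset.univ) fun j =>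
    (hT.mLim_two h hn hs i j).const_mul (2 * D i j)
  have M3 := (hB.mLim_cb B hB.right).const_mul (8 * g)
  have M4 := (hB.mLim_cb (fun i j k => cP E i j * ⟪e k, b⟫)
    (fun i j k hk => by rw [hT.perp k hk, mul_zero])).const_mul (4 * g)
  have M5 := (MLim.qd (e := e) (hT.mLim_two h hn hs) b).const_mul (4 * g)
  have h0 : qd e (fun i j => cP E i j / 2) b = 0 := by
    have h1 : qd e (fun i j => cP E i j / 2) b = qd e (cP E) b / 2 := by
      simp only [qd, Finset.sum_div]
      exact Finset.sum_congr rfl fun i _ => Finset.sum_congr rfl fun j _ => by ring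
    rw [h1, qd_cP, hT.coordProj_b, norm_zero]; simp
  have h2 := (((((M1.add M2).add M3).sub M4).sub M5)).unique (h.mLim_const hn hs 0)
    fun m y hy => by
      have h3 := hS.identity' hB hT h hn hs hy
      have h4 : qd e (fun i j => s m * (⟪e i, y⟫ * ⟪e j, y⟫)) b = s m * ⟪b, y⟫ ^ 2 := by
        rw [← qd_inner e b y]
        simp only [qd, Finset.mul_sum]
        exact Finset.sum_congr rfl fun i _ => Finset.sum_congr rfl fun j _ => by ring
      have h5 : ∑ i, ∑ j, 2 * D i j * (s m * (⟪e i, y⟫ * ⟪e j, y⟫)) = 2 * s m * qd e D y := by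
        simp only [qd, Finset.mul_sum]
        exact Finset.sum_congr rfl fun i _ => Finset.sum_congr rfl fun j _ => by ring
      rw [h4, h5, cb_cP]
      linear_combination (2 * s m) * h3
  have h6 : ∑ i, ∑ j, 2 * D i j * (cP E i j / 2) = -4 * g * ‖b‖ ^ 2 := by
    rw [← hS.trace h hT hn hs]
    exact Finset.sum_congr rfl fun i _ => Finset.sum_congr rfl fun j _ => by ring
  rw [h6, hB.sum_cP, h0] at h2
  linear_combination h2 / 8

lemma SecondOrder.ne_zero (hS : SecondOrder ν s e E b κ a D T g)
    (hB : ThirdMoments n ν s e E b B) (hT : Tube n ν e E b) (h : NUnif n ν) (hn : 0 < n)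
    (hs : Scale s) : g ≠ 0 := by
  intro hg
  have hT0 : ∀ y, cb e T y = 0 := fun y => by
    rw [cb_decomp hS hB, hS.cb_plane hT h hn hs (coordProj_mem e E y), hg]; ring
  have h1 : ∑ i, ∑ j, ∑ k, T i j k * T i j k = 0 := by
    refine (MLim.sum (t := Finset.univ) fun i => MLim.sum (t := Finset.univ) fun j =>
      MLim.sum (t := Finset.univ) fun k => (hS.cubic i j k).const_mul (T i j k)).unique
      (h.mLim_const hn hs 0) fun m y _ => ?_
    have h2 := hT0 y
    calc _ = (κ m)⁻¹ * (4 / 3 * s m ^ 2) * cb e T y := by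
          simp only [cb, Finset.mul_sum]
          exact Finset.sum_congr rfl fun i _ => Finset.sum_congr rfl fun j _ =>
            Finset.sum_congr rfl fun k _ => by ring
      _ = 0 := by rw [h2, mul_zero]
  have hD0 : ∀ y ∈ msupport ν, 2 * ⟪a, y⟫ + qd e D y = 0 := fun y hy => by
    have := hS.identity' hB hT h hn hs hy
    rw [hg] at this
    linarith
  have htr := hS.trace h hT hn hs
  rw [hg, mul_zero, zero_mul] at htr
  have h2 : ∑ i, ∑ j, D i j * D i j = 0 := by
    have h3 := (MLim.sum (t := Finset.univ) fun i => MLim.sum (t := Finset.univ) fun j =>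
      (hS.quad i j).const_mul (D i j)).unique
      ((hT.mLim_one h hn hs a).seq_mul (hS.ratio.const_mul (-4))) fun m y hy => by
        calc _ = (κ m)⁻¹ * (2 * s m * qd e D y - ∑ i, ∑ j, D i j * cP E i j) := by
              simp only [qd, Finset.mul_sum, ← Finset.sum_sub_distrib]
              exact Finset.sum_congr rfl fun i _ => Finset.sum_congr rfl fun j _ => by ring
          _ = _ := by
              rw [htr, sub_zero, show qd e D y = -2 * ⟪a, y⟫ by linarith [hD0 y hy]]
              ring
    rw [h3, hg]; ring
  have hTz : ∀ i j k, T i j k = 0 := fun i j k => by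
    rw [Finset.sum_eq_zero_iff_of_nonneg fun i _ => Finset.sum_nonneg fun j _ =>
      Finset.sum_nonneg fun k _ => mul_self_nonneg _] at h1
    have h3 := h1 i (Finset.mem_univ i)
    rw [Finset.sum_eq_zero_iff_of_nonneg fun j _ => Finset.sum_nonneg fun k _ =>
      mul_self_nonneg _] at h3
    have h4 := h3 j (Finset.mem_univ j)
    rw [Finset.sum_eq_zero_iff_of_nonneg fun k _ => mul_self_nonneg _] at h4
    exact mul_self_eq_zero.1 (h4 k (Finset.mem_univ k))
  have hDz : ∀ i j, D i j = 0 := fun i j => by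
    rw [Finset.sum_eq_zero_iff_of_nonneg fun i _ => Finset.sum_nonneg fun j _ =>
      mul_self_nonneg _] at h2
    have h3 := h2 i (Finset.mem_univ i)
    rw [Finset.sum_eq_zero_iff_of_nonneg fun j _ => mul_self_nonneg _] at h3
    exact mul_self_eq_zero.1 (h3 j (Finset.mem_univ j))
  have ha : a = 0 := by
    have h3 : a ∈ (Submodule.span ℝ (msupport ν))ᗮ := by
      rw [Submodule.mem_orthogonal']
      intro u hu
      induction hu using Submodule.span_induction with
      | mem x hx =>
        have h4 := hD0 x hx
        simp only [qd, hDz, zero_mul, Finset.sum_const_zero, add_zero] at h4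
        linarith
      | zero => exact inner_zero_right _
      | add x y _ _ hx hy => rw [inner_add_right, hx, hy, add_zero]
      | smul c x _ hx => rw [real_inner_smul_right, hx, mul_zero]
    exact inner_self_eq_zero.1 (Submodule.inner_left_of_mem_orthogonal hS.mem h3)
  have h3 := hS.norm
  simp [hg, ha, hTz, hDz] at h3

end Tube

section Tube

variable {ν : Measure (Euc d)} {e : OrthonormalBasis (Fin d) ℝ (Euc d)} {E : Finset (Fin d)}
  {b : Euc d} {s : ℕ → ℝ}

/-- The traceless coefficients of the quadratic model for the transversal coordinates. -/
def qS (E : Finset (Fin d)) (e : OrthonormalBasis (Fin d) ℝ (Euc d)) (b : Euc d)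
    (B : Fin d → Fin d → Fin d → ℝ) (k i j : Fin d) : ℝ := 2 * B i j k - cP E i j * ⟪e k, b⟫

lemma sum_cP_mul (F : Fin d → Fin d → ℝ) (hF : ∀ i j, i ∉ E → F i j = 0) :
    ∑ i, ∑ j, cP E i j * F i j = ∑ i, F i i := by
  refine Finset.sum_congr rfl fun i _ => ?_
  rw [Finset.sum_eq_single i]
  · rw [cP_self]
    split_ifs with hi
    · rw [one_mul]
    · rw [hF i i hi, mul_zero]
  · intro j _ hj
    rw [cP, if_neg fun h => hj h.2.symm, zero_mul]
  · simp

lemma ThirdMoments.qS_left {B} (hB : ThirdMoments n ν s e E b B) {k i j : Fin d} (hi : i ∉ E) :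
    qS E e b B k i j = 0 := by
  rw [qS, hB.left i j k hi, cP, if_neg fun h => hi h.1]; ring

lemma ThirdMoments.symm {B} (hB : ThirdMoments n ν s e E b B) (i j k : Fin d) :
    B i j k = B j i k :=
  (hB.lim i j k).unique (hB.lim j i k) fun m y _ => by ring

lemma ThirdMoments.qS_symm {B} (hB : ThirdMoments n ν s e E b B) (k i j : Fin d) :
    qS E e b B k i j = qS E e b B k j i := by
  rw [qS, qS, hB.symm, cP_comm]

lemma ThirdMoments.qS_trace {B} (hB : ThirdMoments n ν s e E b B) (hT : Tube n ν e E b)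
    (k : Fin d) : ∑ i, qS E e b B k i i = 0 := by
  have h1 : ∑ i, cP E i i = n := by
    simp only [cP_self, Finset.sum_ite_mem, Finset.univ_inter, Finset.sum_const, hT.card,
        nsmul_eq_mul, mul_one]
  simp only [qS]
  rw [Finset.sum_sub_distrib, ← Finset.mul_sum, ← Finset.sum_mul, hB.trace, h1]
  ring

/-- The quadratic model has vanishing trace, so its averaged square is half of its norm squared. -/
lemma Tube.mLim_qd_sq (hT : Tube n ν e E b) (h : NUnif n ν) (hn : 0 < n) (hs : Scale s)
    {S : Fin d → Fin d → ℝ} (hS : ∀ i j, i ∉ E → S i j = 0) (hsymm : ∀ i j, S i j = S j i)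
    (htr : ∑ i, S i i = 0) :
    MLim ν s (fun m y => s m ^ 2 * qd e S y ^ 2) ((∑ i, ∑ j, S i j ^ 2) / 2) := by
  refine (MLim.sum (t := Finset.univ) fun i => MLim.sum (t := Finset.univ) fun j =>
    MLim.sum (t := Finset.univ) fun k => MLim.sum (t := Finset.univ) fun l =>
    (hT.mLim_four h hn hs i j k l).const_mul (S i j * S k l)).congr (fun m y _ => ?_) ?_
  · rw [sq (qd e S y)]
    simp only [qd, Finset.sum_mul, Finset.mul_sum]
    exact Finset.sum_congr rfl fun i _ => Finset.sum_congr rfl fun j _ =>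
      Finset.sum_congr rfl fun k _ => Finset.sum_congr rfl fun l _ => by ring
  · have h1 : ∑ k, ∑ l, cP E k l * S k l = 0 := by
      rw [sum_cP_mul S hS, htr]
    have h2 : ∀ i j, ∑ k, ∑ l, cP E i k * cP E j l * S k l = S i j := fun i j => by
      have h3 : ∀ k, ∑ l, cP E i k * cP E j l * S k l = cP E i k * S k j := fun k => by
        rw [Finset.sum_eq_single j]
        · rw [cP_self]
          split_ifs with hj
          · ring
          · rw [hsymm, hS j k hj]; ring
        · intro l _ hl
          rw [cP_comm E j, cP, cP, if_neg (c := l ∈ E ∧ l = j) fun h => hl h.2]; ring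
        · simp
      simp only [h3]
      rw [Finset.sum_eq_single i]
      · rw [cP_self]
        split_ifs with hi
        · ring
        · rw [hS i j hi]; ring
      · intro k _ hk
        rw [cP, if_neg fun h => hk h.2.symm, zero_mul]
      · simp
    have h4 : ∀ i j, ∑ k, ∑ l, S i j * S k l *
        ((cP E i j * cP E k l + cP E i k * cP E j l + cP E i l * cP E j k) / 4) =
        S i j ^ 2 / 2 := fun i j => by
      have h5 : ∑ k, ∑ l, cP E i l * cP E j k * S k l = S i j := by
        rw [hsymm, ← h2 j i]
        exact Finset.sum_congr rfl fun k _ => Finset.sum_congr rfl fun l _ => by ring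
      calc _ = S i j * cP E i j / 4 * (∑ k, ∑ l, cP E k l * S k l) +
            S i j / 4 * (∑ k, ∑ l, cP E i k * cP E j l * S k l) +
            S i j / 4 * (∑ k, ∑ l, cP E i l * cP E j k * S k l) := by
            simp only [Finset.mul_sum, ← Finset.sum_add_distrib]
            exact Finset.sum_congr rfl fun k _ => Finset.sum_congr rfl fun l _ => by ring
        _ = _ := by rw [h1, h2, h5]; ring
    simp only [h4, Finset.sum_div]

/-- A tube around a plane containing the support of a uniform measure is degenerate. -/
theorem Tube.b_eq_zero (hT : Tube n ν e E b) (h : NUnif n ν) (hn : 0 < n) : b = 0 := by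
  set s : ℕ → ℝ := fun j => 1 / ((j : ℝ) + 1) with hsd
  have hs : Scale s := scale_one_div
  clear_value s
  obtain ⟨κ, a, D, T, g, hS⟩ := hT.exists_secondOrder h hn hs
  obtain ⟨B, hB1, hB2, hB3, hB4, hB5⟩ := hT.exists_third h hn hs
  have hB : ThirdMoments n ν s e E b B := ⟨hB1, hB2, hB3, hB4, hB5⟩
  have hBB := mul_left_cancel₀ (hS.ne_zero hB hT h hn hs) (hS.average hB hT h hn hs)
  have hSn : ∑ k, ∑ i, ∑ j, qS E e b B k i j ^ 2 = 2 * ‖b‖ ^ 2 := by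
    have h1 : ∀ k, ∑ i, ∑ j, qS E e b B k i j ^ 2 =
        4 * (∑ i, ∑ j, B i j k * B i j k) - n * ⟪e k, b⟫ ^ 2 := fun k => by
      have h2 : ∑ i, ∑ j, cP E i j * B i j k = n / 2 * ⟪e k, b⟫ := by
        rw [sum_cP_mul (fun i j => B i j k) fun i j hi => hB2 i j k hi, hB5]
      have h3 : ∑ i, ∑ j, cP E i j * cP E i j = n := by
        rw [sum_cP_mul (cP E) fun i j hi => by rw [cP, if_neg fun h => hi h.1]]
        simp only [cP_self, Finset.sum_ite_mem, Finset.univ_inter, Finset.sum_const, hT.card,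
          nsmul_eq_mul, mul_one]
      calc _ = 4 * (∑ i, ∑ j, B i j k * B i j k) - 4 * ⟪e k, b⟫ * (∑ i, ∑ j, cP E i j * B i j k) +
            ⟪e k, b⟫ ^ 2 * (∑ i, ∑ j, cP E i j * cP E i j) := by
            simp only [qS, Finset.mul_sum, ← Finset.sum_add_distrib, ← Finset.sum_sub_distrib]
            exact Finset.sum_congr rfl fun i _ => Finset.sum_congr rfl fun j _ => by ring
        _ = _ := by rw [h2, h3]; ring
    simp only [h1]
    rw [Finset.sum_sub_distrib, ← Finset.mul_sum, ← Finset.mul_sum, sum_sq_coord]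
    have h4 : ∑ k, ∑ i, ∑ j, B i j k * B i j k = ∑ i, ∑ j, ∑ k, B i j k * B i j k := by
      rw [Finset.sum_comm]
      exact Finset.sum_congr rfl fun i _ => Finset.sum_comm
    rw [h4, hBB]; ring
  have hq : ∀ {s : ℕ → ℝ}, Scale s → MLim ν s
      (fun m y => ∑ k, s m ^ 2 * qd e (qS E e b B k) y ^ 2) (‖b‖ ^ 2) := fun {s} hs' => by
    refine (MLim.sum (t := Finset.univ) fun k => hT.mLim_qd_sq h hn hs' (S := qS E e b B k)
      (fun i j hi => hB.qS_left hi) (hB.qS_symm k) (hB.qS_trace hT k)).congr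
      (fun _ _ _ => rfl) ?_
    rw [← Finset.sum_div, hSn]; ring
  have hcross : MLim ν s (fun m y => ∑ k, (⟪cN e E k, y⟫ - ⟪e k, b⟫) *
      (s m * qd e (qS E e b B k) y)) (‖b‖ ^ 2) := by
    refine (MLim.sum (t := Finset.univ) fun k => MLim.sum (t := Finset.univ) fun i =>
      MLim.sum (t := Finset.univ) fun j => ((hB1 i j k).sub
      ((hT.mLim_two h hn hs i j).const_mul ⟪e k, b⟫)).const_mul (qS E e b B k i j)).congr
      (fun m y _ => ?_) ?_
    · refine Finset.sum_congr rfl fun k _ => ?_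
      simp only [qd, Finset.mul_sum]
      exact Finset.sum_congr rfl fun i _ => Finset.sum_congr rfl fun j _ => by ring
    · rw [show ‖b‖ ^ 2 = (1 / 2) * (2 * ‖b‖ ^ 2) by ring, ← hSn]
      simp only [Finset.mul_sum]
      exact Finset.sum_congr rfl fun k _ => Finset.sum_congr rfl fun i _ =>
        Finset.sum_congr rfl fun j _ => by rw [qS]; ring
  have hu : ∀ y ∈ msupport ν, ∑ k, (⟪cN e E k, y⟫ - ⟪e k, b⟫) ^ 2 = ‖b‖ ^ 2 := fun y hy => by
    have h1 := hT.sum_cN_sq hy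
    have h2 := hT.sum_b_cN y
    calc _ = ∑ k, ⟪cN e E k, y⟫ ^ 2 - 2 * (∑ k, ⟪e k, b⟫ * ⟪cN e E k, y⟫) +
          ∑ k, ⟪e k, b⟫ ^ 2 := by
          rw [Finset.mul_sum, ← Finset.sum_sub_distrib, ← Finset.sum_add_distrib]
          exact Finset.sum_congr rfl fun k _ => by ring
      _ = _ := by rw [h1, h2, sum_sq_coord]; ring
  set V : ℕ → Euc d → ℝ := fun m y =>
    ∑ k, (⟪cN e E k, y⟫ - ⟪e k, b⟫ - s m * qd e (qS E e b B k) y) ^ 2 with hV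
  have hVl : MLim ν s V 0 := by
    refine (((h.mLim_const hn hs (‖b‖ ^ 2)).sub (hcross.const_mul 2)).add (hq hs)).congr
      (fun m y hy => ?_) (by ring)
    rw [← hu y hy, hV, Finset.mul_sum, ← Finset.sum_sub_distrib, ← Finset.sum_add_distrib]
    exact Finset.sum_congr rfl fun k _ => by ring
  have hs2 : Scale fun j => s j * (1 + 1) := hs.mul (by norm_num)
  have hq2 := hq hs2
  set c : ℝ := (1 + 1 : ℝ) ^ (-((n : ℝ) / 2)) with hc
  have hc0 : 0 < c := by positivity
  have hqc : ∀ y m, ∑ k, (s m * (1 + 1)) ^ 2 * qd e (qS E e b B k) y ^ 2 =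
      4 * ∑ k, s m ^ 2 * qd e (qS E e b B k) y ^ 2 := fun y m => by
    rw [Finset.mul_sum]
    exact Finset.sum_congr rfl fun k _ => by ring
  have hlim : Tendsto (fun m => 2 * (∫ y, V m y ∂(gM ν (s m))) +
      c / 2 * ∫ y, ∑ k, (s m * (1 + 1)) ^ 2 * qd e (qS E e b B k) y ^ 2 ∂(gM ν (s m * (1 + 1)))) UF
      (𝓝 (2 * 0 + c / 2 * ‖b‖ ^ 2)) := (hVl.lim.const_mul 2).add (hq2.lim.const_mul _)
  have hle : c * ‖b‖ ^ 2 ≤ 2 * 0 + c / 2 * ‖b‖ ^ 2 := by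
    refine ge_of_tendsto hlim (Eventually.of_forall fun m => ?_)
    have hsm := hs.pos m
    have hP := h.gM_prob hn (hs2.pos m)
    have h1 := h.gM_scale hn hsm (lam := 1) (by norm_num) (fun _ : Euc d => ‖b‖ ^ 2)
    have h2 := h.gM_scale hn hsm (lam := 1) (by norm_num)
      (fun y : Euc d => ∑ k, s m ^ 2 * qd e (qS E e b B k) y ^ 2)
    simp only [smul_eq_mul, integral_const, probReal_univ, neg_mul, one_mul] at h1 h2
    rw [← hc] at h1 h2
    rw [← h1]
    simp only [hqc, integral_const_mul]
    rw [show c / 2 * (4 * ∫ y, ∑ k, s m ^ 2 * qd e (qS E e b B k) y ^ 2 ∂(gM ν (s m * (1 + 1)))) =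
      2 * (c * ∫ y, ∑ k, s m ^ 2 * qd e (qS E e b B k) y ^ 2 ∂(gM ν (s m * (1 + 1)))) by ring,
      ← h2, ← integral_const_mul, ← integral_const_mul]
    have hqi := (hq hs).int m
    have hexp : ∀ y : Euc d, Real.exp (-(s m * ‖y‖ ^ 2)) ≤ 1 := fun y =>
      Real.exp_le_one_iff.2 (by simp only [neg_nonpos]; positivity)
    have hqe : Integrable (fun y => Real.exp (-(s m * ‖y‖ ^ 2)) *
        ∑ k, s m ^ 2 * qd e (qS E e b B k) y ^ 2) (gM ν (s m)) := by
      refine hqi.bdd_mul (c := 1) (by fun_prop) (Eventually.of_forall fun y => ?_)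
      rw [Real.norm_of_nonneg (Real.exp_pos _).le]
      exact hexp y
    rw [← integral_add ((hVl.int m).const_mul _) (hqe.const_mul _)]
    have hP1 := h.gM_prob hn hsm
    refine integral_mono_ae ?_ (((hVl.int m).const_mul _).add (hqe.const_mul _)) ?_
    · refine (integrable_const (‖b‖ ^ 2)).bdd_mul (c := 1) (by fun_prop)
        (Eventually.of_forall fun y => ?_)
      rw [Real.norm_of_nonneg (Real.exp_pos _).le]
      exact hexp y
    · filter_upwards [gM_ae_mem ν (s m)] with y hy
      have h3 : ‖b‖ ^ 2 ≤ 2 * V m y + 2 * ∑ k, s m ^ 2 * qd e (qS E e b B k) y ^ 2 := by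
        rw [← hu y hy, hV, Finset.mul_sum, Finset.mul_sum, ← Finset.sum_add_distrib]
        refine Finset.sum_le_sum fun k _ => ?_
        nlinarith [sq_nonneg (⟪cN e E k, y⟫ - ⟪e k, b⟫ - 2 * (s m * qd e (qS E e b B k) y))]
      have hV0 : 0 ≤ V m y := Finset.sum_nonneg fun k _ => sq_nonneg _
      have h4 := mul_le_mul_of_nonneg_left h3 (Real.exp_pos (-(s m * ‖y‖ ^ 2))).le
      have h5 := mul_le_mul_of_nonneg_right (hexp y) hV0
      linarith
  have h6 : ‖b‖ ^ 2 ≤ 0 := by nlinarith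
  exact norm_eq_zero.1 (pow_eq_zero_iff two_ne_zero |>.1 (le_antisymm h6 (sq_nonneg _)))

theorem Tube.msupport_eq (hT : Tube n ν e E b) (h : NUnif n ν) (hn : 0 < n) :
    msupport ν = coordPlane e E := by
  refine h.flat hn (by rw [finrank_coordPlane, hT.card]) fun x hx k hk => ?_
  have h1 := hT.coord_le hx hk
  rw [hT.b_eq_zero h hn, norm_zero, mul_zero] at h1
  exact abs_nonpos_iff.1 h1

end Tube

/-- A uniform measure that is close to planes at large scales is supported on a plane. -/
theorem NUnif.eq_plane {ν : Measure (Euc d)} (h : NUnif n ν) (hn : 0 < n) (hnd : n ≤ d)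
    (hF : NearPlanes n (msupport ν) (1 / (10 ^ 4 * (d : ℝ) ^ 4))) :
    ∃ L : Submodule ℝ (Euc d), finrank ℝ L = n ∧ msupport ν = L := by
  have hs := scale_one_div.within
  obtain ⟨b, hb, hbs⟩ := h.exists_mom1_limit hn hs
  obtain ⟨e, α, hα, hsum, hQ⟩ := h.exists_mom2_limit hn hs
  obtain ⟨E, hE, hperp, htube⟩ := gap (b := b) hn hnd hα hsum (fun x hx =>
    tendsto_nhds_unique ((h.tendsto_first_order hn hx).comp hs)
      (((tendsto_const_nhds.inner hb).const_mul 2).add (hQ x))) hF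
  have hT : Tube n ν e E b := ⟨hE, hperp, hbs, htube⟩
  exact ⟨coordPlane e E, by rw [finrank_coordPlane, hE], hT.msupport_eq h hn⟩

lemma exists_orthonormal_limit {v : ℕ → Fin n → Euc d} (hv : ∀ j, Orthonormal ℝ (v j)) :
    ∃ u : Fin n → Euc d, Orthonormal ℝ u ∧ ∀ i, Tendsto (fun j => v j i) UF (𝓝 (u i)) := by
  have h1 : ∀ i, ∃ x, Tendsto (fun j => v j i) UF (𝓝 x) := fun i => by
    obtain ⟨x, -, hx⟩ := uf_bdd (f := fun j => v j i) (C := 1)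
      (Eventually.of_forall fun j => ((hv j).1 i).le)
    exact ⟨x, hx⟩
  choose u hu using h1
  refine ⟨u, orthonormal_iff_ite.2 fun i k => ?_, hu⟩
  refine tendsto_nhds_unique ((hu i).inner (hu k)) ?_
  simp only [fun j => orthonormal_iff_ite.1 (hv j) i k]
  exact tendsto_const_nhds

lemma exists_orthonormal_span {V : Submodule ℝ (Euc d)} (hV : finrank ℝ V = n) :
    ∃ v : Fin n → Euc d, Orthonormal ℝ v ∧ Submodule.span ℝ (range v) = V := by
  subst hV
  let B := stdOrthonormalBasis ℝ V
  refine ⟨fun i => (B i : Euc d), B.orthonormal.comp_linearIsometry V.subtypeₗᵢ, ?_⟩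
  have h1 : (range fun i => (B i : Euc d)) = V.subtype '' range B := by
    rw [← range_comp]; rfl
  rw [h1, ← Submodule.map_span, ← B.coe_toBasis, B.toBasis.span_eq, Submodule.map_top,
    Submodule.range_subtype]

lemma mem_span_orthonormal_iff {v : Fin n → Euc d} (hv : Orthonormal ℝ v) {w : Euc d} :
    w ∈ Submodule.span ℝ (range v) ↔ ∑ i, ⟪v i, w⟫ • v i = w := by
  constructor
  · intro hw
    obtain ⟨c, rfl⟩ := (Submodule.mem_span_range_iff_exists_fun ℝ).1 hw
    refine Finset.sum_congr rfl fun i _ => ?_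
    rw [hv.inner_right_fintype]
  · intro hw
    exact (Submodule.mem_span_range_iff_exists_fun ℝ).2 ⟨_, hw⟩

lemma norm_sum_orthonormal {v u : Fin n → Euc d} (hv : Orthonormal ℝ v) (hu : Orthonormal ℝ u)
    (c : Fin n → ℝ) : ‖∑ i, c i • v i‖ = ‖∑ i, c i • u i‖ := by
  rw [← sq_eq_sq₀ (norm_nonneg _) (norm_nonneg _), ← real_inner_self_eq_norm_sq,
    ← real_inner_self_eq_norm_sq, hv.inner_sum, hu.inner_sum]

lemma mem_span_of_tendsto {v : ℕ → Fin n → Euc d} (hv : ∀ j, Orthonormal ℝ (v j))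
    {u : Fin n → Euc d} (hu : Orthonormal ℝ u) (hvu : ∀ i, Tendsto (fun j => v j i) UF (𝓝 (u i)))
    {y : ℕ → Euc d} (hy : ∀ j, y j ∈ Submodule.span ℝ (range (v j))) {q : Euc d}
    (hq : Tendsto y UF (𝓝 q)) : q ∈ Submodule.span ℝ (range u) := by
  refine (mem_span_orthonormal_iff hu).2 (tendsto_nhds_unique (f := y) (l := UF) ?_ hq)
  exact (tendsto_finsetSum _ fun i _ => ((hvu i).inner hq).smul (hvu i)).congr fun j =>
    (mem_span_orthonormal_iff (hv j)).1 (hy j)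

lemma exists_plane (hnd : n ≤ d) : ∃ V : Submodule ℝ (Euc d), finrank ℝ V = n := by
  obtain ⟨E, -, hE⟩ := Finset.exists_subset_card_eq (s := (Finset.univ : Finset (Fin d))) (n := n)
    (by simpa using hnd)
  exact ⟨coordPlane (EuclideanSpace.basisFun (Fin d) ℝ) E, by rw [finrank_coordPlane, hE]⟩

lemma nonempty_nPlanes (hnd : n ≤ d) : Nonempty (nPlanes d n) := by
  obtain ⟨V, hV⟩ := exists_plane hnd
  exact ⟨⟨V.toAffineSubspace, ⟨0, V.zero_mem⟩, by rw [Submodule.toAffineSubspace_direction, hV]⟩⟩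

lemma infDist_nearPlanes_limit (hnd : n ≤ d) {S : ℕ → Set (Euc d)} {T : Set (Euc d)}
    (h0 : ∀ j, (0 : Euc d) ∈ S j)
    (hT : ∀ x, Tendsto (fun j => infDist x (S j)) UF (𝓝 0) → x ∈ T) {R ε : ℝ}
    (H : ∀ᶠ j in UF, ∃ v : Fin n → Euc d, Orthonormal ℝ v ∧
      ∀ w ∈ Submodule.span ℝ (range v), ‖w‖ ≤ 1 → ∃ x ∈ S j, ‖x - R • w‖ ≤ ε * R) :
    ∃ v : Fin n → Euc d, Orthonormal ℝ v ∧
      ∀ w ∈ Submodule.span ℝ (range v), ‖w‖ ≤ 1 → ∃ x ∈ T, ‖x - R • w‖ ≤ ε * R := by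
  let P : ℕ → (Fin n → Euc d) → Prop := fun j v =>
    ∀ w ∈ Submodule.span ℝ (range v), ‖w‖ ≤ 1 → ∃ x ∈ S j, ‖x - R • w‖ ≤ ε * R
  have h1 : ∀ j, ∃ v : Fin n → Euc d, Orthonormal ℝ v ∧
      ((∃ v : Fin n → Euc d, Orthonormal ℝ v ∧ P j v) → P j v) := fun j => by
    by_cases hj : ∃ v : Fin n → Euc d, Orthonormal ℝ v ∧ P j v
    · obtain ⟨v, hv, hP⟩ := hj
      exact ⟨v, hv, fun _ => hP⟩
    · obtain ⟨V, hV⟩ := exists_plane hnd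
      obtain ⟨v, hv, -⟩ := exists_orthonormal_span hV
      exact ⟨v, hv, fun h => absurd h hj⟩
  choose v hv hP using h1
  obtain ⟨u, hu, hvu⟩ := exists_orthonormal_limit hv
  refine ⟨u, hu, fun w hw hw1 => ?_⟩
  obtain ⟨c, rfl⟩ := (Submodule.mem_span_range_iff_exists_fun ℝ).1 hw
  have hwl : Tendsto (fun j => ∑ i, c i • v j i) UF (𝓝 (∑ i, c i • u i)) :=
    tendsto_finsetSum _ fun i _ => (hvu i).const_smul (c i)
  have h2 : ∀ j, ∃ x ∈ S j, (∃ v : Fin n → Euc d, Orthonormal ℝ v ∧ P j v) →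
      ‖x - R • ∑ i, c i • v j i‖ ≤ ε * R := fun j => by
    by_cases hj : ∃ v : Fin n → Euc d, Orthonormal ℝ v ∧ P j v
    · obtain ⟨x, hx, hxe⟩ := hP j hj (∑ i, c i • v j i)
        ((Submodule.mem_span_range_iff_exists_fun ℝ).2 ⟨c, rfl⟩)
        (by rwa [norm_sum_orthonormal (hv j) hu])
      exact ⟨x, hx, fun _ => hxe⟩
    · exact ⟨0, h0 j, fun h => absurd h hj⟩
  choose y hyS hy using h2
  have hy' : ∀ᶠ j in UF, ‖y j - R • ∑ i, c i • v j i‖ ≤ ε * R := H.mono fun j hj => hy j hj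
  obtain ⟨z, hz, hzl⟩ := uf_bdd hy'
  have hyl : Tendsto y UF (𝓝 (z + R • ∑ i, c i • u i)) := by
    refine (hzl.add (hwl.const_smul R)).congr fun j => ?_
    rw [sub_add_cancel]
  exact ⟨_, hT _ (infDist_tendsto_of_seq hyS hyl), by rwa [add_sub_cancel_right]⟩

section Beta

variable {μ : Measure (Euc d)} {x : Euc d} {r : ℝ}

lemma bddAbove_infDist (A S : Set (Euc d)) (hr : 0 < r) :
    BddAbove (range fun y : (A ∩ closedBall x r : Set (Euc d)) => infDist y.1 S / r) := by
  refine ⟨(infDist x S + r) / r, ?_⟩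
  rintro _ ⟨y, rfl⟩
  refine div_le_div_of_nonneg_right ((infDist_le_infDist_add_dist (y := x)).trans ?_) hr.le
  have := y.2.2
  rw [mem_closedBall] at this
  linarith

lemma iSup_infDist_nonneg (A S : Set (Euc d)) (hr : 0 < r) :
    0 ≤ ⨆ y : (A ∩ closedBall x r : Set (Euc d)), infDist y.1 S / r :=
  Real.iSup_nonneg fun _ => div_nonneg infDist_nonneg hr.le

lemma exists_plane_of_jonesBeta_lt (hnd : n ≤ d) (hr : 0 < r) {δ : ℝ}
    (h : jonesBeta n μ x r < δ) : ∃ L ∈ nPlanes d n,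
      ∀ y ∈ msupport μ, dist y x ≤ r → infDist y (L : Set (Euc d)) ≤ δ * r := by
  have := nonempty_nPlanes hnd
  obtain ⟨L, hL⟩ := exists_lt_of_ciInf_lt h
  refine ⟨L.1, L.2, fun y hy hyx => ?_⟩
  rw [← div_le_iff₀ hr]
  exact (le_ciSup (bddAbove_infDist (msupport μ) (L.1 : Set (Euc d)) hr) ⟨y, hy, hyx⟩).trans hL.le

lemma exists_plane_of_bilateralBeta_lt (hnd : n ≤ d) (hr : 0 < r) {δ : ℝ}
    (h : bilateralBeta n μ x r < δ) : ∃ L ∈ nPlanes d n,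
      (∀ y ∈ msupport μ, dist y x ≤ r → infDist y (L : Set (Euc d)) ≤ δ * r) ∧
      ∀ p ∈ L, dist p x ≤ r → infDist p (msupport μ) ≤ δ * r := by
  have := nonempty_nPlanes hnd
  obtain ⟨L, hL⟩ := exists_lt_of_ciInf_lt h
  have h1 := iSup_infDist_nonneg (x := x) (msupport μ) (L.1 : Set (Euc d)) hr
  have h2 := iSup_infDist_nonneg (x := x) (L.1 : Set (Euc d)) (msupport μ) hr
  refine ⟨L.1, L.2, fun y hy hyx => ?_, fun p hp hpx => ?_⟩
  · rw [← div_le_iff₀ hr]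
    exact (le_ciSup (bddAbove_infDist (msupport μ) (L.1 : Set (Euc d)) hr) ⟨y, hy, hyx⟩).trans
      (by linarith)
  · rw [← div_le_iff₀ hr]
    exact (le_ciSup (bddAbove_infDist (L.1 : Set (Euc d)) (msupport μ) hr) ⟨p, hp, hpx⟩).trans
      (by linarith)

lemma bilateralBeta_le {L : AffineSubspace ℝ (Euc d)} (hL : L ∈ nPlanes d n) (hr : 0 < r) {a c : ℝ}
    (ha : 0 ≤ a) (hc : 0 ≤ c)
    (h1 : ∀ y ∈ msupport μ, dist y x ≤ r → infDist y (L : Set (Euc d)) ≤ a * r)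
    (h2 : ∀ p ∈ L, dist p x ≤ r → infDist p (msupport μ) ≤ c * r) :
    bilateralBeta n μ x r ≤ a + c := by
  refine (ciInf_le ⟨0, ?_⟩ ⟨L, hL⟩).trans (add_le_add ?_ ?_)
  · rintro _ ⟨L, rfl⟩
    exact add_nonneg (iSup_infDist_nonneg _ _ hr) (iSup_infDist_nonneg _ _ hr)
  · exact Real.iSup_le (fun y => (div_le_iff₀ hr).2 (h1 y.1 y.2.1 y.2.2)) ha
  · exact Real.iSup_le (fun y => (div_le_iff₀ hr).2 (h2 y.1 y.2.1 y.2.2)) hc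

lemma bilateralBeta_le_of_rescale [IsLocallyFiniteMeasure μ] (hx : x ∈ msupport μ) (hr : 0 < r)
    {L : Submodule ℝ (Euc d)} (hL : finrank ℝ L = n) {a c : ℝ} (ha : 0 ≤ a) (hc : 0 ≤ c)
    (h1 : ∀ y ∈ msupport (rescale μ x r), ‖y‖ ≤ 1 → infDist y (L : Set (Euc d)) ≤ a)
    (h2 : ∀ p ∈ L, ‖p‖ ≤ 1 → infDist p (msupport (rescale μ x r)) ≤ c) :
    bilateralBeta n μ x r ≤ a + c := by
  have hs : ∀ z : Euc d, x + r • (r⁻¹ • (z - x)) = z := fun z => by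
    rw [smul_inv_smul₀ hr.ne', add_sub_cancel]
  have hnorm : ∀ z : Euc d, dist z x ≤ r → ‖r⁻¹ • (z - x)‖ ≤ 1 := fun z hz => by
    rw [norm_smul, norm_inv, Real.norm_of_nonneg hr.le, ← dist_eq_norm]
    exact inv_mul_le_one_of_le₀ hz hr.le
  have hd : ∀ u w : Euc d, dist (x + r • u) (x + r • w) = dist u w * r := fun u w => by
    rw [dist_add_left, dist_smul₀, Real.norm_of_nonneg hr.le, mul_comm]
  refine bilateralBeta_le (L := AffineSubspace.mk' x L)
    ⟨⟨x, AffineSubspace.self_mem_mk' x L⟩, by rw [AffineSubspace.direction_mk', hL]⟩ hr ha hc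
    (fun z hz hzx => ?_) fun p hp hpx => ?_
  · have hy : r⁻¹ • (z - x) ∈ msupport (rescale μ x r) := by
      rw [mem_msupport_rescale μ x hr, hs]; exact hz
    obtain ⟨l, hl, hle⟩ := exists_nearest (S := (L : Set (Euc d))) L.closed_of_finiteDimensional
      ⟨0, L.zero_mem⟩ (r⁻¹ • (z - x))
    have h3 := h1 _ hy (hnorm z hzx)
    have h4 : x + r • l ∈ AffineSubspace.mk' x L := by
      rw [AffineSubspace.mem_mk']
      simpa using L.smul_mem r hl
    refine (infDist_le_dist_of_mem h4).trans ?_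
    rw [← hs z, hd, hle]
    exact mul_le_mul_of_nonneg_right h3 hr.le
  · have hpL : r⁻¹ • (p - x) ∈ L := by
      rw [AffineSubspace.mem_mk'] at hp
      exact L.smul_mem _ hp
    have h0 : (0 : Euc d) ∈ msupport (rescale μ x r) := by
      rw [mem_msupport_rescale μ x hr]; simpa using hx
    obtain ⟨y, hy, hye⟩ := exists_nearest (isClosed_msupport (rescale μ x r)) ⟨0, h0⟩
      (r⁻¹ • (p - x))
    refine (infDist_le_dist_of_mem ((mem_msupport_rescale μ x hr y).1 hy)).trans ?_
    rw [← hs p, hd, hye]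
    exact mul_le_mul_of_nonneg_right (h2 _ hpL (hnorm p hpx)) hr.le

/-- Small bilateral beta number at scale `2 * R` yields a frame approximated by the support. -/
lemma exists_frame_of_bilateralBeta [IsLocallyFiniteMeasure μ] (hnd : n ≤ d) (hx : x ∈ msupport μ)
    (hr : 0 < r) {R ε : ℝ} (hR : 0 < R) (hε : 0 < ε) (hε' : ε ≤ 1 / 4)
    (h : bilateralBeta n μ x (2 * R * r) ≤ ε) :
    ∃ v : Fin n → Euc d, Orthonormal ℝ v ∧ ∀ w ∈ Submodule.span ℝ (range v), ‖w‖ ≤ 1 →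
      ∃ y ∈ msupport (rescale μ x r), ‖y - R • w‖ ≤ 8 * ε * R := by
  have hRr : 0 < 2 * R * r := by positivity
  have hRr' : 0 < R * r := by positivity
  obtain ⟨L, hL, h1, h2⟩ := exists_plane_of_bilateralBeta_lt hnd hRr (h.trans_lt
    (show ε < 2 * ε by linarith))
  obtain ⟨v, hv, hvL⟩ := exists_orthonormal_span hL.2
  refine ⟨v, hv, fun w hw hw1 => ?_⟩
  obtain ⟨c, hc, hcx⟩ := exists_nearest (S := (L : Set (Euc d)))
    L.closed_of_finiteDimensional hL.1 x
  have hcx' : dist x c ≤ 4 * ε * (R * r) := by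
    rw [hcx]
    refine (h1 x hx (by rw [dist_self]; exact hRr.le)).trans (le_of_eq (by ring))
  have hp : (R * r) • w + c ∈ L :=
    AffineSubspace.vadd_mem_of_mem_direction (L.direction.smul_mem _ (hvL ▸ hw)) hc
  have hwn : ‖(R * r) • w‖ ≤ R * r := by
    rw [norm_smul, Real.norm_of_nonneg hRr'.le]
    nlinarith [norm_nonneg w]
  have hpx : dist ((R * r) • w + c) x ≤ 2 * R * r := by
    rw [dist_eq_norm, add_sub_assoc]
    rw [dist_comm, dist_eq_norm] at hcx'
    have := norm_add_le ((R * r) • w) (c - x)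
    nlinarith
  obtain ⟨z, hz, hze⟩ := exists_nearest (isClosed_msupport μ) ⟨x, hx⟩ ((R * r) • w + c)
  have hz' : dist ((R * r) • w + c) z ≤ 4 * ε * (R * r) := by
    rw [hze]
    exact (h2 _ hp hpx).trans (le_of_eq (by ring))
  refine ⟨r⁻¹ • (z - x), ?_, ?_⟩
  · rw [mem_msupport_rescale μ x hr, smul_inv_smul₀ hr.ne', add_sub_cancel]; exact hz
  · have h3 : r⁻¹ • (z - x) - R • w = r⁻¹ • (-((R * r) • w + c - z) - (x - c)) := by
      have h4 : R • w = r⁻¹ • ((R * r) • w) := by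
        rw [smul_smul]; congr 1; field_simp
      rw [h4, ← smul_sub]
      congr 1
      abel
    rw [h3, norm_smul, norm_inv, Real.norm_of_nonneg hr.le, inv_mul_le_iff₀ hr]
    rw [dist_eq_norm] at hz' hcx'
    refine (norm_sub_le _ _).trans ?_
    rw [norm_neg]
    linarith

end Beta

/-- If the rescaled supports converge to an `n`-plane in the unit ball, the bilateral beta numbers
tend to zero. -/
lemma eventually_bilateralBeta_le {μ : Measure (Euc d)} [IsLocallyFiniteMeasure μ] {x : ℕ → Euc d}
    {s : ℕ → ℝ} (hx : ∀ j, x j ∈ msupport μ) (hs : ∀ j, 0 < s j) {L : Submodule ℝ (Euc d)}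
    (hL : finrank ℝ L = n)
    (hlim : ∀ y : ℕ → Euc d, (∀ j, y j ∈ msupport (rescale μ (x j) (s j))) → (∀ j, ‖y j‖ ≤ 1) →
      ∀ q, Tendsto y UF (𝓝 q) → q ∈ L)
    (hfill : ∀ p ∈ L, ‖p‖ < 1 →
      Tendsto (fun j => infDist p (msupport (rescale μ (x j) (s j)))) UF (𝓝 0))
    {η : ℝ} (hη : 0 < η) : ∀ᶠ j in UF, bilateralBeta n μ (x j) (s j) ≤ η := by
  have h0 : ∀ j, (0 : Euc d) ∈ msupport (rescale μ (x j) (s j)) := fun j => by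
    rw [mem_msupport_rescale μ _ (hs j)]; simpa using hx j
  have hA : ∀ᶠ j in UF, ∀ y ∈ msupport (rescale μ (x j) (s j)), ‖y‖ ≤ 1 →
      infDist y (L : Set (Euc d)) ≤ η / 2 := by
    by_contra hc
    have hc := uf_not hc
    have h1 : ∀ j, ∃ y ∈ msupport (rescale μ (x j) (s j)), ‖y‖ ≤ 1 ∧
        ((¬ ∀ y ∈ msupport (rescale μ (x j) (s j)), ‖y‖ ≤ 1 → infDist y (L : Set (Euc d)) ≤ η / 2) →
          η / 2 < infDist y (L : Set (Euc d))) := fun j => by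
      by_cases hj : ∀ y ∈ msupport (rescale μ (x j) (s j)), ‖y‖ ≤ 1 →
        infDist y (L : Set (Euc d)) ≤ η / 2
      · exact ⟨0, h0 j, by simp, fun h => absurd hj h⟩
      · have hj' := hj
        push Not at hj'
        obtain ⟨y, hy, hy1, hyd⟩ := hj'
        exact ⟨y, hy, hy1, fun _ => hyd⟩
    choose y hy hy1 hyd using h1
    obtain ⟨q, -, hq⟩ := uf_bdd (Eventually.of_forall hy1)
    have h2 : Tendsto (fun j => infDist (y j) (L : Set (Euc d))) UF
        (𝓝 (infDist q (L : Set (Euc d)))) := ((continuous_infDist_pt _).tendsto q).comp hq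
    rw [infDist_zero_of_mem (hlim y hy hy1 q hq)] at h2
    have h3 := ge_of_tendsto h2 (hc.mono fun j hj => (hyd j hj).le)
    linarith
  have hB : ∀ᶠ j in UF, ∀ p ∈ L, ‖p‖ ≤ 1 →
      infDist p (msupport (rescale μ (x j) (s j))) ≤ η / 2 := by
    by_contra hc
    have hc := uf_not hc
    have h1 : ∀ j, ∃ p ∈ L, ‖p‖ ≤ 1 ∧
        ((¬ ∀ p ∈ L, ‖p‖ ≤ 1 → infDist p (msupport (rescale μ (x j) (s j))) ≤ η / 2) →
          η / 2 < infDist p (msupport (rescale μ (x j) (s j)))) := fun j => by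
      by_cases hj : ∀ p ∈ L, ‖p‖ ≤ 1 → infDist p (msupport (rescale μ (x j) (s j))) ≤ η / 2
      · exact ⟨0, L.zero_mem, by simp, fun h => absurd hj h⟩
      · have hj' := hj
        push Not at hj'
        obtain ⟨p, hp, hp1, hpd⟩ := hj'
        exact ⟨p, hp, hp1, fun _ => hpd⟩
    choose p hp hp1 hpd using h1
    obtain ⟨q, hq1, hq⟩ := uf_bdd (Eventually.of_forall hp1)
    have hqL : q ∈ L := L.closed_of_finiteDimensional.mem_of_tendsto hq (Eventually.of_forall hp)
    set t : ℝ := min (η / 4) (1 / 2) with ht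
    have ht0 : 0 < t := lt_min (by linarith) (by norm_num)
    have ht1 : t ≤ 1 / 2 := min_le_right _ _
    have ht2 : t ≤ η / 4 := min_le_left _ _
    have hq' : ‖(1 - t) • q‖ < 1 := by
      rw [norm_smul, Real.norm_of_nonneg (by linarith)]
      nlinarith [norm_nonneg q]
    have h2 := (hfill _ (L.smul_mem (1 - t) hqL) hq').add (hq.dist (tendsto_const_nhds (x := (1 - t) • q)))
    have h3 := ge_of_tendsto h2 (b := η / 2) (hc.mono fun j hj =>
      (hpd j hj).le.trans infDist_le_infDist_add_dist)
    have h4 : dist q ((1 - t) • q) ≤ t := by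
      rw [dist_eq_norm, sub_smul, one_smul, sub_sub_cancel, norm_smul, Real.norm_of_nonneg ht0.le]
      nlinarith [norm_nonneg q]
    linarith
  filter_upwards [hA, hB] with j hjA hjB
  exact (bilateralBeta_le_of_rescale (hx j) (hs j) hL (by positivity) (by positivity) hjA hjB).trans
    (by linarith)

lemma radius_le (hd : 0 < d) {x : Euc d} {r C : ℝ} (hr : 0 < r)
    (h : closedBall x r ⊆ closedBall 0 C) : r ≤ 2 * C := by
  let u : Euc d := EuclideanSpace.single ⟨0, hd⟩ 1
  have hu : ‖r • u‖ = r := by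
    rw [norm_smul, Real.norm_of_nonneg hr.le]; simp [u]
  have h1 := h (mem_closedBall_self hr.le)
  have h2 := h (show x + r • u ∈ closedBall x r by
    rw [mem_closedBall, dist_eq_norm, add_sub_cancel_left, hu])
  rw [mem_closedBall, dist_zero_right] at h1 h2
  have h3 := norm_sub_le (x + r • u) x
  rw [add_sub_cancel_left, hu] at h3
  linarith

section Scales

variable {μ : Measure (Euc d)} [IsLocallyFiniteMeasure μ] {x : ℕ → Euc d} {r s : ℕ → ℝ} {C : ℝ}

/-- Flat balls remain flat, bilaterally, at comparable scales. -/
lemma eventually_bilateralBeta_le_of_comparable (hn : 0 < n) (hnd : n ≤ d)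
    (hμ : AsympUnif n (fun _ => μ)) (hx : ∀ j, x j ∈ msupport μ) (hxC : ∀ j, ‖x j‖ ≤ C)
    (hs : ∀ j, 0 < s j) (hsr : ∀ j, s j ≤ r j) (hrC : ∀ j, r j ≤ C)
    (hβ : ∀ j, jonesBeta n μ (x j) (r j) ≤ 1 / ((j : ℝ) + 1)) {A : ℝ}
    (hA : ∀ᶠ j in UF, r j ≤ A * s j) {η : ℝ} (hη : 0 < η) :
    ∀ᶠ j in UF, bilateralBeta n μ (x j) (s j) ≤ η := by
  have hr : ∀ j, 0 < r j := fun j => (hs j).trans_le (hsr j)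
  have hpl : ∀ j, ∃ L ∈ nPlanes d n, ∀ y ∈ msupport μ, dist y (x j) ≤ r j →
      infDist y (L : Set (Euc d)) ≤ 2 * (1 / ((j : ℝ) + 1)) * r j := fun j => by
    refine exists_plane_of_jonesBeta_lt hnd (hr j) ((hβ j).trans_lt ?_)
    have : 0 < 1 / ((j : ℝ) + 1) := by positivity
    linarith
  choose P hP hPd using hpl
  choose v hv hvP using fun j => exists_orthonormal_span (hP j).2
  obtain ⟨u, hu, hvu⟩ := exists_orthonormal_limit hv
  have hL : finrank ℝ (Submodule.span ℝ (range u)) = n := by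
    rw [finrank_span_eq_card hu.linearIndependent, Fintype.card_fin]
  choose c hc hcd using fun j => exists_nearest (S := (P j : Set (Euc d)))
    (P j).closed_of_finiteDimensional (hP j).1 (x j)
  have hlim : ∀ y : ℕ → Euc d, (∀ j, y j ∈ msupport (rescale μ (x j) (s j))) →
      (∀ j, ‖y j‖ ≤ 1) → ∀ q, Tendsto y UF (𝓝 q) → q ∈ Submodule.span ℝ (range u) := by
    intro y hy hy1 q hq
    choose a ha had using fun j => exists_nearest (S := (P j : Set (Euc d)))
      (P j).closed_of_finiteDimensional (hP j).1 (x j + s j • y j)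
    have hw : ∀ j, (s j)⁻¹ • (a j - c j) ∈ Submodule.span ℝ (range (v j)) := fun j => by
      rw [hvP]
      exact Submodule.smul_mem _ _ (AffineSubspace.vsub_mem_direction (ha j) (hc j))
    refine mem_span_of_tendsto hv hu hvu hw ?_
    have h1 : Tendsto (fun j => y j - (s j)⁻¹ • (a j - c j)) UF (𝓝 0) := by
      refine squeeze_zero_norm' (a := fun j : ℕ => 4 * A * (1 / ((j : ℝ) + 1))) ?_
        (by simpa using uf_one_div.const_mul (4 * A))
      filter_upwards [hA] with j hj
      have h2 : y j - (s j)⁻¹ • (a j - c j) =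
          (s j)⁻¹ • ((x j + s j • y j - a j) - (x j - c j)) := by
        have h3 : y j = (s j)⁻¹ • (s j • y j) := (inv_smul_smul₀ (hs j).ne' _).symm
        nth_rewrite 1 [h3]
        rw [← smul_sub]
        congr 1
        abel
      have h4 := hPd j (x j) (hx j) (by rw [dist_self]; exact (hr j).le)
      have h5 := hPd j _ ((mem_msupport_rescale μ (x j) (hs j) (y j)).1 (hy j)) (by
        rw [dist_eq_norm, add_sub_cancel_left, norm_smul, Real.norm_of_nonneg (hs j).le]
        nlinarith [hy1 j, hs j, hsr j])
      rw [← hcd j, dist_eq_norm] at h4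
      rw [← had j, dist_eq_norm] at h5
      rw [h2, norm_smul, norm_inv, Real.norm_of_nonneg (hs j).le, inv_mul_le_iff₀ (hs j)]
      have h6 : 0 < 1 / ((j : ℝ) + 1) := by positivity
      have h7 := mul_le_mul_of_nonneg_left hj h6.le
      refine (norm_sub_le _ _).trans ?_
      linarith
    simpa using hq.sub h1
  have h0 : ∀ j, (0 : Euc d) ∈ msupport (rescale μ (x j) (s j)) := fun j => by
    rw [mem_msupport_rescale μ _ (hs j)]; simpa using hx j
  have : ∀ j, IsLocallyFiniteMeasure (rescale μ (x j) (s j)) :=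
    fun j => rescale_locFin μ (hx j) (hs j)
  exact eventually_bilateralBeta_le hx hs hL hlim (fun p hp hp1 =>
    no_holes (hμ.rescale hx hxC hs fun j => (hsr j).trans (hrC j)) hn h0 hL one_pos hlim hp hp1) hη

/-- Balls that are flat at all larger comparable scales are flat at vanishing scales. -/
lemma eventually_bilateralBeta_le_of_larger (hn : 0 < n) (hnd : n ≤ d)
    (hμ : AsympUnif n (fun _ => μ)) (hx : ∀ j, x j ∈ msupport μ) (hxC : ∀ j, ‖x j‖ ≤ C)
    (hs : ∀ j, 0 < s j) (hsC : ∀ j, s j ≤ C) (hs0 : Tendsto s UF (𝓝 0)) {ε : ℝ}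
    (hε : 0 < ε) (hε' : 8 * ε ≤ 1 / (10 ^ 4 * (d : ℝ) ^ 4))
    (hlarge : ∀ m : ℕ, ∀ᶠ j in UF, bilateralBeta n μ (x j) (2 * 2 ^ m * s j) ≤ ε)
    {η : ℝ} (hη : 0 < η) : ∀ᶠ j in UF, bilateralBeta n μ (x j) (s j) ≤ η := by
  obtain ⟨ν, hν, hsupp⟩ := exists_blowup hμ hx hxC hs hsC hs0
  have h0 : ∀ j, (0 : Euc d) ∈ msupport (rescale μ (x j) (s j)) := fun j => by
    rw [mem_msupport_rescale μ _ (hs j)]; simpa using hx j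
  have hε4 : ε ≤ 1 / 4 := by
    have hd : (1 : ℝ) ≤ (d : ℝ) ^ 4 := one_le_pow₀ (by exact_mod_cast (hn.trans_le hnd))
    have : 1 / (10 ^ 4 * (d : ℝ) ^ 4) ≤ 1 := by
      rw [div_le_one (by positivity)]; linarith
    linarith
  have hF : NearPlanes n (msupport ν) (1 / (10 ^ 4 * (d : ℝ) ^ 4)) := by
    intro R0
    obtain ⟨m, hm⟩ := pow_unbounded_of_one_lt R0 (one_lt_two (α := ℝ))
    have hm0 : (0 : ℝ) < 2 ^ m := by positivity
    obtain ⟨v, hv, hvw⟩ := infDist_nearPlanes_limit hnd h0 (fun y hy => (hsupp y).2 hy)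
      ((hlarge m).mono fun j hj => exists_frame_of_bilateralBeta hnd (hx j) (hs j) hm0 hε hε4 hj)
    refine ⟨2 ^ m, hm.le, v, hv, fun w hw hw1 => ?_⟩
    obtain ⟨y, hy, hyw⟩ := hvw w hw hw1
    exact ⟨y, hy, hyw.trans (mul_le_mul_of_nonneg_right hε' hm0.le)⟩
  obtain ⟨L, hL, hνL⟩ := hν.eq_plane hn hnd hF
  refine eventually_bilateralBeta_le hx hs hL (fun y hy _ q hq => ?_) (fun p hp _ => ?_) hη
  · rw [← SetLike.mem_coe, ← hνL, hsupp]
    exact infDist_tendsto_of_seq hy hq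
  · rw [← hsupp, hνL]
    exact hp

end Scales

end FlatStab

open FlatStab

theorem flatness_stability_small_scales {d n : ℕ} (hn : 0 < n) (hnd : n ≤ d)
    (μ : Measure (Euc d)) [IsLocallyFiniteMeasure μ]
    (hne : (msupport μ).Nonempty)
    (hdoub : Doubling μ) (haod : AsympOptDoubling n μ)
    (η : ℝ) (hη : 0 < η) (K : Set (Euc d)) (hK : IsCompact K) :
    ∃ δ₁ : ℝ, 0 < δ₁ ∧
      ∀ x₀ ∈ msupport μ ∩ K, ∀ r : ℝ, 0 < r → Metric.closedBall x₀ r ⊆ K →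
        jonesBeta n μ x₀ r ≤ δ₁ →
        ∀ k : ℕ, bilateralBeta n μ x₀ ((2:ℝ) ^ (-(k:ℤ)) * r) ≤ η := by
  by_contra hcon
  push Not at hcon
  have hd : 0 < d := hn.trans_le hnd
  obtain ⟨C, hKC⟩ := hK.isBounded.subset_closedBall (0 : Euc d)
  choose x hx r hr hrK hβ hbad using fun j : ℕ => hcon (1 / ((j : ℝ) + 1)) (by positivity)
  set ε : ℝ := min η (1 / (8 * (10 ^ 4 * (d : ℝ) ^ 4))) with hεdef
  have hε : 0 < ε := lt_min hη (by positivity)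
  have hε' : 8 * ε ≤ 1 / (10 ^ 4 * (d : ℝ) ^ 4) := by
    have h1 : ε ≤ 1 / (8 * (10 ^ 4 * (d : ℝ) ^ 4)) := min_le_right _ _
    have h2 : 1 / (10 ^ 4 * (d : ℝ) ^ 4) = 8 * (1 / (8 * (10 ^ 4 * (d : ℝ) ^ 4))) := by field_simp
    linarith
  have hbad' : ∀ j, ∃ k : ℕ, ε < bilateralBeta n μ (x j) ((2:ℝ) ^ (-(k:ℤ)) * r j) := fun j => by
    obtain ⟨k, hk⟩ := hbad j
    exact ⟨k, (min_le_left _ _).trans_lt hk⟩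
  classical
  let k : ℕ → ℕ := fun j => Nat.find (hbad' j)
  have hk : ∀ j, ε < bilateralBeta n μ (x j) ((2:ℝ) ^ (-(k j:ℤ)) * r j) :=
    fun j => Nat.find_spec (hbad' j)
  have hkmin : ∀ j, ∀ m < k j, bilateralBeta n μ (x j) ((2:ℝ) ^ (-(m:ℤ)) * r j) ≤ ε :=
    fun j m hm => not_lt.1 (Nat.find_min (hbad' j) hm)
  clear_value k
  have hμ := haod.asympUnif
  have hxC : ∀ j, ‖x j‖ ≤ 2 * C := fun j => by
    have h1 := hKC (hx j).2
    rw [mem_closedBall, dist_zero_right] at h1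
    have := norm_nonneg (x j)
    linarith
  have hrC : ∀ j, r j ≤ 2 * C := fun j => radius_le hd (hr j) ((hrK j).trans hKC)
  have hpow : ∀ m : ℕ, (2 : ℝ) ^ (-(m : ℤ)) = (1 / 2) ^ m := fun m => by
    rw [zpow_neg, zpow_natCast, one_div, inv_pow]
  simp only [hpow] at hk hkmin
  have hs : ∀ j, 0 < (1 / 2 : ℝ) ^ k j * r j := fun j => mul_pos (by positivity) (hr j)
  have hsr : ∀ j, (1 / 2 : ℝ) ^ k j * r j ≤ r j := fun j =>
    mul_le_of_le_one_left (hr j).le (pow_le_one₀ (by norm_num) (by norm_num))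
  have hev : ∀ᶠ j in UF, bilateralBeta n μ (x j) ((1 / 2 : ℝ) ^ k j * r j) ≤ ε := by
    by_cases hinf : ∀ m, ∀ᶠ j in UF, m ≤ k j
    · have hk' : Tendsto k UF atTop := tendsto_atTop.2 hinf
      refine eventually_bilateralBeta_le_of_larger hn hnd hμ (fun j => (hx j).1) hxC hs
        (fun j => (hsr j).trans (hrC j)) ?_ hε hε' (fun m => ?_) hε
      · refine squeeze_zero (fun j => (hs j).le) (fun j => mul_le_mul_of_nonneg_left (hrC j)
          (by positivity)) ?_
        simpa using ((tendsto_pow_atTop_nhds_zero_of_lt_one (r := (1 / 2 : ℝ)) (by norm_num)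
          (by norm_num)).comp hk').mul_const (2 * C)
      · filter_upwards [hinf (m + 1)] with j hj
        have h1 := hkmin j (k j - (m + 1)) (by lia)
        have h2 : (1 / 2 : ℝ) ^ (k j - (m + 1)) * r j = 2 * 2 ^ m * ((1 / 2) ^ k j * r j) := by
          obtain ⟨i, hi⟩ := Nat.exists_eq_add_of_le hj
          rw [hi, Nat.add_sub_cancel_left, pow_add, pow_succ]
          have : (1 / 2 : ℝ) ^ m * 2 ^ m = 1 := by rw [← mul_pow]; norm_num
          linear_combination (-(1 / 2 : ℝ) ^ i * r j) * this
        rwa [h2] at h1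
    · push Not at hinf
      obtain ⟨m, hm⟩ := hinf
      refine eventually_bilateralBeta_le_of_comparable hn hnd hμ (fun j => (hx j).1) hxC hs hsr
        hrC hβ (A := 2 ^ m) ?_ hε
      filter_upwards [hm] with j hj
      have h1 : (2 : ℝ) ^ k j ≤ 2 ^ m := pow_le_pow_right₀ (by norm_num) (by lia)
      have h2 : (2 : ℝ) ^ k j * (1 / 2) ^ k j = 1 := by rw [← mul_pow]; norm_num
      calc r j = 2 ^ k j * ((1 / 2) ^ k j * r j) := by rw [← mul_assoc, h2, one_mul]
        _ ≤ _ := mul_le_mul_of_nonneg_right h1 (hs j).le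
  obtain ⟨j, hj⟩ := hev.exists
  exact (hk j).not_ge hj
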